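/- arXiv:2403.12681 — 4 statements merged into one kernel-verified Lean document; each statement's English description precedes it below -/
import Mathlib

section
/- Let k be an algebraically closed field of characteristic zero and R = k[x,y,z] = k^[3] with an ℕ-grading R = ⊕_{i∈ℕ} R_i in which x, y, z are homogeneous of positive degrees. Let f ∈ R be a homogeneous prime element such that Proj(R/fR) is not a unicuspidal rational curve. Then: (a) the quotient ring R/(f − c) is rigid for every c ∈ k; (b) every nonzero locally nilpotent derivation δ of R satisfies δ(f) ≠ 0. -/
open MvPolynomial

set_option synthInstance.maxHeartbeats 400000
set_option maxHeartbeats 1000000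

noncomputable section

/-- `D` is a locally nilpotent derivation: every element is killed by some power of `D`. -/
def IsLND {k B : Type*} [CommRing k] [CommRing B] [Algebra k B]
    (D : Derivation k B B) : Prop :=
  ∀ b : B, ∃ n : ℕ, (⇑D)^[n] b = 0

/-- `B` is rigid: its only locally nilpotent `k`-derivation is the zero derivation. -/
def IsRigid (k B : Type*) [CommRing k] [CommRing B] [Algebra k B] : Prop :=
  ∀ D : Derivation k B B, IsLND D → D = 0

/-- The scheme `Proj ℬ` contains an open subscheme isomorphic to the affine line `𝔸¹_k`.
A projective curve with this property is precisely a unicuspidal rational curve. -/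
def ProjContainsAffineLine (k : Type) [Field k] {A : Type} [CommRing A] [Algebra k A]
    (ℬ : ℕ → Submodule k A) [GradedAlgebra ℬ] : Prop :=
  ∃ U : (AlgebraicGeometry.Proj ℬ).Opens,
    Nonempty (U.toScheme ≅ AlgebraicGeometry.Spec (CommRingCat.of (Polynomial k)))


/-- elements algebraic over a subalgebra killed by a derivation are killed. -/
lemma transc_of_deriv {k B : Type*} [Field k] [CharZero k] [CommRing B] [IsDomain B] [Algebra k B]
    (D : Derivation k B B) (A : Subalgebra k B) (hA : ∀ a ∈ A, D a = 0) (s : B) (hs : D s ≠ 0) :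
    Transcendental A s := by
  have key : ∀ n : ℕ, ∀ p : Polynomial A, p.natDegree ≤ n → Polynomial.aeval s p = 0 → p = 0 := by
    intro n
    induction n with
    | zero =>
      intro p hp h0
      rw [Polynomial.eq_C_of_natDegree_le_zero hp] at h0 ⊢
      rw [Polynomial.aeval_C] at h0
      have : p.coeff 0 = 0 := Subtype.ext h0
      simp [this]
    | succ n ih =>
      intro p hp h0
      have hD : D (Polynomial.aeval s p) = Polynomial.aeval s (Polynomial.derivative p) * D s := by
        clear h0 hp
        induction p using Polynomial.induction_on' with
        | add p q hp hq => simp [hp, hq, add_mul]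
        | monomial m a =>
          have : D (a : B) = 0 := hA _ a.2
          simp [Polynomial.aeval_monomial, Polynomial.derivative_monomial, this,
            Derivation.leibniz_pow]
          ring
      rw [h0, map_zero] at hD
      have h1 : Polynomial.aeval s (Polynomial.derivative p) = 0 := by
        rcases mul_eq_zero.mp hD.symm with h | h
        · exact h
        · exact absurd h hs
      have h2 := ih _ (by have := Polynomial.natDegree_derivative_le p; omega) h1
      have : CharZero A := charZero_of_injective_algebraMap (algebraMap k A).injective
      have h3 := Polynomial.derivative_eq_zero.mp h2
      exact ih p (by omega) h0
  rw [transcendental_iff]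
  intro p hp
  exact key _ p le_rfl hp

lemma mem_of_isAlgebraic {k K : Type*} [Field k] [IsAlgClosed k] [Field K] [Algebra k K]
    {t : K} (h : IsAlgebraic k t) : ∃ c : k, t = algebraMap k K c := by
  have h1 := IsAlgClosed.degree_eq_one_of_irreducible k (minpoly.irreducible h.isIntegral)
  obtain ⟨c, hc⟩ := minpoly.mem_range_of_degree_eq_one k t h1
  exact ⟨c, hc.symm⟩

lemma aeval_fin2 {k B : Type*} [Field k] [CommRing B] [Algebra k B] (a b : B)
    (Q : MvPolynomial (Fin 2) k) :
    aeval ![a, b] Q = ∑ v ∈ Q.support, coeff v Q • (a ^ (v 0) * b ^ (v 1)) := by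
  conv_lhs => rw [Q.as_sum]
  rw [map_sum]
  refine Finset.sum_congr rfl fun v _ => ?_
  rw [aeval_monomial, Finsupp.prod_fintype _ _ (by simp)]
  simp [Algebra.smul_def]

lemma homog_fin2 {k : Type*} [Field k] {Q : MvPolynomial (Fin 2) k} {n : ℕ}
    (hQ : Q.IsHomogeneous n) {v : Fin 2 →₀ ℕ} (hv : v ∈ Q.support) : v 0 + v 1 = n := by
  have := hQ (mem_support_iff.mp hv)
  rw [← this, Finsupp.weight_apply, Finsupp.sum_fintype _ _ (by simp)]
  simp

lemma algIndep_two {k B : Type} [Field k] [IsAlgClosed k] [CommRing B] [IsDomain B] [Algebra k B]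
    (ℬ : ℕ → Submodule k B) [GradedAlgebra ℬ] (e : ℕ) (he : 0 < e) (a b : B)
    (ha : a ∈ ℬ e) (hb : b ∈ ℬ e) (hb0 : b ≠ 0) (hab : ∀ c : k, a ≠ c • b) :
    AlgebraicIndependent k ![a, b] := by
  classical
  rw [algebraicIndependent_iff]
  intro P hP
  have hmem : ∀ n, aeval ![a,b] (homogeneousComponent n P) ∈ ℬ (n * e) := by
    intro n
    have hh := homogeneousComponent_isHomogeneous n P
    rw [aeval_fin2]
    refine Submodule.sum_mem _ fun v hv => Submodule.smul_mem _ _ ?_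
    have h1 := SetLike.mul_mem_graded (SetLike.pow_mem_graded (v 0) ha)
      (SetLike.pow_mem_graded (v 1) hb)
    rw [← homog_fin2 hh hv, add_mul]
    simpa using h1
  have hz : ∀ n, aeval ![a,b] (homogeneousComponent n P) = 0 := by
    intro n
    by_cases hn : n ≤ P.totalDegree
    swap
    · rw [homogeneousComponent_eq_zero _ _ (by omega), map_zero]
    have h1 := congrArg (fun x => ((DirectSum.decompose ℬ x (n * e) : ℬ (n*e)) : B)) hP
    simp only [DirectSum.decompose_zero, DirectSum.zero_apply, ZeroMemClass.coe_zero] at h1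
    rw [← sum_homogeneousComponent P, map_sum, DirectSum.decompose_sum] at h1
    rw [DFinsupp.finsetSum_apply, AddSubmonoidClass.coe_finsetSum] at h1
    rw [Finset.sum_eq_single n] at h1
    · rwa [DirectSum.decompose_of_mem_same _ (hmem n)] at h1
    · intro m _ hmn
      exact DirectSum.decompose_of_mem_ne _ (hmem m) (fun h => hmn (Nat.eq_of_mul_eq_mul_right he h))
    · intro h; simp at h; omega
  let K := FractionRing B
  have hbK : algebraMap B K b ≠ 0 := by simpa using hb0
  set t : K := algebraMap B K a / algebraMap B K b with ht
  have htr : Transcendental k t := by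
    intro halg
    obtain ⟨c, hc⟩ := mem_of_isAlgebraic halg
    apply hab c
    apply IsFractionRing.injective B K
    rw [ht, div_eq_iff hbK] at hc
    rw [hc, Algebra.smul_def, map_mul, ← IsScalarTower.algebraMap_apply]
  have hcz : ∀ n, homogeneousComponent n P = 0 := by
    intro n
    have hh := homogeneousComponent_isHomogeneous n P
    have hzQ := hz n
    generalize homogeneousComponent n P = Q at hh hzQ ⊢
    have hq : aeval ![(Polynomial.X : Polynomial k), 1] Q = 0 := by
      rw [transcendental_iff] at htr
      apply htr
      have h2 := congrArg (algebraMap B K) hzQ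
      rw [map_zero, aeval_fin2, map_sum] at h2
      rw [aeval_fin2, map_sum]
      have h3 : (algebraMap B K b) ^ n * ∑ v ∈ Q.support, Polynomial.aeval t
          (coeff v Q • ((Polynomial.X : Polynomial k) ^ (v 0) * 1 ^ (v 1))) = 0 := by
        rw [← h2, Finset.mul_sum]
        refine Finset.sum_congr rfl fun v hv => ?_
        rw [← homog_fin2 hh hv, map_smul, Algebra.smul_def, Algebra.smul_def, map_mul (algebraMap B K),
          ← IsScalarTower.algebraMap_apply]
        simp only [one_pow, mul_one, map_pow, Polynomial.aeval_X, map_mul]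
        have h4 : algebraMap B K a = t * algebraMap B K b := by rw [ht, div_mul_cancel₀ _ hbK]
        rw [h4]
        ring
      exact (mul_eq_zero.mp h3).resolve_left (pow_ne_zero _ hbK)
    rw [← Polynomial.homogenize_eq_of_isHomogeneous hh hq, Polynomial.homogenize_zero]
  rw [← sum_homogeneousComponent P]
  simp [hcz]

set_option linter.unusedSectionVars false
section core
variable {k B : Type} [Field k] [IsAlgClosed k] [CharZero k] [CommRing B] [IsDomain B] [Algebra k B]

lemma iter_ker_mul (D : Derivation k B B) (a x : B) (ha : D a = 0) (m : ℕ) :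
    (⇑D)^[m] (a * x) = a * (⇑D)^[m] x := by
  induction m generalizing x with
  | zero => rfl
  | succ m ih => rw [Function.iterate_succ_apply, Function.iterate_succ_apply, D.leibniz, ha]; simp [ih]

lemma iter_slice_pow (D : Derivation k B B) (s : B) (hs : D (D s) = 0) (m : ℕ) :
    (⇑D)^[m] (s ^ m) = (m.factorial : B) * (D s) ^ m := by
  induction m with
  | zero => simp
  | succ m ih =>
    have hk : D (((m + 1 : ℕ) : B) * D s) = 0 := by simp [D.leibniz, hs]
    rw [Function.iterate_succ_apply, D.leibniz_pow]
    have : (m + 1) • s ^ (m + 1 - 1) • D s = (((m + 1 : ℕ) : B) * D s) * s ^ m := by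
      simp [nsmul_eq_mul]; ring
    rw [this, iter_ker_mul D _ _ hk, ih, Nat.factorial_succ]
    push_cast; ring

lemma iter_sub' (D : Derivation k B B) (x y : B) (m : ℕ) :
    (⇑D)^[m] (x - y) = (⇑D)^[m] x - (⇑D)^[m] y := by
  induction m generalizing x y with
  | zero => rfl
  | succ m ih => simp [Function.iterate_succ_apply, ih]

lemma iter_zero' (D : Derivation k B B) (m : ℕ) : (⇑D)^[m] 0 = 0 := by
  induction m with
  | zero => rfl
  | succ m ih => simp [Function.iterate_succ_apply, ih]

lemma ker_pow (D : Derivation k B B) (x : B) (hx : D x = 0) (m : ℕ) : D (x ^ m) = 0 := by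
  simp [D.leibniz_pow, hx]

/-- lowering of the order -/
lemma lower_order (D : Derivation k B B) (s b z : B) (hs : D (D s) = 0) (m : ℕ)
    (hb : (⇑D)^[m + 1] b = 0) (hz : D z = 0) :
    (⇑D)^[m] (((m.factorial : B) * (D s) ^ m * z) * b - ((⇑D)^[m] b * z) * s ^ m) = 0 := by
  have h1 : D ((⇑D)^[m] b) = 0 := by rwa [Function.iterate_succ_apply'] at hb
  rw [iter_sub', iter_ker_mul, iter_ker_mul, iter_slice_pow D s hs]
  · ring
  · simp [D.leibniz, h1, hz]
  · simp [D.leibniz, hz, ker_pow D _ hs]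

variable (ℬ : ℕ → Submodule k B) [GradedAlgebra ℬ] (D : Derivation k B B) (N : ℤ)

lemma iter_deg (hD : ∀ i b, b ∈ ℬ i → D b ≠ 0 → ∃ j : ℕ, (j : ℤ) = i + N ∧ D b ∈ ℬ j)
    (i : ℕ) (b : B) (hb : b ∈ ℬ i) (m : ℕ) (hm : (⇑D)^[m] b ≠ 0) :
    ∃ j : ℕ, (j : ℤ) = i + m * N ∧ (⇑D)^[m] b ∈ ℬ j := by
  induction m with
  | zero => exact ⟨i, by simp, hb⟩
  | succ m ih =>
    have h1 : (⇑D)^[m] b ≠ 0 := by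
      intro h; apply hm; rw [Function.iterate_succ_apply', h, map_zero]
    obtain ⟨j, hj, hj2⟩ := ih h1
    rw [Function.iterate_succ_apply'] at hm ⊢
    obtain ⟨l, hl, hl2⟩ := hD j _ hj2 hm
    exact ⟨l, by rw [hl, hj]; push_cast; ring, hl2⟩

lemma exists_slice (hD : ∀ i b, b ∈ ℬ i → D b ≠ 0 → ∃ j : ℕ, (j : ℤ) = i + N ∧ D b ∈ ℬ j)
    (hnil : ∀ i b, b ∈ ℬ i → ∃ n, (⇑D)^[n] b = 0)
    (hne : ∃ i b, b ∈ ℬ i ∧ D b ≠ 0) :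
    ∃ (σ γ : ℕ) (s : B), s ∈ ℬ σ ∧ D s ∈ ℬ γ ∧ (γ : ℤ) = σ + N ∧ D s ≠ 0 ∧ D (D s) = 0 := by
  classical
  obtain ⟨i, b, hb, hb0⟩ := hne
  have hex := hnil i b hb
  obtain ⟨m, hm0, hlt⟩ : ∃ m, (⇑D)^[m] b = 0 ∧ ∀ l < m, (⇑D)^[l] b ≠ 0 :=
    ⟨Nat.find hex, Nat.find_spec hex, fun l hl => Nat.find_min hex hl⟩
  have hm2 : 2 ≤ m := by
    by_contra hcon
    have : m = 0 ∨ m = 1 := by omega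
    rcases this with h | h
    · rw [h] at hm0; apply hb0; simp at hm0; simp [hm0]
    · rw [h] at hm0; exact hb0 hm0
  obtain ⟨l, rfl⟩ : ∃ l, m = l + 2 := ⟨m - 2, by omega⟩
  obtain ⟨σ, _, hσ⟩ := iter_deg ℬ D N hD i b hb l (hlt l (by omega))
  have h1 : D ((⇑D)^[l] b) ≠ 0 := by
    have := hlt (l + 1) (by omega)
    rwa [Function.iterate_succ_apply'] at this
  obtain ⟨γ, hγ, hγ2⟩ := hD σ _ hσ h1
  refine ⟨σ, γ, _, hσ, hγ2, hγ, h1, ?_⟩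
  rwa [Function.iterate_succ_apply', Function.iterate_succ_apply'] at hm0

lemma ker_prop (h0 : ∀ b ∈ ℬ 0, ∃ c : k, b = algebraMap k B c)
    (htr : ∀ v : Option (Fin 2) → B, ¬ AlgebraicIndependent k v)
    (s : B) (hs : D s ≠ 0) (j : ℕ) (a b : B) (ha : a ∈ ℬ j) (hb : b ∈ ℬ j) (hDa : D a = 0)
    (hDb : D b = 0) (hb0 : b ≠ 0) : ∃ c : k, a = c • b := by
  rcases Nat.eq_zero_or_pos j with rfl | hj
  · obtain ⟨c, rfl⟩ := h0 a ha
    obtain ⟨c', rfl⟩ := h0 b hb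
    have : c' ≠ 0 := by rintro rfl; simp at hb0
    refine ⟨c / c', ?_⟩
    rw [Algebra.smul_def, ← map_mul, div_mul_cancel₀ _ this]
  · by_contra hcon
    push Not at hcon
    have h2 := algIndep_two ℬ j hj a b ha hb hb0 hcon
    apply htr _ ((h2.option_iff_transcendental s).mpr ?_)
    apply transc_of_deriv D _ _ s hs
    intro x hx
    induction hx using Algebra.adjoin_induction with
    | mem x hx =>
      obtain ⟨i, rfl⟩ := hx
      fin_cases i
      · exact hDa
      · exact hDb
    | algebraMap r => simp
    | add x y _ _ hx hy => simp [hx, hy]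
    | mul x y _ _ hx hy => simp [D.leibniz, hx, hy]

lemma exists_ker_pos (hD : ∀ i b, b ∈ ℬ i → D b ≠ 0 → ∃ j : ℕ, (j : ℤ) = i + N ∧ D b ∈ ℬ j)
    (hnil : ∀ i b, b ∈ ℬ i → ∃ n, (⇑D)^[n] b = 0)
    (h0 : ∀ b ∈ ℬ 0, ∃ c : k, b = algebraMap k B c)
    (hgen : ∀ s : B, ∃ i b, b ∈ ℬ i ∧ b ∉ Algebra.adjoin k {s})
    (σ γ : ℕ) (s : B) (hsσ : s ∈ ℬ σ) (hgγ : D s ∈ ℬ γ)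
    (hγ : (γ : ℤ) = σ + N) (hs : D s ≠ 0) (hss : D (D s) = 0) :
    ∃ e h, 0 < e ∧ h ∈ ℬ e ∧ h ≠ 0 ∧ D h = 0 := by
  by_contra hcon
  push Not at hcon
  have hcon' : ∀ e h, h ∈ ℬ e → D h = 0 → h ≠ 0 → e = 0 := by
    intro e h he hh hz
    rcases Nat.eq_zero_or_pos e with rfl | hj
    · rfl
    · exact absurd hh (hcon e h hj he hz)
  have hγ0 := hcon' γ _ hgγ hss hs
  subst hγ0
  obtain ⟨g, hg⟩ := h0 _ hgγ
  have hg0 : g ≠ 0 := by rintro rfl; simp [hg] at hs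
  have hsadj : s ∈ Algebra.adjoin k {s} := Algebra.subset_adjoin rfl
  have key : ∀ m i (b : B), b ∈ ℬ i → (⇑D)^[m] b = 0 → b ∈ Algebra.adjoin k {s} := by
    intro m
    induction m with
    | zero => intro i b _ hb; simp at hb; rw [hb]; exact zero_mem _
    | succ m ih =>
      intro i b hb hm
      by_cases ha : (⇑D)^[m] b = 0
      · exact ih i b hb ha
      obtain ⟨j, hj, hja⟩ := iter_deg ℬ D N hD i b hb m ha
      have hDa : D ((⇑D)^[m] b) = 0 := by rwa [Function.iterate_succ_apply'] at hm
      have hj0 := hcon' j _ hja hDa ha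
      subst hj0
      obtain ⟨α, hα⟩ := h0 _ hja
      have hi : i = m * σ := by
        have : (i : ℤ) = m * σ := by
          have h1 : N = -σ := by push_cast at hγ; linarith
          rw [h1] at hj; push_cast at hj; linarith
        exact_mod_cast this
      have hlow := lower_order D s b 1 hss m hm (by simp)
      have hr : ((m.factorial : B) * (D s) ^ m * 1) * b - ((⇑D)^[m] b * 1) * s ^ m
          = ((m.factorial : k) * g ^ m) • b - α • s ^ m := by
        rw [hα, hg]; simp [Algebra.smul_def]
      rw [hr] at hlow
      have hsm : s ^ m ∈ ℬ i := by
        have := SetLike.pow_mem_graded m hsσ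
        rw [hi]; simpa using this
      have h2 := ih i _ (Submodule.sub_mem _ (Submodule.smul_mem _ _ hb)
        (Submodule.smul_mem _ _ hsm)) hlow
      have h3 : ((m.factorial : k) * g ^ m) • b ∈ Algebra.adjoin k {s} := by
        have := add_mem h2 (Subalgebra.smul_mem _ (pow_mem hsadj m) α)
        simpa using this
      have hne : ((m.factorial : k) * g ^ m) ≠ 0 :=
        mul_ne_zero (by exact_mod_cast m.factorial_ne_zero) (pow_ne_zero _ hg0)
      have h4 := Subalgebra.smul_mem _ h3 ((m.factorial : k) * g ^ m)⁻¹
      rwa [smul_smul, inv_mul_cancel₀ hne, one_smul] at h4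
  obtain ⟨i, b, hb, hb'⟩ := hgen s
  obtain ⟨n, hn⟩ := hnil i b hb
  exact hb' (key n i b hb hn)

/-- The algebraic core: `B_(h)` is a polynomial ring in one variable. -/
lemma core_main (hD : ∀ i b, b ∈ ℬ i → D b ≠ 0 → ∃ j : ℕ, (j : ℤ) = i + N ∧ D b ∈ ℬ j)
    (hnil : ∀ i b, b ∈ ℬ i → ∃ n, (⇑D)^[n] b = 0)
    (hne : ∃ i b, b ∈ ℬ i ∧ D b ≠ 0)
    (h0 : ∀ b ∈ ℬ 0, ∃ c : k, b = algebraMap k B c)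
    (htr : ∀ v : Option (Fin 2) → B, ¬ AlgebraicIndependent k v)
    (hgen : ∀ s : B, ∃ i b, b ∈ ℬ i ∧ b ∉ Algebra.adjoin k {s})
    (K : Type) [Field K] [Algebra k K] [Algebra B K] [IsScalarTower k B K] [IsFractionRing B K] :
    ∃ (e : ℕ) (h : B) (u : K), 0 < e ∧ h ∈ ℬ e ∧ h ≠ 0 ∧ Transcendental k u ∧
      (∃ n b, b ∈ ℬ (n * e) ∧ u = algebraMap B K b / algebraMap B K h ^ n) ∧
      ∀ n b, b ∈ ℬ (n * e) → ∃ p : Polynomial k,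
        algebraMap B K b / algebraMap B K h ^ n = Polynomial.aeval u p := by
  classical
  obtain ⟨σ, γ, s, hsσ, hgγ, hγ, hs, hss⟩ := exists_slice ℬ D N hD hnil hne
  obtain ⟨e, h, he, hhe, hh0, hDh⟩ := exists_ker_pos ℬ D N hD hnil h0 hgen σ γ s hsσ hgγ hγ hs hss
  have prop := ker_prop ℬ D h0 htr s hs
  have hinj := IsFractionRing.injective B K
  have hhK : algebraMap B K h ≠ 0 := by simpa using hh0
  have hpow : ∀ {x : B} {i : ℕ} (m : ℕ), x ∈ ℬ i → x ^ m ∈ ℬ (m * i) := by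
    intro x i m hx
    simpa using SetLike.pow_mem_graded m hx
  have hmul : ∀ {x y : B} {i j : ℕ}, x ∈ ℬ i → y ∈ ℬ j → x * y ∈ ℬ (i + j) :=
    fun hx hy => SetLike.mul_mem_graded hx hy
  have hkm : ∀ {x y : B}, D x = 0 → D y = 0 → D (x * y) = 0 := by
    intro x y hx hy; simp [D.leibniz, hx, hy]
  -- the set of exponents
  let J : ℕ → Prop := fun j => ∃ (a : B) (i n : ℕ), a ∈ ℬ i ∧ a ≠ 0 ∧ D a = 0 ∧ i + j * σ = n * e
  have hJe : ∃ j, 0 < j ∧ J j :=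
    ⟨e, he, 1, 0, σ, SetLike.one_mem_graded ℬ, one_ne_zero, by simp, by ring⟩
  obtain ⟨j0, ⟨hj0, a0, i0, n0, ha0, ha00, hDa0, hdeg0⟩, hmin⟩ :
      ∃ j, (0 < j ∧ J j) ∧ ∀ l < j, ¬ (0 < l ∧ J l) :=
    ⟨Nat.find hJe, Nat.find_spec hJe, fun l hl => Nat.find_min hJe hl⟩
  have hdvd : ∀ j, J j → j0 ∣ j := by
    intro j
    induction j using Nat.strong_induction_on with
    | _ j ih =>
      intro hj
      rcases Nat.eq_zero_or_pos j with rfl | hjp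
      · exact dvd_zero _
      have hle : j0 ≤ j := by
        by_contra hlt
        exact hmin j (by omega) ⟨hjp, hj⟩
      obtain ⟨a, i, n, ha, ha', hDa, hdeg⟩ := hj
      have : J (j - j0) := by
        obtain ⟨e', rfl⟩ : ∃ e', e = e' + 1 := ⟨e - 1, by omega⟩
        obtain ⟨l, rfl⟩ : ∃ l, j = j0 + l := ⟨j - j0, by omega⟩
        have hz : (i : ℤ) + e' * i0 + l * σ = (n - n0 + i0) * (e' + 1) := by
          zify at hdeg hdeg0
          linear_combination hdeg - hdeg0
        have hnn : 0 ≤ (n : ℤ) - n0 + i0 := by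
          by_contra hneg
          push Not at hneg
          have h1 : ((n : ℤ) - n0 + i0) * (e' + 1) < 0 := mul_neg_of_neg_of_pos hneg (by positivity)
          have h2 : 0 ≤ (i : ℤ) + e' * i0 + l * σ := by positivity
          linarith
        obtain ⟨n', hn'⟩ := Int.eq_ofNat_of_zero_le hnn
        refine ⟨a * a0 ^ e', i + e' * i0, n', hmul ha (hpow e' ha0),
          mul_ne_zero ha' (pow_ne_zero _ ha00), hkm hDa (ker_pow D _ hDa0 _), ?_⟩
        rw [hn'] at hz
        have : j0 + l - j0 = l := by omega
        rw [this]
        exact_mod_cast hz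
      have := ih _ (by omega) this
      have h2 := Nat.dvd_add this (dvd_refl j0)
      rwa [Nat.sub_add_cancel hle] at h2
  set u : K := algebraMap B K (a0 * s ^ j0) / algebraMap B K h ^ n0 with hu
  have hs0 : s ≠ 0 := by rintro rfl; simp at hs
  have hmono : ∀ (a : B) (i j n : ℕ), a ∈ ℬ i → D a = 0 → i + j * σ = n * e →
      ∃ p : Polynomial k, algebraMap B K (a * s ^ j) / algebraMap B K h ^ n = Polynomial.aeval u p := by
    intro a i j n ha hDa hdeg
    by_cases hz : a = 0
    · exact ⟨0, by simp [hz]⟩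
    obtain ⟨q, rfl⟩ := hdvd j ⟨a, i, n, ha, hz, hDa, hdeg⟩
    have hd1 : i + (q * n0) * e = q * i0 + n * e := by
      zify at hdeg hdeg0 ⊢
      linear_combination hdeg - q * hdeg0
    obtain ⟨c, hc⟩ := prop (i + (q * n0) * e) (a * h ^ (q * n0)) (a0 ^ q * h ^ n)
      (hmul ha (hpow _ hhe)) (by rw [hd1]; exact hmul (hpow _ ha0) (hpow _ hhe))
      (hkm hDa (ker_pow D _ hDh _)) (hkm (ker_pow D _ hDa0 _) (ker_pow D _ hDh _))
      (mul_ne_zero (pow_ne_zero _ ha00) (pow_ne_zero _ hh0))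
    refine ⟨Polynomial.C c * Polynomial.X ^ q, ?_⟩
    have hcK := congrArg (algebraMap B K) hc
    rw [Algebra.smul_def] at hcK
    simp only [map_mul, map_pow, ← IsScalarTower.algebraMap_apply] at hcK
    simp only [map_mul, map_pow, Polynomial.aeval_C, Polynomial.aeval_X]
    rw [hu, div_pow, ← pow_mul, mul_comm n0 q, mul_div_assoc', div_eq_div_iff (pow_ne_zero _ hhK)
      (pow_ne_zero _ hhK)]
    simp only [map_mul, map_pow]
    rw [pow_mul]
    linear_combination (algebraMap B K s ^ j0) ^ q * hcK
  refine ⟨e, h, u, he, hhe, hh0, ?_, ⟨n0, a0 * s ^ j0, ?_, hu⟩, ?_⟩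
  · intro halg
    obtain ⟨c, hc⟩ := mem_of_isAlgebraic halg
    rw [hu, div_eq_iff (pow_ne_zero _ hhK), IsScalarTower.algebraMap_apply k B K, ← map_pow,
      ← map_mul] at hc
    have hc := congrArg D (hinj hc)
    rw [D.leibniz, D.leibniz, ker_pow D _ hDh, hDa0, D.leibniz_pow] at hc
    simp only [mul_zero, D.map_algebraMap, add_zero, smul_eq_mul, nsmul_eq_mul] at hc
    have : CharZero B := charZero_of_injective_algebraMap (algebraMap k B).injective
    have h1 : (j0 : B) ≠ 0 := by exact_mod_cast hj0.ne'
    exact mul_ne_zero ha00 (mul_ne_zero h1 (mul_ne_zero (pow_ne_zero _ hs0) hs)) hc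
  · rw [← hdeg0]; exact hmul ha0 (hpow _ hsσ)
  · have key : ∀ m n b, b ∈ ℬ (n * e) → (⇑D)^[m] b = 0 → ∃ p : Polynomial k,
        algebraMap B K b / algebraMap B K h ^ n = Polynomial.aeval u p := by
      intro m
      induction m with
      | zero => intro n b _ hb; simp at hb; exact ⟨0, by simp [hb]⟩
      | succ m ih =>
        intro n b hb hm
        by_cases ha : (⇑D)^[m] b = 0
        · exact ih n b hb ha
        obtain ⟨i, hi, hia⟩ := iter_deg ℬ D N hD _ b hb m ha
        have hDa : D ((⇑D)^[m] b) = 0 := by rwa [Function.iterate_succ_apply'] at hm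
        obtain ⟨e', he'⟩ : ∃ e', e = e' + 1 := ⟨e - 1, by omega⟩
        have hDz : D ((D s) ^ (m * e')) = 0 := ker_pow D _ hss _
        have hlow := lower_order D s b ((D s) ^ (m * e')) hss m hm hDz
        set a := (⇑D)^[m] b
        have hza : a * D s ^ (m * e') ∈ ℬ (i + m * e' * γ) := hmul hia (hpow _ hgγ)
        have hdeg : (i + m * e' * γ) + m * σ = (n + m * γ) * e := by
          zify
          rw [hi, he']
          push_cast [he']
          have : N = γ - σ := by linarith
          rw [this]; ring
        obtain ⟨p1, hp1⟩ := hmono _ _ m (n + m * γ) hza (hkm hDa hDz) hdeg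
        have hge : D s ^ m * D s ^ (m * e') = D s ^ (m * e) := by rw [he']; ring
        obtain ⟨c, hc⟩ := prop ((m * γ) * e) (h ^ (m * γ)) (D s ^ (m * e)) (hpow _ hhe)
          (by have := hpow (m * e) hgγ; rwa [show m * e * γ = m * γ * e by ring] at this)
          (ker_pow D _ hDh _) (ker_pow D _ hss _) (pow_ne_zero _ hs)
        have hmem : ((m.factorial : B) * (D s) ^ m * D s ^ (m * e')) * b
            - (a * D s ^ (m * e')) * s ^ m ∈ ℬ ((n + m * γ) * e) := by
          refine Submodule.sub_mem _ ?_ ?_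
          · rw [mul_assoc (m.factorial : B), hge, mul_assoc, ← nsmul_eq_mul]
            refine Submodule.smul_of_tower_mem _ _ ?_
            have := hmul (hpow (m * e) hgγ) hb
            rwa [show m * e * γ + n * e = (n + m * γ) * e by ring] at this
          · rw [← hdeg]; exact hmul hza (hpow _ hsσ)
        obtain ⟨p2, hp2⟩ := ih _ _ hmem hlow
        have hfac : (m.factorial : k) ≠ 0 := by exact_mod_cast m.factorial_ne_zero
        refine ⟨Polynomial.C (c * (m.factorial : k)⁻¹) * (p1 + p2), ?_⟩
        rw [map_mul, map_add, ← hp1, ← hp2, ← add_div, ← map_add, add_sub_cancel,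
          mul_assoc (m.factorial : B), hge, Polynomial.aeval_C, mul_div_assoc',
          div_eq_div_iff (pow_ne_zero _ hhK) (pow_ne_zero _ hhK)]
        have hcK := congrArg (algebraMap B K) hc
        rw [Algebra.smul_def] at hcK
        simp only [map_mul, map_pow, ← IsScalarTower.algebraMap_apply] at hcK
        have hf : algebraMap k K (m.factorial : k)⁻¹ * (m.factorial : K) = 1 := by
          rw [← map_natCast (algebraMap k K), ← map_mul, inv_mul_cancel₀ hfac, map_one]
        simp only [map_mul, map_pow, map_natCast]
        rw [pow_add, hcK]
        linear_combination (-algebraMap B K b * algebraMap B K h ^ n * algebraMap k K c * (algebraMap B K (D s)) ^ (m * e)) * hf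
    intro n b hb
    obtain ⟨m, hm⟩ := hnil _ b hb
    exact key m n b hb hm
end core
lemma equiv_of_range {X Y Z : Type} [CommRing X] [CommRing Y] [CommRing Z] (φ : X →+* Z)
    (ψ : Y →+* Z) (hφ : Function.Injective φ) (hψ : Function.Injective ψ)
    (h1 : ∀ x, ∃ y, ψ y = φ x) (h2 : ∀ y, ∃ x, φ x = ψ y) : Nonempty (X ≃+* Y) := by
  have hr : φ.range = ψ.range := by
    ext z
    simp only [RingHom.mem_range]
    constructor
    · rintro ⟨x, rfl⟩; exact h1 x
    · rintro ⟨x, rfl⟩; exact h2 x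
  have e1 : X ≃+* φ.range := RingEquiv.ofBijective φ.rangeRestrict
    ⟨fun a b h => hφ (congrArg Subtype.val h), φ.rangeRestrict_surjective⟩
  have e2 : Y ≃+* ψ.range := RingEquiv.ofBijective ψ.rangeRestrict
    ⟨fun a b h => hψ (congrArg Subtype.val h), ψ.rangeRestrict_surjective⟩
  rw [← hr] at e2
  exact ⟨e1.trans e2.symm⟩

lemma proj_of_core {k B : Type} [Field k] [CommRing B] [IsDomain B] [Algebra k B]
    (ℬ : ℕ → Submodule k B) [GradedAlgebra ℬ]
    (e : ℕ) (h : B) (u : FractionRing B) (he : 0 < e) (hh : h ∈ ℬ e) (hh0 : h ≠ 0)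
    (hu : Transcendental k u)
    (hu2 : ∃ n b, b ∈ ℬ (n * e) ∧
      u = algebraMap B (FractionRing B) b / algebraMap B (FractionRing B) h ^ n)
    (hsurj : ∀ n b, b ∈ ℬ (n * e) → ∃ p : Polynomial k,
        algebraMap B (FractionRing B) b / algebraMap B (FractionRing B) h ^ n
          = Polynomial.aeval u p) : ProjContainsAffineLine k ℬ := by
  let K := FractionRing B
  have hhK : algebraMap B K h ≠ 0 := by simpa using hh0
  have hunit : ∀ y : Submonoid.powers h, IsUnit (algebraMap B K y) := by
    rintro ⟨_, n, rfl⟩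
    rw [map_pow]
    exact (pow_ne_zero _ hhK).isUnit
  let L : Localization (Submonoid.powers h) →+* K := IsLocalization.lift hunit
  have hL : Function.Injective L := by
    rw [IsLocalization.lift_injective_iff]
    intro x y
    rw [(IsLocalization.injective (Localization (Submonoid.powers h))
      (powers_le_nonZeroDivisors_of_noZeroDivisors hh0)).eq_iff,
      (IsFractionRing.injective B K).eq_iff]
  let Ψ : HomogeneousLocalization.Away ℬ h →+* K :=
    L.comp (algebraMap (HomogeneousLocalization.Away ℬ h) (Localization (Submonoid.powers h)))
  have hΨ : Function.Injective Ψ := hL.comp (HomogeneousLocalization.val_injective _)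
  have hΨmk : ∀ n b (hb : b ∈ ℬ (n • e)), Ψ (HomogeneousLocalization.Away.mk ℬ hh n b hb) =
      algebraMap B K b / algebraMap B K h ^ n := by
    intro n b hb
    change L (HomogeneousLocalization.Away.mk ℬ hh n b hb).val = _
    rw [HomogeneousLocalization.Away.val_mk, eq_div_iff (pow_ne_zero _ hhK),
      Localization.mk_eq_mk', mul_comm, ← map_pow]
    exact ((IsLocalization.lift_mk'_spec (g := algebraMap B K) (hg := hunit) b _ ⟨h ^ n, n, rfl⟩).mp rfl).symm
  obtain ⟨f⟩ := equiv_of_range Ψ (Polynomial.aeval (R := k) u).toRingHom hΨ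
    (transcendental_iff_injective.mp hu) (by
      intro x
      obtain ⟨n, b, hb, rfl⟩ := HomogeneousLocalization.Away.mk_surjective ℬ hh x
      obtain ⟨p, hp⟩ := hsurj n b (by simpa using hb)
      exact ⟨p, by rw [hΨmk]; exact hp.symm⟩) (by
      intro p
      change ∃ x, Ψ x = Polynomial.aeval u p
      change Polynomial.aeval u p ∈ Ψ.range
      induction p using Polynomial.induction_on' with
      | add p q hp hq => rw [map_add]; exact add_mem hp hq
      | monomial n a =>
        rw [Polynomial.aeval_monomial]
        refine mul_mem ?_ (pow_mem ?_ n)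
        · refine ⟨HomogeneousLocalization.Away.mk ℬ hh 0 (algebraMap k B a) ?_, ?_⟩
          · simpa using SetLike.algebraMap_mem_graded ℬ a
          · rw [hΨmk]
            simp only [pow_zero, div_one]
            exact (IsScalarTower.algebraMap_apply k B K a).symm
        · obtain ⟨m, b, hb, hub⟩ := hu2
          exact ⟨HomogeneousLocalization.Away.mk ℬ hh m b (by simpa using hb), by
            rw [hΨmk]; exact hub.symm⟩)
  refine ⟨AlgebraicGeometry.Proj.basicOpen ℬ h, ⟨?_⟩⟩
  refine AlgebraicGeometry.Proj.basicOpenIsoSpec ℬ h hh he ≪≫ ?_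
  exact AlgebraicGeometry.Scheme.Spec.mapIso (RingEquiv.toCommRingCatIso f.symm).op

section red
variable {k : Type} [Field k]

/-- polynomials all of whose monomials have weight in `T` -/
def Sub3 (W : Fin 3 → ℤ) (T : Set ℤ) : Submodule k (MvPolynomial (Fin 3) k) where
  carrier := {p | ∀ m, coeff m p ≠ 0 → Finsupp.weight W m ∈ T}
  zero_mem' := by intro m h; simp at h
  add_mem' := by
    intro p q hp hq m h
    by_cases h1 : coeff m p = 0
    · refine hq m fun h2 => h ?_
      simp [h1, h2]
    · exact hp m h1
  smul_mem' := by
    intro c p hp m h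
    refine hp m fun h2 => h ?_
    simp [h2]

variable {W : Fin 3 → ℤ}

lemma sub3_mono {S T : Set ℤ} (h : S ⊆ T) {p : MvPolynomial (Fin 3) k} (hp : p ∈ Sub3 W S) :
    p ∈ Sub3 W T := fun m hm => h (hp m hm)

lemma sub3_monomial {T : Set ℤ} (v : Fin 3 →₀ ℕ) (c : k) (h : c ≠ 0 → Finsupp.weight W v ∈ T) :
    monomial v c ∈ Sub3 W T := by
  classical
  intro m hm
  rw [coeff_monomial] at hm
  by_cases hv : v = m
  · subst hv; simp at hm; exact h hm
  · simp [hv] at hm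

lemma sub3_mul {S T U : Set ℤ} (h : ∀ s ∈ S, ∀ t ∈ T, s + t ∈ U) {p q : MvPolynomial (Fin 3) k}
    (hp : p ∈ Sub3 W S) (hq : q ∈ Sub3 W T) : p * q ∈ Sub3 W U := by
  classical
  intro m hm
  rw [coeff_mul] at hm
  obtain ⟨⟨a, b⟩, hab, hne⟩ := Finset.exists_ne_zero_of_sum_ne_zero hm
  rw [Finset.HasAntidiagonal.mem_antidiagonal] at hab
  simp only at hab hne
  rw [← hab, map_add]
  exact h _ (hp a (left_ne_zero_of_mul hne)) _ (hq b (right_ne_zero_of_mul hne))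

lemma sub3_pderiv {S T : Set ℤ} (i : Fin 3) (h : ∀ s ∈ S, s - W i ∈ T)
    {p : MvPolynomial (Fin 3) k} (hp : p ∈ Sub3 W S) : pderiv i p ∈ Sub3 W T := by
  classical
  rw [p.as_sum, map_sum]
  refine Submodule.sum_mem _ fun v hv => ?_
  rw [pderiv_monomial]
  refine sub3_monomial _ _ fun hc => ?_
  have hvi : v i ≠ 0 := by
    intro h0; simp [h0] at hc
  have h1 : v - Finsupp.single i 1 + Finsupp.single i 1 = v :=
    tsub_add_cancel_of_le (by rw [Finsupp.single_le_iff]; omega)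
  have h2 := congrArg (Finsupp.weight W) h1
  rw [map_add, Finsupp.weight_single] at h2
  have h3 := h _ (hp v (mem_support_iff.mp hv))
  rw [← h2] at h3
  simpa using h3

lemma deriv_formula (Δ : Derivation k (MvPolynomial (Fin 3) k) (MvPolynomial (Fin 3) k))
    (p : MvPolynomial (Fin 3) k) : Δ p = ∑ i, pderiv i p * Δ (X i) := by
  have : Δ = ∑ i, Δ (X i) • pderiv i := by
    apply MvPolynomial.derivation_ext
    intro j
    fin_cases j <;> simp [Fin.sum_univ_three, pderiv_X]
  conv_lhs => rw [this]
  simp [Fin.sum_univ_three, mul_comm]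

lemma sub3_deriv (Δ : Derivation k (MvPolynomial (Fin 3) k) (MvPolynomial (Fin 3) k))
    {S T : Set ℤ} {U : Fin 3 → Set ℤ} (hΔ : ∀ i, Δ (X i) ∈ Sub3 W (U i))
    (h : ∀ s ∈ S, ∀ i, ∀ t ∈ U i, s - W i + t ∈ T)
    {p : MvPolynomial (Fin 3) k} (hp : p ∈ Sub3 W S) : Δ p ∈ Sub3 W T := by
  rw [deriv_formula]
  refine Submodule.sum_mem _ fun i _ => ?_
  refine sub3_mul (S := {x | ∃ s ∈ S, x = s - W i}) (T := U i) ?_ (sub3_pderiv i ?_ hp) (hΔ i)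
  · rintro _ ⟨s, hs, rfl⟩ t ht
    exact h s hs i t ht
  · intro s hs; exact ⟨s, hs, rfl⟩

lemma sub3_eq_zero {S T : Set ℤ} (h : ∀ s ∈ S, s ∉ T) {p : MvPolynomial (Fin 3) k}
    (hp : p ∈ Sub3 W S) (hq : p ∈ Sub3 W T) : p = 0 := by
  ext m
  by_contra hm
  exact h _ (hp m hm) (hq m hm)

lemma sub3_comp (j : ℤ) (p : MvPolynomial (Fin 3) k) :
    weightedHomogeneousComponent W j p ∈ Sub3 W {j} := by
  intro m hm
  exact weightedHomogeneousComponent_isWeightedHomogeneous j p hm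

lemma sub3_sub_comp (j : ℤ) {p : MvPolynomial (Fin 3) k} (hp : p ∈ Sub3 W (Set.Iic j)) :
    p - weightedHomogeneousComponent W j p ∈ Sub3 W (Set.Iic (j - 1)) := by
  classical
  intro m hm
  rw [coeff_sub, coeff_weightedHomogeneousComponent] at hm
  by_cases h1 : Finsupp.weight W m = j
  · simp [h1] at hm
  · simp only [h1, if_false, sub_zero] at hm
    have := hp m hm
    simp only [Set.mem_Iic] at this ⊢
    omega

lemma sub3_bound (p : MvPolynomial (Fin 3) k) : ∃ n : ℕ, p ∈ Sub3 W (Set.Iic (n : ℤ)) := by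
  refine ⟨∑ m ∈ p.support, (Finsupp.weight W m).natAbs, ?_⟩
  intro m hm
  have h1 := Finset.single_le_sum (f := fun m => (Finsupp.weight W m).natAbs)
    (fun _ _ => Nat.zero_le _) (mem_support_iff.mpr hm)
  simp only [Set.mem_Iic]
  have h2 : (Finsupp.weight W m).natAbs ≤ ∑ m ∈ p.support, (Finsupp.weight W m).natAbs := h1
  omega

lemma sub3_neg (hW : ∀ i, 0 < W i) {T : Set ℤ} (hT : ∀ t ∈ T, t < 0)
    {p : MvPolynomial (Fin 3) k} (hp : p ∈ Sub3 W T) : p = 0 := by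
  ext m
  by_contra hm
  have h1 := hT _ (hp m hm)
  rw [Finsupp.weight_apply, Finsupp.sum_fintype _ _ (by simp)] at h1
  have : 0 ≤ ∑ i, m i • W i := Finset.sum_nonneg fun i _ => by
    have := (hW i).le
    positivity
  omega

variable {f : MvPolynomial (Fin 3) k} {d : ℤ}

lemma quot_bound (hf : f ∈ Sub3 W {d}) (hf0 : f ≠ 0) (hd : 1 ≤ d) (c : k)
    (g : MvPolynomial (Fin 3) k) (M : ℤ) (h : (f - C c) * g ∈ Sub3 W (Set.Iic M)) :
    g ∈ Sub3 W (Set.Iic (M - d)) := by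
  have step : ∀ n : ℕ, g ∈ Sub3 W (Set.Iic (M - d + n)) → g ∈ Sub3 W (Set.Iic (M - d)) := by
    intro n
    induction n with
    | zero => intro hg; simpa using hg
    | succ n ih =>
      intro hg
      apply ih
      set j : ℤ := M - d + (n + 1 : ℕ) with hj
      set g1 := weightedHomogeneousComponent W j g
      have hg1 : g1 ∈ Sub3 W {j} := sub3_comp j g
      have hg2 : g - g1 ∈ Sub3 W (Set.Iic (j - 1)) := sub3_sub_comp j hg
      have hfg1 : f * g1 ∈ Sub3 W {M + n + 1} := sub3_mul (by
        rintro s rfl t rfl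
        simp only [Set.mem_singleton_iff]; push_cast at hj; omega) hf hg1
      have e1 : f * g1 = (f - C c) * g - f * (g - g1) + c • g := by
        rw [smul_eq_C_mul]; ring
      have h3 : f * g1 ∈ Sub3 W (Set.Iic (M + n)) := by
        rw [e1]
        refine add_mem (sub_mem (sub3_mono ?_ h) (sub3_mul ?_ hf hg2))
          (Submodule.smul_mem _ _ (sub3_mono ?_ hg))
        · exact Set.Iic_subset_Iic.mpr (by omega)
        · rintro s rfl t ht
          simp only [Set.mem_Iic] at ht ⊢; push_cast at hj; omega
        · exact Set.Iic_subset_Iic.mpr (by push_cast at hj; omega)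
      have h4 := sub3_eq_zero (by rintro s rfl; simp) hfg1 h3
      have h5 := (mul_eq_zero.mp h4).resolve_left hf0
      rw [h5, sub_zero] at hg2
      exact sub3_mono (Set.Iic_subset_Iic.mpr (by push_cast at hj; omega)) hg2
  obtain ⟨n, hn⟩ := sub3_bound (W := W) g
  refine step (n + (M - d).natAbs) (sub3_mono (Set.Iic_subset_Iic.mpr ?_) hn)
  rw [Nat.cast_add, Int.natCast_natAbs]
  have := neg_abs_le (M - d)
  omega

lemma lead_dvd (hf : f ∈ Sub3 W {d}) (hf0 : f ≠ 0) (hd : 1 ≤ d) (c : k)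
    {p q : MvPolynomial (Fin 3) k} {M : ℤ} (hp : f - C c ∣ p)
    (hpq : p - q ∈ Sub3 W (Set.Iic (M - 1))) (hq : q ∈ Sub3 W {M}) : f ∣ q := by
  obtain ⟨g, rfl⟩ := hp
  have h1 : (f - C c) * g ∈ Sub3 W (Set.Iic M) := by
    have := add_mem (sub3_mono (Set.Iic_subset_Iic.mpr (by omega : M - 1 ≤ M)) hpq)
      (sub3_mono (by simp : ({M} : Set ℤ) ⊆ Set.Iic M) hq)
    simpa using this
  have hg := quot_bound hf hf0 hd c g M h1
  set g1 := weightedHomogeneousComponent W (M - d) g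
  have hg1 : g1 ∈ Sub3 W {M - d} := sub3_comp _ g
  have hg2 : g - g1 ∈ Sub3 W (Set.Iic (M - d - 1)) := sub3_sub_comp _ hg
  have e1 : f * g1 - q = ((f - C c) * g - q) - f * (g - g1) + c • g := by
    rw [smul_eq_C_mul]; ring
  have h3 : f * g1 - q ∈ Sub3 W (Set.Iic (M - 1)) := by
    rw [e1]
    refine add_mem (sub_mem hpq (sub3_mul ?_ hf hg2)) (Submodule.smul_mem _ _ (sub3_mono ?_ hg))
    · rintro s rfl t ht
      simp only [Set.mem_Iic] at ht ⊢; omega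
    · exact Set.Iic_subset_Iic.mpr (by omega)
  have h4 : f * g1 - q ∈ Sub3 W {M} := sub_mem (sub3_mul (by
        rintro s rfl t rfl
        simp) hf hg1) hq
  have h5 := sub3_eq_zero (by rintro s rfl; simp) h4 h3
  exact ⟨g1, (sub_eq_zero.mp h5).symm⟩

lemma reduce (hW : ∀ i, 0 < W i) (hf : f ∈ Sub3 W {d}) (hf0 : f ≠ 0) (hd : 1 ≤ d) (c : k)
    (I : Ideal (MvPolynomial (Fin 3) k)) (hI : I = Ideal.span {f - C c})
    (D : Derivation k (MvPolynomial (Fin 3) k ⧸ I) (MvPolynomial (Fin 3) k ⧸ I))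
    (hD : ∀ b, ∃ n : ℕ, (⇑D)^[n] b = 0) (hD0 : D ≠ 0) :
    ∃ (N : ℤ) (E : Derivation k (MvPolynomial (Fin 3) k) (MvPolynomial (Fin 3) k)),
      (∀ i, E (X i) ∈ Sub3 W {W i + N}) ∧ f ∣ E f ∧
      (∀ j r, r ∈ Sub3 W {j} → ∃ m, f ∣ (⇑E)^[m] r) ∧ ∃ i, ¬ f ∣ E (X i) := by
  have hlift0 : ∀ Δ : Derivation k (MvPolynomial (Fin 3) k) (MvPolynomial (Fin 3) k),
      (∀ i, Ideal.Quotient.mk I (Δ (X i)) = D (Ideal.Quotient.mk I (X i))) →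
      ∀ r, Ideal.Quotient.mk I (Δ r) = D (Ideal.Quotient.mk I r) := by
    intro Δ h r
    induction r using MvPolynomial.induction_on with
    | C a =>
      have h1 : Δ (C a) = 0 := by rw [← algebraMap_eq]; exact Δ.map_algebraMap a
      have h2 : D (Ideal.Quotient.mk I (C a)) = 0 := D.map_algebraMap a
      rw [h1, h2, map_zero]
    | add p q hp hq => simp [hp, hq]
    | mul_X p i hp => rw [Δ.leibniz, map_mul, D.leibniz]; simp [hp, h i]
  obtain ⟨Wm, hWm⟩ : ∃ Wm : ℤ, ∀ i, W i ≤ Wm :=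
    ⟨W 0 + W 1 + W 2, fun i => by have := hW 0; have := hW 1; have := hW 2; fin_cases i <;> simp <;> omega⟩
  have main : ∀ n : ℕ, ∀ Δ : Derivation k (MvPolynomial (Fin 3) k) (MvPolynomial (Fin 3) k),
      (∀ i, Δ (X i) ∈ Sub3 W (Set.Iic (W i + (n - Wm - 1)))) →
      (∀ i, Ideal.Quotient.mk I (Δ (X i)) = D (Ideal.Quotient.mk I (X i))) →
      ∃ (N : ℤ) (E : Derivation k (MvPolynomial (Fin 3) k) (MvPolynomial (Fin 3) k)),
      (∀ i, E (X i) ∈ Sub3 W {W i + N}) ∧ f ∣ E f ∧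
      (∀ j r, r ∈ Sub3 W {j} → ∃ m, f ∣ (⇑E)^[m] r) ∧ ∃ i, ¬ f ∣ E (X i) := by
    intro n
    induction n with
    | zero =>
      intro Δ h1 h2
      exfalso; apply hD0
      have h3 : ∀ i, Δ (X i) = 0 := fun i => sub3_neg hW (by
        intro t ht; have := hWm i; simp at ht; omega) (h1 i)
      have h4 : Δ = 0 := MvPolynomial.derivation_ext (by simpa using h3)
      ext b
      obtain ⟨r, rfl⟩ := Ideal.Quotient.mk_surjective b
      rw [← hlift0 Δ h2, h4]; simp
    | succ n ih =>
      intro Δ h1 h2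
      set N : ℤ := ((n + 1 : ℕ) : ℤ) - Wm - 1 with hN
      have hl := hlift0 Δ h2
      have hli : ∀ m r, Ideal.Quotient.mk I ((⇑Δ)^[m] r) = (⇑D)^[m] (Ideal.Quotient.mk I r) := by
        intro m
        induction m with
        | zero => intro r; rfl
        | succ m ihm => intro r; rw [Function.iterate_succ_apply, Function.iterate_succ_apply, ihm, hl]
      let E := mkDerivation k (fun i => weightedHomogeneousComponent W (W i + N) (Δ (X i)))
      have hE : ∀ i, E (X i) = weightedHomogeneousComponent W (W i + N) (Δ (X i)) := fun i =>
        mkDerivation_X k _ i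
      have hE1 : ∀ i, E (X i) ∈ Sub3 W {W i + N} := fun i => by rw [hE]; exact sub3_comp _ _
      have hE2 : ∀ i, (Δ - E) (X i) ∈ Sub3 W (Set.Iic (W i + N - 1)) := fun i => by
        rw [Derivation.sub_apply, hE]; exact sub3_sub_comp _ (h1 i)
      have hEh : ∀ j r, r ∈ Sub3 W {j} → E r ∈ Sub3 W {j + N} := fun j r hr =>
        sub3_deriv E hE1 (by rintro s rfl i t rfl; simp only [Set.mem_singleton_iff]; ring) hr
      have hΔh : ∀ j r, r ∈ Sub3 W (Set.Iic j) → Δ r ∈ Sub3 W (Set.Iic (j + N)) := fun j r hr =>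
        sub3_deriv Δ h1 (by intro s hs i t ht; simp only [Set.mem_Iic] at *; omega) hr
      have hdh : ∀ j r, r ∈ Sub3 W {j} → (Δ - E) r ∈ Sub3 W (Set.Iic (j + N - 1)) := fun j r hr =>
        sub3_deriv (Δ - E) hE2 (by
          rintro s rfl i t ht; simp only [Set.mem_Iic] at *; omega) hr
      have hdvd : ∀ r, Ideal.Quotient.mk I r = 0 → f - C c ∣ r := by
        intro r hr
        rwa [Ideal.Quotient.eq_zero_iff_mem, hI, Ideal.mem_span_singleton] at hr
      by_cases hex : ∃ i, ¬ f ∣ E (X i)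
      · refine ⟨N, E, hE1, ?_, ?_, hex⟩
        · refine lead_dvd hf hf0 hd c (p := Δ f) (hdvd _ ?_) (hdh d f hf) (hEh d f hf)
          have h5 : Ideal.Quotient.mk I f = Ideal.Quotient.mk I (C c) := by
            rw [Ideal.Quotient.eq, hI]; exact Ideal.mem_span_singleton_self _
          rw [hl, h5]
          exact D.map_algebraMap c
        · intro j r hr
          have hEi : ∀ m : ℕ, (⇑E)^[m] r ∈ Sub3 W {j + m * N} ∧
              (⇑Δ)^[m] r - (⇑E)^[m] r ∈ Sub3 W (Set.Iic (j + m * N - 1)) := by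
            intro m
            induction m with
            | zero => simpa using hr
            | succ m ihm =>
              rw [Function.iterate_succ_apply', Function.iterate_succ_apply']
              have e0 : j + ((m + 1 : ℕ) : ℤ) * N = j + m * N + N := by push_cast; ring
              rw [e0]
              refine ⟨hEh _ _ ihm.1, ?_⟩
              have e1 : Δ ((⇑Δ)^[m] r) - E ((⇑E)^[m] r) =
                  Δ ((⇑Δ)^[m] r - (⇑E)^[m] r) + (Δ - E) ((⇑E)^[m] r) := by
                rw [Derivation.sub_apply, map_sub]; ring
              rw [e1]
              refine add_mem ?_ (hdh _ _ ihm.1)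
              have := hΔh _ _ ihm.2
              rwa [show j + m * N - 1 + N = j + m * N + N - 1 by ring] at this
          obtain ⟨m, hm⟩ := hD (Ideal.Quotient.mk I r)
          exact ⟨m, lead_dvd hf hf0 hd c (hdvd _ (by rw [hli, hm])) (hEi m).2 (hEi m).1⟩
      · push Not at hex
        choose q hq using hex
        refine ih (Δ - (f - C c) • mkDerivation k q) ?_ ?_
        · intro i
          have h6 : q i ∈ Sub3 W (Set.Iic (W i + N - d)) := by
            refine quot_bound hf hf0 hd 0 (q i) (W i + N) ?_
            rw [C_0, sub_zero, ← hq]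
            exact sub3_mono (by simp) (hE1 i)
          have e2 : (Δ - (f - C c) • mkDerivation k q) (X i) = (Δ - E) (X i) + c • q i := by
            rw [Derivation.sub_apply, Derivation.sub_apply, Derivation.smul_apply, mkDerivation_X,
              hq i, smul_eq_C_mul, smul_eq_mul]
            ring
          rw [e2]
          refine add_mem (sub3_mono (Set.Iic_subset_Iic.mpr ?_) (hE2 i))
            (Submodule.smul_mem _ _ (sub3_mono (Set.Iic_subset_Iic.mpr ?_) h6))
          · push_cast at hN; omega
          · push_cast at hN; omega
        · intro i
          rw [← h2, Ideal.Quotient.eq, Derivation.sub_apply, Derivation.smul_apply]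
          rw [sub_sub_cancel_left, Ideal.neg_mem_iff, smul_eq_mul]
          rw [hI]
          exact Ideal.mul_mem_right _ _ (Ideal.mem_span_singleton_self _)
  choose p hp using fun i : Fin 3 => Ideal.Quotient.mk_surjective (D (Ideal.Quotient.mk I (X i)))
  choose b hb using fun i : Fin 3 => sub3_bound (W := W) (p i)
  refine main (b 0 + b 1 + b 2 + Wm.natAbs + 1) (mkDerivation k p) ?_ ?_
  · intro i
    rw [mkDerivation_X]
    refine sub3_mono (Set.Iic_subset_Iic.mpr ?_) (hb i)
    have h7 := hW i
    have h8 : b i ≤ b 0 + b 1 + b 2 := by fin_cases i <;> simp <;> omega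
    have h9 := le_abs_self Wm
    rw [Nat.cast_add, Nat.cast_add _ Wm.natAbs, Int.natCast_natAbs]
    omega
  · intro i; rw [mkDerivation_X]; exact hp i
end red

section fin
variable {k : Type} [Field k]

lemma wt_cast (w : Fin 3 → ℕ) (m : Fin 3 →₀ ℕ) :
    Finsupp.weight (fun i => (w i : ℤ)) m = ((Finsupp.weight w m : ℕ) : ℤ) := by
  rw [Finsupp.weight_apply, Finsupp.weight_apply, Finsupp.sum_fintype _ _ (by simp),
    Finsupp.sum_fintype _ _ (by simp)]
  simp

lemma mem_sub3_iff (w : Fin 3 → ℕ) (i : ℕ) (r : MvPolynomial (Fin 3) k) :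
    r ∈ Sub3 (fun i => (w i : ℤ)) {(i : ℤ)} ↔ r.IsWeightedHomogeneous w i := by
  constructor
  · intro h m hm
    have h1 := h m hm
    rw [wt_cast, Set.mem_singleton_iff] at h1
    exact_mod_cast h1
  · intro h m hm
    rw [wt_cast]
    have := h hm
    simp [this]

lemma const_of_zero (w : Fin 3 → ℕ) (hw : ∀ i, 0 < w i) (r : MvPolynomial (Fin 3) k)
    (hr : r.IsWeightedHomogeneous w 0) : r = C (coeff 0 r) := by
  classical
  ext m
  rw [coeff_C]
  by_cases hm : 0 = m
  · simp [← hm]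
  · rw [if_neg hm]
    by_contra h0
    have h1 := hr h0
    rw [Finsupp.weight_apply, Finsupp.sum_fintype _ _ (by simp)] at h1
    apply hm
    ext i
    have h2 := (Finset.sum_eq_zero_iff.mp h1) i (Finset.mem_univ i)
    have h3 := hw i
    simp only [smul_eq_mul, mul_eq_zero] at h2
    simp only [Finsupp.coe_zero, Pi.zero_apply]
    omega

lemma coeff_zero_of_pos (w : Fin 3 → ℕ) (d : ℕ) (hd : 0 < d) (r : MvPolynomial (Fin 3) k)
    (hr : r.IsWeightedHomogeneous w d) : constantCoeff r = 0 := by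
  rw [constantCoeff_eq]
  apply hr.coeff_eq_zero
  simp; omega

lemma not_gen {f : MvPolynomial (Fin 3) k} (hf : constantCoeff f = 0) (s : MvPolynomial (Fin 3) k)
    (h : ∀ i, ∃ P : Polynomial k, f ∣ X i - Polynomial.aeval s P) : False := by
  classical
  let φ : MvPolynomial (Fin 3) k → Fin 3 → k := fun p j => constantCoeff (pderiv j p)
  have key : ∀ i : Fin 3, (Pi.single i 1 : Fin 3 → k) ∈
      Submodule.span k (({φ s, φ f} : Finset (Fin 3 → k)) : Set (Fin 3 → k)) := by
    intro i
    obtain ⟨P, g, hg⟩ := h i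
    have h1 : (Pi.single i 1 : Fin 3 → k) =
        constantCoeff (Polynomial.aeval s (Polynomial.derivative P)) • φ s +
          constantCoeff g • φ f := by
      funext j
      have h2 := congrArg (fun p => constantCoeff (pderiv j p)) (sub_eq_iff_eq_add.mp hg)
      simp only [map_add, Derivation.leibniz, Derivation.map_aeval, smul_eq_mul, map_mul, hf,
        zero_mul, zero_add, pderiv_X] at h2
      simp only [Pi.add_apply, Pi.smul_apply, smul_eq_mul, φ]
      rw [add_comm, ← h2]
      by_cases hij : i = j
      · subst hij; simp
      · simp [Pi.single_apply, hij, Ne.symm hij]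
    rw [h1]
    exact add_mem (Submodule.smul_mem _ _ (Submodule.subset_span (by simp)))
      (Submodule.smul_mem _ _ (Submodule.subset_span (by simp)))
  have htop : Submodule.span k (({φ s, φ f} : Finset (Fin 3 → k)) : Set (Fin 3 → k)) = ⊤ := by
    rw [eq_top_iff]
    intro v _
    have : v = ∑ i, v i • (Pi.single i 1 : Fin 3 → k) := by
      funext j
      simp [Finset.sum_apply, Pi.single_apply]
    rw [this]
    exact Submodule.sum_mem _ fun i _ => Submodule.smul_mem _ _ (key i)
  have h3 := finrank_span_finset_le_card (R := k) ({φ s, φ f} : Finset (Fin 3 → k))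
  have h4 : ({φ s, φ f} : Finset (Fin 3 → k)).card ≤ 2 := Finset.card_le_two
  rw [Set.finrank, htop, finrank_top, Module.finrank_fin_fun] at h3
  omega

lemma lift_homog {B : Type} [CommRing B] [Algebra k B] (π : MvPolynomial (Fin 3) k →ₐ[k] B)
    (w : Fin 3 → ℕ) (ℬ : ℕ → Submodule k B) [GradedAlgebra ℬ]
    (hℬ : ∀ (i : ℕ) (r : MvPolynomial (Fin 3) k), r.IsWeightedHomogeneous w i → π r ∈ ℬ i)
    (i : ℕ) (r : MvPolynomial (Fin 3) k) (hr : π r ∈ ℬ i) :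
    ∃ r', r'.IsWeightedHomogeneous w i ∧ π r' = π r := by
  classical
  refine ⟨weightedHomogeneousComponent w i r, weightedHomogeneousComponent_isWeightedHomogeneous i r, ?_⟩
  have h : ∀ r : MvPolynomial (Fin 3) k,
      ((DirectSum.decompose ℬ (π r) i : ℬ i) : B) = π (weightedHomogeneousComponent w i r) := by
    intro r
    induction r using MvPolynomial.induction_on' with
    | monomial v c =>
      have hv : (monomial v c).IsWeightedHomogeneous w (Finsupp.weight w v) :=
        isWeightedHomogeneous_monomial w v c rfl
      by_cases hi : Finsupp.weight w v = i
      · rw [hi] at hv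
        rw [DirectSum.decompose_of_mem_same _ (hℬ i _ hv), hv.weightedHomogeneousComponent_same]
      · rw [DirectSum.decompose_of_mem_ne _ (hℬ _ _ hv) hi,
          hv.weightedHomogeneousComponent_ne _ (Ne.symm hi), map_zero]
    | add p q hp hq => simp [hp, hq]
  rw [← h, DirectSum.decompose_of_mem_same _ hr]

lemma main1 [IsAlgClosed k] [CharZero k] {B : Type} [CommRing B] [IsDomain B] [Algebra k B]
    (π : MvPolynomial (Fin 3) k →ₐ[k] B) (hπ : Function.Surjective π)
    {f : MvPolynomial (Fin 3) k} (hker : ∀ r, π r = 0 ↔ f ∣ r) (hf0 : f ≠ 0)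
    (w : Fin 3 → ℕ) (hw : ∀ i, 0 < w i) (d : ℕ) (hd : 0 < d) (hfd : f.IsWeightedHomogeneous w d)
    (ℬ : ℕ → Submodule k B) [GradedAlgebra ℬ]
    (hℬ : ∀ (i : ℕ) (r : MvPolynomial (Fin 3) k), r.IsWeightedHomogeneous w i → π r ∈ ℬ i)
    (N : ℤ) (E : Derivation k (MvPolynomial (Fin 3) k) (MvPolynomial (Fin 3) k))
    (hE : ∀ i, E (X i) ∈ Sub3 (fun i => (w i : ℤ)) {(w i : ℤ) + N}) (hEf : f ∣ E f)
    (hnil : ∀ j r, r ∈ Sub3 (fun i => (w i : ℤ)) {j} → ∃ m, f ∣ (⇑E)^[m] r)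
    (hne : ∃ i, ¬ f ∣ E (X i)) : ProjContainsAffineLine k ℬ := by
  have hlift : ∀ i b, b ∈ ℬ i → ∃ r, r.IsWeightedHomogeneous w i ∧ π r = b := by
    intro i b hb
    obtain ⟨r, rfl⟩ := hπ b
    exact lift_homog π w ℬ hℬ i r hb
  have hstab : ∀ x, π x = 0 → π (E x) = 0 := by
    intro x hx
    rw [hker] at hx ⊢
    obtain ⟨g, rfl⟩ := hx
    rw [E.leibniz]
    exact dvd_add (dvd_mul_right _ _) (hEf.mul_left _)
  let D : Derivation k B B := Derivation.liftOfSurjective hπ hstab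
  have hDa : ∀ r, D (π r) = π (E r) := fun r => Derivation.liftOfSurjective_apply hπ hstab r
  have hDi : ∀ n r, (⇑D)^[n] (π r) = π ((⇑E)^[n] r) := by
    intro n
    induction n with
    | zero => intro r; rfl
    | succ n ih => intro r; rw [Function.iterate_succ_apply, Function.iterate_succ_apply, hDa, ih]
  obtain ⟨e, h, u, he, hh, hh0, hu, hu2, hs⟩ := core_main ℬ D N (by
      intro i b hb hDb
      obtain ⟨r, hr, rfl⟩ := hlift i b hb
      rw [hDa] at hDb ⊢
      have h1 : E r ∈ Sub3 (fun i => (w i : ℤ)) {(i : ℤ) + N} :=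
        sub3_deriv E hE (by rintro s rfl i t rfl; simp only [Set.mem_singleton_iff]; ring)
          ((mem_sub3_iff w i r).mpr hr)
      have h2 : 0 ≤ (i : ℤ) + N := by
        by_contra hlt
        apply hDb
        rw [sub3_neg (fun i => by have := hw i; simpa using this) (by
          rintro t rfl; omega) h1, map_zero]
      obtain ⟨j, hj⟩ := Int.eq_ofNat_of_zero_le h2
      refine ⟨j, hj.symm, hℬ _ _ ((mem_sub3_iff w j _).mp ?_)⟩
      rwa [hj] at h1) (by
      intro i b hb
      obtain ⟨r, hr, rfl⟩ := hlift i b hb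
      obtain ⟨m, hm⟩ := hnil i r ((mem_sub3_iff w i r).mpr hr)
      exact ⟨m, by rw [hDi]; exact (hker _).mpr hm⟩) (by
      obtain ⟨i, hi⟩ := hne
      refine ⟨w i, π (X i), hℬ _ _ (isWeightedHomogeneous_X k w i), ?_⟩
      rw [hDa]
      exact fun h => hi ((hker _).mp h)) (by
      intro b hb
      obtain ⟨r, hr, rfl⟩ := hlift 0 b hb
      refine ⟨coeff 0 r, ?_⟩
      conv_lhs => rw [const_of_zero w hw r hr, ← algebraMap_eq]
      exact π.commutes _) (by
      intro v hv
      let x : Fin 3 → B := fun i => π (X i)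
      have hx : aeval x = π := by
        apply MvPolynomial.algHom_ext
        intro i; simp [x]
      have hadj : Algebra.adjoin k (Set.range x) = ⊤ := by
        rw [Algebra.adjoin_range_eq_range_aeval, hx]
        exact (AlgHom.range_eq_top π).mpr hπ
      have : Algebra.IsAlgebraic (Algebra.adjoin k (Set.range x)) B := by
        constructor
        intro b
        exact isAlgebraic_algebraMap (⟨b, by rw [hadj]; trivial⟩ : Algebra.adjoin k (Set.range x))
      have h1 := hv.cardinalMk_le_trdeg
      have h2 := Algebra.IsAlgebraic.isTranscendenceBasis_of_le_trdeg_of_finite k x (by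
        simpa using h1)
      have h3 := (algebraicIndependent_iff.mp h2.1) f (by rw [hx]; exact (hker f).mpr dvd_rfl)
      exact hf0 h3) (by
      intro s
      by_contra hcon
      push Not at hcon
      obtain ⟨s, rfl⟩ := hπ s
      refine not_gen (coeff_zero_of_pos w d hd f hfd) s fun i => ?_
      have h1 := hcon (w i) (π (X i)) (hℬ _ _ (isWeightedHomogeneous_X k w i))
      rw [Algebra.adjoin_singleton_eq_range_aeval] at h1
      obtain ⟨P, hP⟩ := h1
      refine ⟨P, (hker _).mp ?_⟩
      rw [map_sub, ← hP, sub_eq_zero]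
      exact Polynomial.aeval_algHom_apply π s P) (FractionRing B)
  exact proj_of_core ℬ e h u he hh hh0 hu hu2 hs

lemma iter_smul' {R : Type} [CommRing R] [Algebra k R] (δ δ' : Derivation k R R) (a : R)
    (ha : δ' a = 0) (h : ∀ r, δ r = a * δ' r) (n : ℕ) (r : R) :
    (⇑δ)^[n] r = a ^ n * (⇑δ')^[n] r := by
  have hp : ∀ n, δ' (a ^ n) = 0 := by
    intro n; simp [Derivation.leibniz_pow, ha]
  induction n with
  | zero => simp
  | succ n ih =>
    rw [Function.iterate_succ_apply', Function.iterate_succ_apply', ih, h, δ'.leibniz, hp]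
    simp only [smul_eq_mul, mul_zero, add_zero]
    ring

lemma divide_out {f : MvPolynomial (Fin 3) k} (hf : ¬ IsUnit f) (hf0 : f ≠ 0)
    (δ : Derivation k (MvPolynomial (Fin 3) k) (MvPolynomial (Fin 3) k))
    (hδ : ∀ b, ∃ n : ℕ, (⇑δ)^[n] b = 0) (h0 : δ ≠ 0) (hδf : δ f = 0) :
    ∃ δ' : Derivation k (MvPolynomial (Fin 3) k) (MvPolynomial (Fin 3) k),
      (∀ b, ∃ n : ℕ, (⇑δ')^[n] b = 0) ∧ δ' f = 0 ∧ ∃ i, ¬ f ∣ δ' (X i) := by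
  classical
  have hex : ∃ m, ¬ ∀ i, f ^ (m + 1) ∣ δ (X i) := by
    by_contra hcon
    push Not at hcon
    apply h0
    apply MvPolynomial.derivation_ext
    intro i
    by_contra hi
    have hfin : FiniteMultiplicity f (δ (X i)) := by
      apply FiniteMultiplicity.of_not_isUnit hf
      simpa using hi
    obtain ⟨n, hn⟩ := hfin
    exact hn (hcon n i)
  obtain ⟨m, hm1, hm2⟩ : ∃ m, (∀ i, f ^ m ∣ δ (X i)) ∧ ¬ ∀ i, f ^ (m + 1) ∣ δ (X i) := by
    refine ⟨Nat.find hex, ?_, Nat.find_spec hex⟩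
    by_cases hz : Nat.find hex = 0
    · intro i; rw [hz, pow_zero]; exact one_dvd _
    · have := Nat.find_min hex (m := Nat.find hex - 1) (by omega)
      rw [not_not, Nat.sub_add_cancel (by omega)] at this
      exact this
  choose q hq using hm1
  have hfm : f ^ m ≠ 0 := pow_ne_zero _ hf0
  have heq : δ = f ^ m • mkDerivation k q := by
    apply MvPolynomial.derivation_ext
    intro i
    rw [Derivation.smul_apply, mkDerivation_X, smul_eq_mul, hq]
  have hpt : ∀ r, δ r = f ^ m * mkDerivation k q r := by
    intro r
    conv_lhs => rw [heq]
    simp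
  have hf' : mkDerivation k q f = 0 := by
    have := hpt f
    rw [hδf] at this
    exact (mul_eq_zero.mp this.symm).resolve_left hfm
  refine ⟨mkDerivation k q, ?_, hf', ?_⟩
  · intro b
    obtain ⟨n, hn⟩ := hδ b
    refine ⟨n, ?_⟩
    rw [iter_smul' δ (mkDerivation k q) (f ^ m) (by simp [Derivation.leibniz_pow, hf']) hpt] at hn
    exact (mul_eq_zero.mp hn).resolve_left (pow_ne_zero _ hfm)
  · push Not at hm2
    obtain ⟨i, hi⟩ := hm2
    refine ⟨i, fun h => hi ?_⟩
    rw [mkDerivation_X] at h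
    rw [hq i, pow_succ]
    exact mul_dvd_mul_left _ h

end fin

/-- Proposition 2.18 (8y23874t28746rdhjh): let `R = k[x,y,z]` be graded with `x, y, z`
homogeneous of positive degrees `w`, and let `f` be a homogeneous prime element such that
`Proj (R/fR)` is not a unicuspidal rational curve. Then
(a) `R/(f - c)` is rigid for every `c ∈ k`;
(b) every nonzero locally nilpotent derivation `δ` of `R` satisfies `δ f ≠ 0`. -/
theorem statement_12 (k : Type) [Field k] [IsAlgClosed k] [CharZero k]
    (w : Fin 3 → ℕ) (hw : ∀ i, 0 < w i)
    (f : MvPolynomial (Fin 3) k) (d : ℕ) (hfd : f.IsWeightedHomogeneous w d)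
    (hfp : Prime f)
    (hnotuni : ∃ (ℬ : ℕ → Submodule k (MvPolynomial (Fin 3) k ⧸ Ideal.span {f}))
      (inst : GradedAlgebra ℬ),
      (∀ (i : ℕ) (r : MvPolynomial (Fin 3) k), r.IsWeightedHomogeneous w i →
        Ideal.Quotient.mk (Ideal.span {f}) r ∈ ℬ i) ∧
      ¬ @ProjContainsAffineLine k _ _ _ _ ℬ inst) :
    (∀ c : k, IsRigid k (MvPolynomial (Fin 3) k ⧸ Ideal.span {f - C c})) ∧
    (∀ δ : Derivation k (MvPolynomial (Fin 3) k) (MvPolynomial (Fin 3) k),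
      IsLND δ → δ ≠ 0 → δ f ≠ 0) := by
  classical
  obtain ⟨ℬ, inst, hℬ, hnot⟩ := hnotuni
  have hf0 := hfp.ne_zero
  have hd : 0 < d := by
    rcases Nat.eq_zero_or_pos d with rfl | h
    · exfalso
      have h1 := const_of_zero w hw f hfd
      apply hfp.not_isUnit
      rw [h1]
      refine (IsUnit.mk0 (coeff 0 f) fun h => hf0 ?_).map C
      rw [h1, h, C_0]
    · exact h
  have ha : ∀ c : k, IsRigid k (MvPolynomial (Fin 3) k ⧸ Ideal.span {f - C c}) := by
    intro c D hD
    by_contra hD0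
    obtain ⟨N, E, hE, hEf, hnil, hne⟩ := reduce (W := fun i => (w i : ℤ)) (d := (d : ℤ))
      (fun i => by have := hw i; simpa using this) ((mem_sub3_iff w d f).mpr hfd) hf0
      (by exact_mod_cast hd) c _ rfl D hD hD0
    apply hnot
    have hprime : (Ideal.span {f}).IsPrime := (Ideal.span_singleton_prime hf0).mpr hfp
    have : IsDomain (MvPolynomial (Fin 3) k ⧸ Ideal.span {f}) := Ideal.Quotient.isDomain _
    exact main1 (Ideal.Quotient.mkₐ k (Ideal.span {f})) (Ideal.Quotient.mkₐ_surjective k _)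
      (f := f) (fun r => by
        rw [Ideal.Quotient.mkₐ_eq_mk, Ideal.Quotient.eq_zero_iff_mem, Ideal.mem_span_singleton])
      hf0 w hw d hd hfd ℬ (fun i r hr => hℬ i r hr) N E hE hEf hnil hne
  refine ⟨ha, ?_⟩
  intro δ hδ h0 hδf
  obtain ⟨δ', hδ', hf', i, hi⟩ := divide_out hfp.not_isUnit hf0 δ hδ h0 hδf
  have ha0 := ha 0
  have hker : ∀ r, Ideal.Quotient.mkₐ k (Ideal.span {f - C 0}) r = 0 ↔ f ∣ r := by
    intro r
    rw [Ideal.Quotient.mkₐ_eq_mk, Ideal.Quotient.eq_zero_iff_mem, Ideal.mem_span_singleton, C_0,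
      sub_zero]
  have hsurj := Ideal.Quotient.mkₐ_surjective k (Ideal.span {f - C 0})
  generalize hπ : Ideal.Quotient.mkₐ k (Ideal.span {f - C 0}) = π at hker hsurj
  have hstab : ∀ x, π x = 0 → π (δ' x) = 0 := by
    intro x hx
    rw [hker] at hx ⊢
    obtain ⟨g, rfl⟩ := hx
    rw [δ'.leibniz, hf', smul_zero, add_zero]
    exact dvd_mul_right _ _
  have hDa : ∀ r, Derivation.liftOfSurjective hsurj hstab (π r) = π (δ' r) := fun r =>
    Derivation.liftOfSurjective_apply hsurj hstab r
  generalize Derivation.liftOfSurjective hsurj hstab = D at hDa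
  have hDi : ∀ n r, (⇑D)^[n] (π r) = π ((⇑δ')^[n] r) := by
    intro n
    induction n with
    | zero => intro r; rfl
    | succ n ih => intro r; rw [Function.iterate_succ_apply, Function.iterate_succ_apply, hDa, ih]
  have hD0 : D = 0 := ha0 D fun b => by
    obtain ⟨r, rfl⟩ := hsurj b
    obtain ⟨n, hn⟩ := hδ' r
    exact ⟨n, by rw [hDi, hn]; exact map_zero π⟩
  apply hi
  rw [← hker, ← hDa, hD0]
  rfl
end
end

section
/- Let f ∈ R_9 be irreducible with deg_z(f) = 1 (f has degree exactly 1 as a polynomial in z). Then the curve C = Proj(R/fR), viewed as a subvariety of the weighted projective plane ℙ(3,2,1) = Proj(R), has exactly one singular point. -/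
open MvPolynomial

set_option synthInstance.maxHeartbeats 400000
set_option maxHeartbeats 1000000

noncomputable section

/-- The grading weights `(3, 2, 1)` for the variables `x = X 0`, `y = X 1`, `z = X 2`
of `R = k[x,y,z]`. -/
def w3 : Fin 3 → ℕ := ![3, 2, 1]

/-- `S` is a regular local ring: a Noetherian local ring whose maximal ideal (equivalently,
its Jacobson radical) can be generated by Krull-dimension many elements. -/
def IsRegLocalRing (S : Type*) [CommRing S] : Prop :=
  IsNoetherianRing S ∧ IsLocalRing S ∧
    ∃ s : Finset S, Ideal.span (s : Set S) = (⊥ : Ideal S).jacobson ∧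
      (s.card : WithBot (WithTop ℕ)) = ringKrullDim S

/-- The scheme `Proj ℬ` has exactly one singular point, i.e. exactly one point whose
local ring (the stalk of the structure sheaf) is not a regular local ring. -/
def ProjHasUniqueSingularPoint (k : Type) [Field k] {A : Type} [CommRing A] [Algebra k A]
    (ℬ : ℕ → Submodule k A) [GradedAlgebra ℬ] : Prop :=
  ∃! x : AlgebraicGeometry.Proj ℬ,
    ¬ IsRegLocalRing ((AlgebraicGeometry.Proj ℬ).presheaf.stalk x)

theorem reg_of_equiv {S T : Type} [CommRing S] [CommRing T] (e : S ≃+* T) (h : IsRegLocalRing S) :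
    IsRegLocalRing T := by
  obtain ⟨h1, h2, s, hs, hc⟩ := h
  have hT : IsLocalRing T := e.isLocalRing
  refine ⟨isNoetherianRing_of_ringEquiv S e, hT, ?_⟩
  classical
  refine ⟨s.image e, ?_, ?_⟩
  · rw [IsLocalRing.jacobson_eq_maximalIdeal _ bot_ne_top] at hs ⊢
    rw [Finset.coe_image]
    have := Ideal.map_span (e : S →+* T) (s : Set S)
    simp only [RingHom.coe_coe] at this
    rw [← this, hs]
    refine IsLocalRing.eq_maximalIdeal (R := T) ?_
    exact Ideal.map_isMaximal_of_equiv e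
  · rw [Finset.card_image_of_injective _ e.injective, hc]
    exact ringKrullDim_eq_of_ringEquiv e

theorem reg_of_pir {S : Type} [CommRing S] [IsDomain S] [IsLocalRing S] [IsPrincipalIdealRing S] :
    IsRegLocalRing S := by
  refine ⟨inferInstance, inferInstance, ?_⟩
  rw [IsLocalRing.jacobson_eq_maximalIdeal _ bot_ne_top]
  by_cases h : IsField S
  · refine ⟨∅, ?_, ?_⟩
    · rw [IsLocalRing.isField_iff_maximalIdeal_eq.mp h]; simp
    · rw [ringKrullDim_eq_zero_of_isField h]; simp; rfl
  · obtain ⟨a, ha⟩ := (IsPrincipalIdealRing.principal (IsLocalRing.maximalIdeal S)).principal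
    refine ⟨{a}, ?_, ?_⟩
    · rw [ha]; simp
    · rw [IsPrincipalIdealRing.ringKrullDim_eq_one _ h]; simp; rfl

open scoped IntermediateField in
theorem reg_of_adjoin {k L S : Type} [Field k] [Field L] [Algebra k L] [CommRing S] [IsLocalRing S]
    (i : S →+* L) (hi : Function.Injective i) (c : k →+* S)
    (hc : ∀ r, i (c r) = algebraMap k L r) (v : S) (h : ∀ s, i s ∈ k⟮i v⟯) :
    IsRegLocalRing S := by
  have : IsDomain S := hi.isDomain i
  let E : Polynomial k →+* S := Polynomial.eval₂RingHom c v
  have hE : ∀ p, i (E p) = Polynomial.aeval (i v) p := by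
    intro p
    simp only [E, Polynomial.coe_eval₂RingHom, Polynomial.hom_eval₂, Polynomial.aeval_def]
    congr 1
    ext r; exact hc r
  have key : ∀ s : S, ∃ p q, IsUnit (E q) ∧ s * E q = E p := by
    intro s
    obtain ⟨p, q, hpq⟩ := (IntermediateField.mem_adjoin_simple_iff k _).1 (h s)
    rw [← hE, ← hE] at hpq
    by_cases hq : E q = 0
    · refine ⟨0, 1, by simp, ?_⟩
      rw [hq] at hpq
      have : s = 0 := hi (by simpa using hpq)
      simp [this]
    · have hq' : i (E q) ≠ 0 := fun h0 => hq (hi (by simpa using h0))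
      have hs : s * E q = E p := hi (by rw [map_mul, hpq]; field_simp)
      have hq0 : q ≠ 0 := by rintro rfl; simp at hq
      obtain ⟨p', q', d, hpp, hqq, hco⟩ : ∃ p' q' d, p = d * p' ∧ q = d * q' ∧ IsCoprime p' q' := by
        classical
        obtain ⟨q', hq2⟩ := EuclideanDomain.gcd_dvd_right p q
        obtain ⟨p', hp2⟩ := EuclideanDomain.gcd_dvd_left p q
        refine ⟨p', q', EuclideanDomain.gcd p q, hp2, hq2, ?_⟩
        obtain ⟨α, β, hab⟩ : ∃ α β, EuclideanDomain.gcd p q = p * α + q * β :=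
          ⟨_, _, EuclideanDomain.gcd_eq_gcd_ab p q⟩
        have hd : EuclideanDomain.gcd p q ≠ 0 := fun h0 => hq0 (EuclideanDomain.gcd_eq_zero_iff.1 h0).2
        refine ⟨α, β, mul_left_cancel₀ hd ?_⟩
        calc EuclideanDomain.gcd p q * (α * p' + β * q')
            = (EuclideanDomain.gcd p q * p') * α + (EuclideanDomain.gcd p q * q') * β := by ring
          _ = _ := by rw [← hp2, ← hq2, ← hab, mul_one]
      have hd : E d ≠ 0 := by rintro h0; apply hq; rw [hqq, map_mul, h0, zero_mul]
      have hs' : s * E q' = E p' := by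
        apply mul_left_cancel₀ hd
        rw [hpp, hqq, map_mul, map_mul] at hs
        linear_combination hs
      obtain ⟨α, β, hab⟩ := hco
      refine ⟨p', q', IsUnit.of_mul_eq_one (E α * s + E β) ?_, hs'⟩
      have := congrArg E hab
      simp only [map_add, map_mul, map_one] at this
      linear_combination this + E α * hs'
  have : IsPrincipalIdealRing S := by
    refine ⟨fun I => ?_⟩
    obtain ⟨g, hg⟩ := (IsPrincipalIdealRing.principal (I.comap E)).principal
    refine ⟨E g, le_antisymm ?_ ?_⟩
    · intro s hs
      obtain ⟨p, q, ⟨u, hu⟩, hpq⟩ := key s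
      have hp : p ∈ I.comap E := by
        rw [Ideal.mem_comap, ← hpq]; exact I.mul_mem_right _ hs
      rw [hg] at hp
      obtain ⟨r, rfl⟩ := Submodule.mem_span_singleton.1 hp
      refine Submodule.mem_span_singleton.2 ⟨E r * (↑u⁻¹ : S), ?_⟩
      rw [smul_eq_mul, map_mul, ← hu] at hpq
      rw [smul_eq_mul]
      calc E r * (↑u⁻¹ : S) * E g = (s * u) * (↑u⁻¹ : S) := by rw [hpq]; ring
        _ = s := by simp
    · rw [Submodule.span_singleton_le_iff_mem]
      have : g ∈ I.comap E := by rw [hg]; exact Submodule.mem_span_singleton_self g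
      exact this
  exact reg_of_pir

theorem not_reg {S : Type} [CommRing S] [IsDomain S] [IsLocalRing S] (X Y : S)
    (hm : IsLocalRing.maximalIdeal S = Ideal.span {X, Y})
    (hX : ∃ n, Y ∣ X ^ n) (h1 : ¬ X ∣ Y) (h2 : ¬ Y ∣ X) : ¬ IsRegLocalRing S := by
  rintro ⟨hn, -, s, hs, hc⟩
  rw [IsLocalRing.jacobson_eq_maximalIdeal _ bot_ne_top] at hs
  have hXm : X ∈ IsLocalRing.maximalIdeal S := by rw [hm]; exact Ideal.subset_span (by simp)
  have hYm : Y ∈ IsLocalRing.maximalIdeal S := by rw [hm]; exact Ideal.subset_span (by simp)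
  have hht : (IsLocalRing.maximalIdeal S).height ≤ 1 := by
    apply Ideal.height_le_one_of_isPrincipal_of_mem_minimalPrimes (Ideal.span {Y})
    refine ⟨⟨inferInstance, by simpa [Ideal.span_le] using hYm⟩, ?_⟩
    rintro Q ⟨hQ, hYQ⟩ -
    have hYQ' : Y ∈ Q := hYQ (Ideal.subset_span rfl)
    obtain ⟨n, hn⟩ := hX
    have : X ∈ Q := hQ.mem_of_pow_mem n (Q.mem_of_dvd hn hYQ')
    rw [hm, Ideal.span_le]
    rintro a (rfl | rfl) <;> assumption
  have hcard : s.card ≤ 1 := by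
    rw [← IsLocalRing.maximalIdeal_height_eq_ringKrullDim] at hc
    have h5 : ((s.card : ℕ∞) : WithBot ℕ∞) = (IsLocalRing.maximalIdeal S).height := hc
    have h6 : (s.card : ℕ∞) ≤ 1 := by
      rw [WithBot.coe_injective h5]; exact hht
    exact_mod_cast h6
  obtain ⟨p, hp⟩ : ∃ p, IsLocalRing.maximalIdeal S = Ideal.span {p} := by
    rcases Finset.card_le_one_iff_subset_singleton.1 hcard with ⟨p, hp⟩
    rcases Finset.subset_singleton_iff.1 hp with rfl | rfl
    · exact ⟨0, by rw [← hs]; simp⟩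
    · exact ⟨p, by rw [← hs]; simp⟩
  rw [hp, Ideal.mem_span_singleton] at hXm hYm
  obtain ⟨α, hα⟩ := hXm
  obtain ⟨β, hβ⟩ := hYm
  have hpp : p ∈ Ideal.span {X, Y} := by rw [← hm, hp]; exact Ideal.subset_span rfl
  obtain ⟨γ, δ, hγ⟩ := Ideal.mem_span_pair.1 hpp
  have hp0 : p ≠ 0 := by
    rintro rfl
    apply h1; rw [hα, hβ]; simp
  have h3 : γ * α + δ * β = 1 := by
    apply mul_left_cancel₀ hp0
    linear_combination hγ - γ * hα - δ * hβ
  have h4 : IsUnit (γ * α + δ * β) := by rw [h3]; exact isUnit_one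
  rcases IsLocalRing.isUnit_or_isUnit_of_isUnit_add h4 with h | h
  · have : IsUnit α := isUnit_of_mul_isUnit_right h
    apply h1
    rw [hα, hβ, this.mul_right_dvd]
    exact dvd_mul_right _ _
  · have : IsUnit β := isUnit_of_mul_isUnit_right h
    apply h2
    rw [hα, hβ, this.mul_right_dvd]
    exact dvd_mul_right _ _

theorem whom_scale {k B : Type} [Field k] [CommRing B] [Algebra k B] {r : MvPolynomial (Fin 3) k}
    {n : ℕ} (h : r.IsWeightedHomogeneous w3 n) (c : B) (v : Fin 3 → B) :
    aeval (fun i => c ^ (w3 i) * v i) r = c ^ n * aeval v r := by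
  induction h using MvPolynomial.IsWeightedHomogeneous.induction_on with
  | zero => simp
  | add p q hp hq h1 h2 => rw [map_add, map_add, h1, h2, mul_add]
  | monomial d r hr =>
    rw [aeval_monomial, aeval_monomial, Finsupp.prod_fintype _ _ (by simp),
      Finsupp.prod_fintype _ _ (by simp)]
    simp only [mul_pow, Finset.prod_mul_distrib, ← pow_mul]
    rw [Finset.prod_pow_eq_pow_sum]
    have : ∑ i, w3 i * d i = n := by
      rw [← hr, Finsupp.weight_apply, Finsupp.sum_fintype _ _ (by simp)]
      simp [mul_comm]
    rw [this]; ring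

theorem f_shape {k : Type} [Field k] {f : MvPolynomial (Fin 3) k}
    (hf9 : f.IsWeightedHomogeneous w3 9) (hC1 : Irreducible f) (hdz : f.degreeOf 2 = 1) :
    ∃ a b c d : k, a ≠ 0 ∧ c ≠ 0 ∧ f = X 2 * (C a * X 1 ^ 4 + C b * X 0 ^ 2 * X 1) +
      C c * X 0 ^ 3 + C d * X 0 * X 1 ^ 3 := by
  classical
  have hsh : ∃ a b c d : k, f = X 2 * (C a * X 1 ^ 4 + C b * X 0 ^ 2 * X 1) +
      C c * X 0 ^ 3 + C d * X 0 * X 1 ^ 3 := by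
    let m : Fin 3 → ℕ → ℕ → ℕ → (Fin 3 →₀ ℕ) := fun _ i j l => Finsupp.equivFunOnFinite.symm ![i, j, l]
    let T : Finset (Fin 3 →₀ ℕ) := {m 0 0 4 1, m 0 2 1 1, m 0 3 0 0, m 0 1 3 0}
    have hT : f.support ⊆ T := by
      intro e he
      have h1 := hf9 (MvPolynomial.mem_support_iff.1 he)
      have h2 : e 2 ≤ 1 := by rw [← hdz]; exact MvPolynomial.monomial_le_degreeOf 2 he
      rw [Finsupp.weight_apply, Finsupp.sum_fintype _ _ (by simp)] at h1
      simp [Fin.sum_univ_three, w3] at h1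
      have h3 : e = m 0 (e 0) (e 1) (e 2) := by
        ext i; fin_cases i <;> simp [m]
      have : (e 0 = 0 ∧ e 1 = 4 ∧ e 2 = 1) ∨ (e 0 = 2 ∧ e 1 = 1 ∧ e 2 = 1) ∨
        (e 0 = 3 ∧ e 1 = 0 ∧ e 2 = 0) ∨ (e 0 = 1 ∧ e 1 = 3 ∧ e 2 = 0) := by omega
      rw [h3]
      simp only [T, Finset.mem_insert, Finset.mem_singleton]
      rcases this with ⟨h, h', h''⟩ | ⟨h, h', h''⟩ | ⟨h, h', h''⟩ | ⟨h, h', h''⟩ <;>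
        simp [h, h', h'']
    have hsum : f = ∑ e ∈ T, monomial e (coeff e f) := by
      conv_lhs => rw [MvPolynomial.as_sum f]
      apply Finset.sum_subset hT
      intro e _ he
      rw [MvPolynomial.notMem_support_iff.1 he, monomial_zero]
    have inj : ∀ i j l i' j' l', m 0 i j l = m 0 i' j' l' → i = i' ∧ j = j' ∧ l = l' := by
      intro i j l i' j' l' h
      have h0 := DFunLike.congr_fun h 0
      have h1 := DFunLike.congr_fun h 1
      have h2 := DFunLike.congr_fun h 2
      exact ⟨by simpa [m] using h0, by simpa [m] using h1, by simpa [m] using h2⟩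
    have hmon : ∀ i j l (r : k), monomial (m 0 i j l) r = C r * (X 0 ^ i * X 1 ^ j * X 2 ^ l) := by
      intro i j l r
      rw [monomial_eq, Finsupp.prod_fintype _ _ (by simp)]
      simp [Fin.prod_univ_three, m]
    refine ⟨coeff (m 0 0 4 1) f, coeff (m 0 2 1 1) f, coeff (m 0 3 0 0) f, coeff (m 0 1 3 0) f, ?_⟩
    conv_lhs => rw [hsum]
    simp only [T]
    rw [Finset.sum_insert, Finset.sum_insert, Finset.sum_insert, Finset.sum_singleton]
    · simp only [hmon]; ring
    all_goals
      simp only [Finset.mem_insert, Finset.mem_singleton]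
      intro h
      try rcases h with h | h
      try rcases h with h | h
      all_goals (try rcases h with h | h) <;> (have := inj _ _ _ _ _ _ h; omega)
  obtain ⟨a, b, c, d, hf⟩ := hsh
  have key : ∀ (i : Fin 3) (g : MvPolynomial (Fin 3) k), i ≠ 2 → f ≠ X i * g := by
    intro i g hi hfg
    have hu : ¬ IsUnit (X i : MvPolynomial (Fin 3) k) := (MvPolynomial.X_prime (i := i)).not_isUnit
    have hg : IsUnit g := (hC1.isUnit_or_isUnit hfg).resolve_left hu
    obtain ⟨r, hr, rfl⟩ := MvPolynomial.isUnit_iff_eq_C_of_isReduced.1 hg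
    rw [hfg, mul_comm, MvPolynomial.degreeOf_C_mul] at hdz
    · rw [degreeOf_X, if_neg (Ne.symm hi)] at hdz
      omega
    · exact mem_nonZeroDivisors_of_ne_zero hr.ne_zero
  refine ⟨a, b, c, d, ?_, ?_, hf⟩
  · rintro rfl
    refine key 0 (X 2 * (C b * X 0 * X 1) + C c * X 0 ^ 2 + C d * X 1 ^ 3) (by decide) ?_
    rw [hf, C_0]; ring
  · rintro rfl
    refine key 1 (X 2 * (C a * X 1 ^ 3 + C b * X 0 ^ 2) + C d * X 0 * X 1 ^ 2) (by decide) ?_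
    rw [hf, C_0]; ring

section grading
variable {k : Type} [Field k] (I : Ideal (MvPolynomial (Fin 3) k))

def gr (i : ℕ) : Submodule k (MvPolynomial (Fin 3) k ⧸ I) :=
  (weightedHomogeneousSubmodule k w3 i).map (Ideal.Quotient.mkₐ k I).toLinearMap

theorem mem_gr {i : ℕ} {r : MvPolynomial (Fin 3) k} (h : r.IsWeightedHomogeneous w3 i) :
    Ideal.Quotient.mk I r ∈ gr I i := ⟨r, h, rfl⟩

instance gr_monoid : SetLike.GradedMonoid (gr I) where
  one_mem := mem_gr I (isWeightedHomogeneous_one k w3)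
  mul_mem := by
    rintro i j _ _ ⟨a, ha, rfl⟩ ⟨b, hb, rfl⟩
    exact ⟨a * b, IsWeightedHomogeneous.mul ha hb, map_mul (Ideal.Quotient.mkₐ k I) _ _⟩

def grMap (i : ℕ) : weightedHomogeneousSubmodule k w3 i →ₗ[k] gr I i :=
  ((Ideal.Quotient.mkₐ k I).toLinearMap).restrict (fun _ hr => mem_gr I hr)

open DirectSum in
def grDec : MvPolynomial (Fin 3) k →ₐ[k] ⨁ i, gr I i :=
  letI := weightedGradedAlgebra k w3
  (DirectSum.toAlgebra k (fun i => weightedHomogeneousSubmodule k w3 i)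
    (fun i => (DirectSum.lof k ℕ (fun i => gr I i) i).comp (grMap I i)) rfl (by
      intro i j a b
      simp only [LinearMap.comp_apply, DirectSum.lof_eq_of, DirectSum.of_mul_of]
      congr 1)).comp
    (DirectSum.decomposeAlgEquiv (weightedHomogeneousSubmodule k w3)).toAlgHom

theorem grDec_of {i : ℕ} {r : MvPolynomial (Fin 3) k} (h : r.IsWeightedHomogeneous w3 i) :
    grDec I r = DirectSum.of (fun i => gr I i) i ⟨Ideal.Quotient.mk I r, mem_gr I h⟩ := by
  let _ := weightedGradedAlgebra k w3
  have : DirectSum.decompose (weightedHomogeneousSubmodule k w3) r =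
      DirectSum.of (fun i => weightedHomogeneousSubmodule k w3 i) i ⟨r, h⟩ :=
    DirectSum.decompose_of_mem _ h
  simp only [grDec, AlgHom.comp_apply]
  erw [this]
  exact DirectSum.toAddMonoid_of (fun i => ((DirectSum.lof k ℕ (fun i => gr I i) i).comp (grMap I i)).toAddMonoidHom) i ⟨r, h⟩

end grading

abbrev grAlg {k : Type} [Field k] {f : MvPolynomial (Fin 3) k}
    (hf9 : f.IsWeightedHomogeneous w3 9) : GradedAlgebra (gr (Ideal.span {f})) :=
  GradedAlgebra.ofAlgHom _ (Ideal.Quotient.liftₐ _ (grDec (Ideal.span {f})) (by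
    intro a ha
    obtain ⟨b, rfl⟩ := Ideal.mem_span_singleton.1 ha
    rw [map_mul, grDec_of _ hf9]
    have : (⟨Ideal.Quotient.mk (Ideal.span {f}) f, mem_gr _ hf9⟩ : gr (Ideal.span {f}) 9) = 0 := by
      ext; simp
    rw [this, map_zero, zero_mul]))
  (by
    apply Ideal.Quotient.algHom_ext
    apply MvPolynomial.algHom_ext
    intro i
    simp only [AlgHom.comp_apply, Ideal.Quotient.mkₐ_eq_mk]
    erw [Ideal.Quotient.liftₐ_apply, Ideal.Quotient.lift_mk]
    erw [grDec_of _ (isWeightedHomogeneous_X k w3 i)]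
    erw [DirectSum.coeAlgHom_of]
    rfl)
  (by
    rintro i ⟨_, r, hr, rfl⟩
    exact grDec_of _ hr)

theorem hloc_embed {k A : Type} [Field k] [CommRing A] [IsDomain A] [Algebra k A]
    (ℬ : ℕ → Submodule k A) [GradedAlgebra ℬ] (P : Ideal A) [P.IsPrime] :
    ∃ ι : HomogeneousLocalization.AtPrime ℬ P →+* FractionRing A, Function.Injective ι ∧
      ∀ n : HomogeneousLocalization.NumDenSameDeg ℬ P.primeCompl,
        ι (HomogeneousLocalization.mk n) =
          algebraMap A (FractionRing A) n.num / algebraMap A (FractionRing A) n.den := by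
  have hle : P.primeCompl ≤ nonZeroDivisors A := P.primeCompl_le_nonZeroDivisors
  have hu : ∀ y : P.primeCompl, IsUnit (algebraMap A (FractionRing A) y) := fun y =>
    IsLocalization.map_units _ (⟨y.1, hle y.2⟩ : nonZeroDivisors A)
  let g : Localization.AtPrime P →+* FractionRing A := IsLocalization.lift (M := P.primeCompl) hu
  have hg : Function.Injective g := by
    apply (IsLocalization.lift_injective_iff (M := P.primeCompl) hu).2
    intro x y
    rw [(IsLocalization.injective (Localization.AtPrime P) hle).eq_iff,
      (IsFractionRing.injective A (FractionRing A)).eq_iff]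
  refine ⟨g.comp (algebraMap (HomogeneousLocalization.AtPrime ℬ P) (Localization.AtPrime P)), ?_, ?_⟩
  · exact hg.comp (HomogeneousLocalization.val_injective _)
  · intro n
    rw [RingHom.comp_apply, HomogeneousLocalization.algebraMap_apply,
      HomogeneousLocalization.val_mk, Localization.mk_eq_mk']
    have hne : algebraMap A (FractionRing A) n.den ≠ 0 := (hu ⟨n.den, n.den_mem⟩).ne_zero
    rw [eq_div_iff hne]
    exact (mul_comm _ _).trans ((IsLocalization.lift_mk'_spec (S := Localization.AtPrime P)
      (g := algebraMap A (FractionRing A)) (hg := hu) (n.num : A) _ ⟨n.den, n.den_mem⟩).1 rfl).symm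

def ev0 {k : Type} [Field k] : MvPolynomial (Fin 3) k →ₐ[k] k := aeval (![0, 0, 1] : Fin 3 → k)

theorem fl0 {L : Type} [Field L] {x y : L} (hx : x ≠ 0) (hy : y ≠ 0) :
    x = (x / y) ^ 3 * (y ^ 3 / x ^ 2) := by field_simp

theorem fl1 {L : Type} [Field L] {x y : L} (hx : x ≠ 0) (hy : y ≠ 0) :
    y = (x / y) ^ 2 * (y ^ 3 / x ^ 2) := by field_simp

theorem fl2 {L : Type} [Field L] {x y z a b c d : L} (hx : x ≠ 0) (hy : y ≠ 0)
    (hl : a * y ^ 3 + b * x ^ 2 ≠ 0)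
    (hrel : z * (a * y ^ 4 + b * x ^ 2 * y) + c * x ^ 3 + d * x * y ^ 3 = 0) :
    z = (x / y) ^ 1 * (-(c + d * (y ^ 3 / x ^ 2)) / (a * (y ^ 3 / x ^ 2) + b)) := by
  have h3 : a * (y ^ 3 / x ^ 2) + b ≠ 0 := by
    intro h; apply hl
    field_simp at h
    linear_combination h
  rw [pow_one, div_mul_div_comm, eq_div_iff (mul_ne_zero hy h3)]
  field_simp
  linear_combination hrel

theorem fl3 {L : Type} [Field L] {x y z a b c d : L} (hz : z ≠ 0) (hc : c ≠ 0)
    (hrel : z * (a * y ^ 4 + b * x ^ 2 * y) + c * x ^ 3 + d * x * y ^ 3 = 0) :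
    (x / z ^ 3) ^ 3 = y / z ^ 2 * (-c⁻¹ * (b * (x / z ^ 3) ^ 2 + d * (x / z ^ 3) * (y / z ^ 2) ^ 2
      + a * (y / z ^ 2) ^ 3)) := by
  field_simp
  linear_combination hrel

section main
variable {k A : Type} [Field k] [CommRing A] [Algebra k A]
  (π : MvPolynomial (Fin 3) k →ₐ[k] A)

theorem mod_xy (J : Ideal A) (hx : π (X 0) ∈ J) (hy : π (X 1) ∈ J) {n : ℕ}
    {r : MvPolynomial (Fin 3) k} (hr : r.IsWeightedHomogeneous w3 n) :
    π r - π (X 2) ^ n * algebraMap k A (ev0 r) ∈ J := by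
  rw [← Ideal.Quotient.eq]
  let q := (Ideal.Quotient.mkₐ k J).comp π
  have h0 : q (X 0) = 0 := Ideal.Quotient.eq_zero_iff_mem.2 hx
  have h1 : q (X 1) = 0 := Ideal.Quotient.eq_zero_iff_mem.2 hy
  have hq : q = aeval (fun i => q (X 2) ^ (w3 i) * (algebraMap k (A ⧸ J) ∘ ![0, 0, 1]) i) := by
    apply MvPolynomial.algHom_ext
    intro i
    rw [aeval_X]
    fin_cases i <;> simp [h0, h1, w3]
  have h2 : q r = q (X 2) ^ n * algebraMap k (A ⧸ J) (ev0 r) := by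
    conv_lhs => rw [hq]
    rw [whom_scale hr, MvPolynomial.aeval_algebraMap_apply]
    rfl
  rw [map_mul, map_pow]
  exact h2

theorem mem_iff_xy (J : Ideal A) (hx : π (X 0) ∈ J) (hy : π (X 1) ∈ J) {n : ℕ}
    {r : MvPolynomial (Fin 3) k} (hr : r.IsWeightedHomogeneous w3 n) :
    π r ∈ J ↔ π (X 2) ^ n * algebraMap k A (ev0 r) ∈ J := by
  have := mod_xy π J hx hy hr
  constructor
  · intro h; simpa using J.sub_mem h this
  · intro h; simpa using J.add_mem this h

variable [IsDomain A] (ℬ : ℕ → Submodule k A) [GradedAlgebra ℬ]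
  (hℬ : ∀ i a, a ∈ ℬ i ↔ ∃ r, r.IsWeightedHomogeneous w3 i ∧ π r = a)
  (a b c d : k)

include hℬ

theorem memX (i : Fin 3) : π (X i) ∈ ℬ (w3 i) :=
  (hℬ _ _).2 ⟨X i, isWeightedHomogeneous_X k w3 i, rfl⟩

theorem memXpow (i : Fin 3) (n m : ℕ) (h : n * w3 i = m) : π (X i) ^ n ∈ ℬ m :=
  (hℬ _ _).2 ⟨X i ^ n, by rw [← h]; exact (isWeightedHomogeneous_X k w3 i).pow n, by simp⟩

open scoped IntermediateField in
theorem reg_case (ha : a ≠ 0)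
    (hrel : π (X 2) * (algebraMap k A a * π (X 1) ^ 4 + algebraMap k A b * π (X 0) ^ 2 * π (X 1)) +
      algebraMap k A c * π (X 0) ^ 3 + algebraMap k A d * π (X 0) * π (X 1) ^ 3 = 0)
    (hx0 : π (X 0) ≠ 0) (hy0 : π (X 1) ≠ 0)
    (hl : algebraMap k A a * π (X 1) ^ 3 + algebraMap k A b * π (X 0) ^ 2 ≠ 0)
    (P : Ideal A) [P.IsPrime] (hP : ¬ (π (X 0) ∈ P ∧ π (X 1) ∈ P)) :
    IsRegLocalRing (HomogeneousLocalization.AtPrime ℬ P) := by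
  obtain ⟨ι, hι, hιmk⟩ := hloc_embed ℬ P
  let L := FractionRing A
  let al := algebraMap A L
  have hal : Function.Injective al := IsFractionRing.injective A L
  have hx : al (π (X 0)) ≠ 0 := fun h => hx0 (hal (by simpa using h))
  have hy : al (π (X 1)) ≠ 0 := fun h => hy0 (hal (by simpa using h))
  have hl' : al _ ≠ 0 := fun h => hl (hal (h.trans (map_zero al).symm))
  have hrel' := congrArg al hrel
  simp only [map_add, map_mul, map_pow, map_zero] at hl' hrel'
  have hka : ∀ r, al (algebraMap k A r) = algebraMap k L r := fun r =>
    (IsScalarTower.algebraMap_apply k A L r).symm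
  simp only [hka] at hl' hrel'
  set x := al (π (X 0)) with hxdef
  set y := al (π (X 1)) with hydef
  set z := al (π (X 2)) with hzdef
  let cS : k →+* HomogeneousLocalization.AtPrime ℬ P :=
    (HomogeneousLocalization.fromZeroRingHom ℬ P.primeCompl).comp (algebraMap k (ℬ 0))
  have hcS : ∀ r, ι (cS r) = algebraMap k L r := by
    intro r
    refine (hιmk _).trans ?_
    change al (algebraMap k A r) / al 1 = _
    rw [map_one, div_one]
    exact hka r
  let u : L := y ^ 3 / x ^ 2
  let K := k⟮u⟯
  let u' : K := IntermediateField.AdjoinSimple.gen k u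
  let t' : Fin 3 → K := ![u', u', - (algebraMap k K c + algebraMap k K d * u') /
    (algebraMap k K a * u' + algebraMap k K b)]
  let al' : A →ₐ[k] L := IsScalarTower.toAlgHom k A L
  have hs : al'.comp π = aeval (fun i => (x / y) ^ (w3 i) * algebraMap K L (t' i)) := by
    apply MvPolynomial.algHom_ext
    intro i
    rw [aeval_X]
    fin_cases i
    · exact fl0 hx hy
    · exact fl1 hx hy
    · refine (fl2 hx hy hl' hrel').trans ?_
      change _ = (x / y) ^ 1 * algebraMap K L (- (algebraMap k K c + algebraMap k K d * u') /
        (algebraMap k K a * u' + algebraMap k K b))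
      rw [map_div₀, map_neg, map_add, map_add, map_mul, map_mul]
      rfl
  have hmem : ∀ n (r : MvPolynomial (Fin 3) k), r.IsWeightedHomogeneous w3 n →
      ∃ κ ∈ K, al (π r) = (x / y) ^ n * κ := by
    intro n r hr
    refine ⟨algebraMap K L (aeval t' r), (aeval t' r).2, ?_⟩
    change (al'.comp π) r = _
    rw [hs, whom_scale hr]
    congr 1
    exact MvPolynomial.aeval_algebraMap_apply L t' r
  have hall : ∀ s, ι s ∈ K := by
    intro s
    obtain ⟨⟨n, num, den, hd⟩, rfl⟩ := HomogeneousLocalization.mk_surjective s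
    obtain ⟨r1, hr1, hn1⟩ := (hℬ _ _).1 num.2
    obtain ⟨r2, hr2, hn2⟩ := (hℬ _ _).1 den.2
    rw [hιmk]
    obtain ⟨κ1, hk1, h1⟩ := hmem n r1 hr1
    obtain ⟨κ2, hk2, h2⟩ := hmem n r2 hr2
    simp only
    rw [← hn1, ← hn2]
    change al (π r1) / al (π r2) ∈ K
    rw [h1, h2, mul_div_mul_left _ _ (pow_ne_zero _ (div_ne_zero hx hy))]
    exact K.div_mem hk1 hk2
  by_cases hxP : π (X 0) ∈ P
  · have hyP : π (X 1) ∉ P := fun h => hP ⟨hxP, h⟩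
    let v : HomogeneousLocalization.AtPrime ℬ P := HomogeneousLocalization.mk
      ⟨6, ⟨π (X 0) ^ 2, memXpow π ℬ hℬ 0 2 6 rfl⟩, ⟨π (X 1) ^ 3, memXpow π ℬ hℬ 1 3 6 rfl⟩,
        fun h => hyP (Ideal.IsPrime.mem_of_pow_mem ‹_› _ h)⟩
    have hv : ι v = u⁻¹ := by
      rw [hιmk]; simp only [map_pow, u, inv_div]; rfl
    refine reg_of_adjoin ι hι cS hcS v fun s => ?_
    have : K ≤ k⟮ι v⟯ := by
      rw [IntermediateField.adjoin_simple_le_iff, hv, ← inv_inv u]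
      rw [inv_inv u]
      have := IntermediateField.inv_mem _ (IntermediateField.mem_adjoin_simple_self k u⁻¹)
      rwa [inv_inv] at this
    exact this (hall s)
  · let v : HomogeneousLocalization.AtPrime ℬ P := HomogeneousLocalization.mk
      ⟨6, ⟨π (X 1) ^ 3, memXpow π ℬ hℬ 1 3 6 rfl⟩, ⟨π (X 0) ^ 2, memXpow π ℬ hℬ 0 2 6 rfl⟩,
        fun h => hxP (Ideal.IsPrime.mem_of_pow_mem ‹_› _ h)⟩
    have hv : ι v = u := by
      rw [hιmk]; simp only [map_pow, u]; rfl
    refine reg_of_adjoin ι hι cS hcS v fun s => ?_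
    rw [hv]
    exact hall s

open scoped DualNumber in
theorem chi_exists (hlift : ∀ (B : Type) [CommRing B] [Algebra k B] (v : Fin 3 → B),
      v 2 * (algebraMap k B a * v 1 ^ 4 + algebraMap k B b * v 0 ^ 2 * v 1) +
        algebraMap k B c * v 0 ^ 3 + algebraMap k B d * v 0 * v 1 ^ 3 = 0 →
      ∃ φ : A →ₐ[k] B, ∀ r, φ (π r) = aeval v r)
    (α β : k) (hαβ : α = 0 ∨ β = 0) :
    ∃ χ : A →ₐ[k] k[ε], χ (π (X 0)) = α • DualNumber.eps ∧ χ (π (X 1)) = β • DualNumber.eps ∧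
      χ (π (X 2)) = 1 ∧ ∀ r, (χ (π r)).fst = ev0 r := by
  have he : (DualNumber.eps : k[ε]) ^ 2 = 0 := by rw [sq]; exact DualNumber.eps_mul_eps
  have he3 : (DualNumber.eps : k[ε]) ^ 3 = 0 := by rw [pow_succ, he, zero_mul]
  have he4 : (DualNumber.eps : k[ε]) ^ 4 = 0 := by rw [pow_succ, he3, zero_mul]
  obtain ⟨χ, hχ⟩ := hlift k[ε] ![α • DualNumber.eps, β • DualNumber.eps, 1] (by
    simp [smul_pow, he, he3, he4])
  refine ⟨χ, by simp [hχ], by simp [hχ], by simp [hχ], fun r => ?_⟩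
  rw [hχ]
  have : (TrivSqZeroExt.fstHom k k k).comp
      (aeval ![α • (DualNumber.eps : k[ε]), β • DualNumber.eps, 1]) = ev0 := by
    apply MvPolynomial.algHom_ext
    intro i
    fin_cases i <;> simp [ev0]
  exact DFunLike.congr_fun this r

theorem sing_case (hc : c ≠ 0)
    (hrel : π (X 2) * (algebraMap k A a * π (X 1) ^ 4 + algebraMap k A b * π (X 0) ^ 2 * π (X 1)) +
      algebraMap k A c * π (X 0) ^ 3 + algebraMap k A d * π (X 0) * π (X 1) ^ 3 = 0)
    (hlift : ∀ (B : Type) [CommRing B] [Algebra k B] (v : Fin 3 → B),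
      v 2 * (algebraMap k B a * v 1 ^ 4 + algebraMap k B b * v 0 ^ 2 * v 1) +
        algebraMap k B c * v 0 ^ 3 + algebraMap k B d * v 0 * v 1 ^ 3 = 0 →
      ∃ φ : A →ₐ[k] B, ∀ r, φ (π r) = aeval v r)
    (P : Ideal A) [P.IsPrime]
    (hP : ∀ n (r : MvPolynomial (Fin 3) k), r.IsWeightedHomogeneous w3 n → (π r ∈ P ↔ ev0 r = 0)) :
    ¬ IsRegLocalRing (HomogeneousLocalization.AtPrime ℬ P) := by
  obtain ⟨ι, hι, hιmk⟩ := hloc_embed ℬ P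
  let L := FractionRing A
  let al := algebraMap A L
  have hal : Function.Injective al := IsFractionRing.injective A L
  have hzP : π (X 2) ∉ P := by
    rw [hP 1 (X 2) (isWeightedHomogeneous_X k w3 2)]
    simp [ev0]
  have hzP' : ∀ n, π (X 2) ^ n ∉ P := fun n h => hzP (Ideal.IsPrime.mem_of_pow_mem ‹_› _ h)
  have hne : ∀ g, g ∉ P → al g ≠ 0 := fun g hg h => hg (by
    rw [hal (h.trans (map_zero al).symm)]; exact P.zero_mem)
  have hz := hne _ hzP
  have hrel' := congrArg al hrel
  simp only [map_add, map_mul, map_pow, map_zero] at hrel'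
  have hka : ∀ r, al (algebraMap k A r) = algebraMap k L r := fun r =>
    (IsScalarTower.algebraMap_apply k A L r).symm
  simp only [hka] at hrel'
  let S := HomogeneousLocalization.AtPrime ℬ P
  let cS : k →+* S :=
    (HomogeneousLocalization.fromZeroRingHom ℬ P.primeCompl).comp (algebraMap k (ℬ 0))
  have hcS : ∀ r, ι (cS r) = algebraMap k L r := by
    intro r
    refine (hιmk _).trans ?_
    change al (algebraMap k A r) / al 1 = _
    rw [map_one, div_one]
    exact hka r
  let Xs : S := HomogeneousLocalization.mk
      ⟨3, ⟨π (X 0), memX π ℬ hℬ 0⟩, ⟨π (X 2) ^ 3, memXpow π ℬ hℬ 2 3 3 rfl⟩, hzP' 3⟩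
  let Ys : S := HomogeneousLocalization.mk
      ⟨2, ⟨π (X 1), memX π ℬ hℬ 1⟩, ⟨π (X 2) ^ 2, memXpow π ℬ hℬ 2 2 2 rfl⟩, hzP' 2⟩
  have hXs : ι Xs = al (π (X 0)) / al (π (X 2)) ^ 3 := by
    rw [← map_pow]; exact hιmk _
  have hYs : ι Ys = al (π (X 1)) / al (π (X 2)) ^ 2 := by
    rw [← map_pow]; exact hιmk _
  have hform : ∀ s : S, ∃ n r1 r2, r1.IsWeightedHomogeneous w3 n ∧ r2.IsWeightedHomogeneous w3 n ∧
      ev0 r2 ≠ 0 ∧ ι s = al (π r1) / al (π r2) ∧ al (π r2) ≠ 0 := by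
    intro s
    obtain ⟨⟨n, num, den, hd⟩, rfl⟩ := HomogeneousLocalization.mk_surjective s
    obtain ⟨r1, hr1, hn1⟩ := (hℬ _ _).1 num.2
    obtain ⟨r2, hr2, hn2⟩ := (hℬ _ _).1 den.2
    have hd' : π r2 ∉ P := by rw [hn2]; exact hd
    refine ⟨n, r1, r2, hr1, hr2, ?_, ?_, hne _ hd'⟩
    · rwa [Ne, ← hP n r2 hr2]
    · rw [hn1, hn2]; exact hιmk _
  have hXY : ¬ Xs ∣ Ys := by
    rintro ⟨s, hs⟩
    obtain ⟨n, r1, r2, hr1, hr2, h2, hs2, hn0⟩ := hform s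
    have h := congrArg ι hs
    rw [map_mul, hXs, hYs, hs2] at h
    have h' : al (π (X 1)) * al (π (X 2)) * al (π r2) = al (π (X 0)) * al (π r1) := by
      rw [div_mul_div_comm, div_eq_div_iff (pow_ne_zero _ hz)
        (mul_ne_zero (pow_ne_zero _ hz) hn0)] at h
      apply mul_left_cancel₀ (pow_ne_zero 2 hz)
      linear_combination h
    simp only [← map_mul] at h'
    have h' := hal h'
    obtain ⟨χ, hx, hy, hz, hr⟩ := chi_exists π ℬ hℬ a b c d hlift 0 1 (Or.inl rfl)
    have h3 := congrArg TrivSqZeroExt.snd (congrArg χ h')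
    simp only [map_mul] at h3
    simp [hx, hy, hz, hr] at h3
    exact h2 h3
  have hYX : ¬ Ys ∣ Xs := by
    rintro ⟨s, hs⟩
    obtain ⟨n, r1, r2, hr1, hr2, h2, hs2, hn0⟩ := hform s
    have h := congrArg ι hs
    rw [map_mul, hXs, hYs, hs2] at h
    have h' : al (π (X 0)) * al (π r2) = al (π (X 2)) * al (π (X 1)) * al (π r1) := by
      rw [div_mul_div_comm, div_eq_div_iff (pow_ne_zero _ hz)
        (mul_ne_zero (pow_ne_zero _ hz) hn0)] at h
      apply mul_left_cancel₀ (pow_ne_zero 2 hz)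
      linear_combination h
    simp only [← map_mul] at h'
    have h' := hal h'
    obtain ⟨χ, hx, hy, hz, hr⟩ := chi_exists π ℬ hℬ a b c d hlift 1 0 (Or.inr rfl)
    have h3 := congrArg TrivSqZeroExt.snd (congrArg χ h')
    rw [map_mul, map_mul, map_mul, map_mul, map_mul] at h3
    simp [hx, hy, hz, hr] at h3
    exact h2 h3
  have : IsDomain S := hι.isDomain
  have hpow : Ys ∣ Xs ^ 3 := by
    refine ⟨-cS c⁻¹ * (cS b * Xs ^ 2 + cS d * Xs * Ys ^ 2 + cS a * Ys ^ 3), hι ?_⟩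
    have hc' : algebraMap k L c ≠ 0 := by simpa using hc
    simp only [map_mul, map_add, map_neg, map_pow, hcS, hXs, hYs, map_inv₀]
    exact fl3 hz hc' hrel'
  let E : MvPolynomial (Fin 3) k →+* S := eval₂Hom cS ![Xs, Ys, 1]
  have hE : ∀ n (r : MvPolynomial (Fin 3) k), r.IsWeightedHomogeneous w3 n →
      ι (E r) * al (π (X 2)) ^ n = al (π r) := by
    intro n r hr
    let v : Fin 3 → L := ![al (π (X 0)) / al (π (X 2)) ^ 3, al (π (X 1)) / al (π (X 2)) ^ 2, 1]
    let al' : A →ₐ[k] L := IsScalarTower.toAlgHom k A L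
    have h1 : ι.comp E = (aeval v : MvPolynomial (Fin 3) k →ₐ[k] L).toRingHom := by
      apply MvPolynomial.ringHom_ext
      · intro t
        simp [E, hcS]
      · intro i
        fin_cases i
        · simpa [E, v] using hXs
        · simpa [E, v] using hYs
        · simp [E, v]
    have h2 : al'.comp π = aeval (fun i => al (π (X 2)) ^ (w3 i) * v i) := by
      apply MvPolynomial.algHom_ext
      intro i
      rw [aeval_X]
      fin_cases i
      · exact (mul_div_cancel₀ _ (pow_ne_zero 3 hz)).symm
      · exact (mul_div_cancel₀ _ (pow_ne_zero 2 hz)).symm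
      · change al (π (X 2)) = al (π (X 2)) ^ 1 * 1
        simp
    have h1' : ι (E r) = aeval v r := RingHom.congr_fun h1 r
    have h2' : al (π r) = _ := DFunLike.congr_fun h2 r
    rw [h1', h2', whom_scale hr, mul_comm]
  have hmod : ∀ r, E r - cS (ev0 r) ∈ Ideal.span {Xs, Ys} := by
    intro r
    rw [← Ideal.Quotient.eq]
    have h1 : (Ideal.Quotient.mk (Ideal.span {Xs, Ys})).comp E =
        ((Ideal.Quotient.mk (Ideal.span {Xs, Ys})).comp cS).comp (ev0 (k := k)).toRingHom := by
      apply MvPolynomial.ringHom_ext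
      · intro t
        simp [E, ev0]
      · intro i
        fin_cases i
        · simp [E, ev0, Ideal.Quotient.eq_zero_iff_mem]
          exact Ideal.subset_span (by simp)
        · simp [E, ev0, Ideal.Quotient.eq_zero_iff_mem]
          exact Ideal.subset_span (by simp)
        · simp [E, ev0]
    exact RingHom.congr_fun h1 r
  have hle : Ideal.span {Xs, Ys} ≤ IsLocalRing.maximalIdeal S := by
    rw [Ideal.span_le]
    rintro t (rfl | rfl)
    · exact fun h => hXY h.dvd
    · exact fun h => hYX h.dvd
  refine not_reg Xs Ys (le_antisymm ?_ hle) ⟨3, hpow⟩ hXY hYX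
  intro s hs
  obtain ⟨n, r1, r2, hr1, hr2, h2, hs2, hn0⟩ := hform s
  have hmul : s * E r2 = E r1 := by
    apply hι
    rw [map_mul, hs2]
    apply mul_right_cancel₀ (pow_ne_zero n hz)
    rw [hE n r1 hr1, mul_assoc, hE n r2 hr2, div_mul_cancel₀ _ hn0]
  have hunit : ∀ t : k, t ≠ 0 → IsUnit (cS t) := fun t ht => (IsUnit.mk0 t ht).map cS
  have h1 : ev0 r1 = 0 := by
    by_contra h
    have h4 : cS (ev0 r1) ∈ IsLocalRing.maximalIdeal S := by
      have h5 : E r1 ∈ IsLocalRing.maximalIdeal S := by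
        rw [← hmul]; exact Ideal.mul_mem_right _ _ hs
      simpa using Ideal.sub_mem _ h5 (hle (hmod r1))
    exact h4 (hunit _ h)
  have hu2 : IsUnit (E r2) := by
    by_contra h
    have h4 : cS (ev0 r2) ∈ IsLocalRing.maximalIdeal S := by
      have h5 : E r2 ∈ IsLocalRing.maximalIdeal S := h
      simpa using Ideal.sub_mem _ h5 (hle (hmod r2))
    exact h4 (hunit _ h2)
  have h6 := hmod r1
  rw [h1, map_zero, sub_zero, ← hmul] at h6
  exact (Ideal.mul_unit_mem_iff_mem _ hu2).1 h6

theorem uniq_sing (ha : a ≠ 0) (hc : c ≠ 0)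
    (hrel : π (X 2) * (algebraMap k A a * π (X 1) ^ 4 + algebraMap k A b * π (X 0) ^ 2 * π (X 1)) +
      algebraMap k A c * π (X 0) ^ 3 + algebraMap k A d * π (X 0) * π (X 1) ^ 3 = 0)
    (hlift : ∀ (B : Type) [CommRing B] [Algebra k B] (v : Fin 3 → B),
      v 2 * (algebraMap k B a * v 1 ^ 4 + algebraMap k B b * v 0 ^ 2 * v 1) +
        algebraMap k B c * v 0 ^ 3 + algebraMap k B d * v 0 * v 1 ^ 3 = 0 →
      ∃ φ : A →ₐ[k] B, ∀ r, φ (π r) = aeval v r) :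
    ProjHasUniqueSingularPoint k ℬ := by
  -- nonvanishing
  have hnv : π (X 0) ≠ 0 ∧ π (X 1) ≠ 0 ∧
      algebraMap k A a * π (X 1) ^ 3 + algebraMap k A b * π (X 0) ^ 2 ≠ 0 := by
    let l : Polynomial k := Polynomial.C a * Polynomial.X + Polynomial.C b
    have hl : l ≠ 0 := by
      intro h
      have := congrArg (fun p => Polynomial.coeff p 1) h
      simp [l] at this
      exact ha this
    have hX : (Polynomial.X : Polynomial k) ≠ 0 := Polynomial.X_ne_zero
    obtain ⟨ψ, hψ⟩ := hlift (Polynomial k) ![Polynomial.X * l ^ 3, Polynomial.X * l ^ 2,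
      - (Polynomial.C c + Polynomial.C d * Polynomial.X)] (by
        simp only [Polynomial.algebraMap_eq, l, Matrix.cons_val]
        ring)
    have h0 : ψ (π (X 0)) = Polynomial.X * l ^ 3 := by simp [hψ]
    have h1 : ψ (π (X 1)) = Polynomial.X * l ^ 2 := by simp [hψ]
    refine ⟨fun h => ?_, fun h => ?_, fun h => ?_⟩
    · rw [h, map_zero] at h0
      exact mul_ne_zero hX (pow_ne_zero _ hl) h0.symm
    · rw [h, map_zero] at h1
      exact mul_ne_zero hX (pow_ne_zero _ hl) h1.symm
    · have h2 := congrArg ψ h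
      rw [map_add, map_mul, map_mul, map_pow, map_pow, h0, h1, AlgHom.commutes, AlgHom.commutes,
        map_zero, Polynomial.algebraMap_eq] at h2
      apply mul_ne_zero (pow_ne_zero 2 hX) (pow_ne_zero 7 hl)
      rw [← h2]
      simp only [l]
      ring
  obtain ⟨hx0, hy0, hl0⟩ := hnv
  obtain ⟨φ0, hφ0⟩ := hlift k ![0, 0, 1] (by simp)
  let P0 : Ideal A := Ideal.span {π (X 0), π (X 1)}
  have hxP0 : π (X 0) ∈ P0 := Ideal.subset_span (by simp)
  have hyP0 : π (X 1) ∈ P0 := Ideal.subset_span (by simp)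
  have hchar0 : ∀ n (r : MvPolynomial (Fin 3) k), r.IsWeightedHomogeneous w3 n →
      (π r ∈ P0 ↔ ev0 r = 0) := by
    intro n r hr
    constructor
    · intro h
      have hle : P0 ≤ RingHom.ker φ0 := by
        rw [Ideal.span_le]
        rintro t (rfl | rfl)
        · change φ0 _ = 0
          simp [hφ0]
        · change φ0 _ = 0
          simp [hφ0]
      have : φ0 (π r) = 0 := hle h
      rwa [hφ0] at this
    · intro h
      rw [mem_iff_xy π P0 hxP0 hyP0 hr, h]
      simp
  have hhom0 : P0.IsHomogeneous ℬ := by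
    apply Ideal.homogeneous_span
    rintro t (rfl | rfl)
    · exact ⟨_, memX π ℬ hℬ 0⟩
    · exact ⟨_, memX π ℬ hℬ 1⟩
  have hz0 : π (X 2) ∉ P0 := by
    rw [hchar0 1 (X 2) (isWeightedHomogeneous_X k w3 2)]
    simp [ev0]
  have hprime0 : P0.IsPrime := by
    refine hhom0.isPrime_of_homogeneous_mem_or_mem (fun h => hz0 (by rw [h]; trivial)) ?_
    rintro g h ⟨i, hi⟩ ⟨j, hj⟩ hgh
    obtain ⟨r1, hr1, rfl⟩ := (hℬ _ _).1 hi
    obtain ⟨r2, hr2, rfl⟩ := (hℬ _ _).1 hj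
    rw [← map_mul, hchar0 _ _ (hr1.mul hr2), map_mul, mul_eq_zero] at hgh
    rwa [hchar0 _ _ hr1, hchar0 _ _ hr2]
  let p0 : ProjectiveSpectrum ℬ := ⟨⟨P0, hhom0⟩, hprime0, fun h => hz0 (h
    (HomogeneousIdeal.mem_irrelevant_of_mem ℬ one_pos (memX π ℬ hℬ 2)))⟩
  have hstalk : ∀ p : ProjectiveSpectrum ℬ,
      IsRegLocalRing ((AlgebraicGeometry.Proj ℬ).presheaf.stalk p) ↔
      IsRegLocalRing (HomogeneousLocalization.AtPrime ℬ
        p.asHomogeneousIdeal.toIdeal) := fun p =>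
    ⟨reg_of_equiv (AlgebraicGeometry.Proj.stalkIso ℬ p).commRingCatIsoToRingEquiv,
     reg_of_equiv (AlgebraicGeometry.Proj.stalkIso ℬ p).commRingCatIsoToRingEquiv.symm⟩
  have hle_of : ∀ I J : Ideal A, I.IsHomogeneous ℬ →
      (∀ n (r : MvPolynomial (Fin 3) k), r.IsWeightedHomogeneous w3 n → π r ∈ I → π r ∈ J) →
      I ≤ J := by
    intro I J hI h g hg
    classical
    rw [← DirectSum.sum_support_decompose ℬ g]
    refine Ideal.sum_mem _ fun i _ => ?_
    obtain ⟨r, hr, hr2⟩ := (hℬ _ _).1 (DirectSum.decompose ℬ g i).2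
    rw [← hr2]
    apply h i r hr
    rw [hr2]
    exact hI i hg
  refine ⟨p0, ?_, ?_⟩
  · change ¬ IsRegLocalRing ((AlgebraicGeometry.Proj ℬ).presheaf.stalk p0)
    refine mt (hstalk p0).1 ?_
    exact sing_case π ℬ hℬ a b c d hc hrel hlift P0 hchar0
  · intro p hp
    change ¬ IsRegLocalRing ((AlgebraicGeometry.Proj ℬ).presheaf.stalk p) at hp
    let q : ProjectiveSpectrum ℬ := p
    replace hp := mt (hstalk q).2 hp
    change q = p0
    have hqp : q.asHomogeneousIdeal.toIdeal.IsPrime := q.isPrime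
    have hxy : π (X 0) ∈ q.asHomogeneousIdeal.toIdeal ∧ π (X 1) ∈ q.asHomogeneousIdeal.toIdeal := by
      by_contra h
      exact hp (reg_case π ℬ hℬ a b c d ha hrel hx0 hy0 hl0 _ h)
    have hzq : π (X 2) ∉ q.asHomogeneousIdeal.toIdeal := by
      intro hz
      apply q.not_irrelevant_le
      rw [HomogeneousIdeal.irrelevant_le]
      intro i hi g hg
      obtain ⟨r, hr, rfl⟩ := (hℬ _ _).1 hg
      exact (mem_iff_xy π q.asHomogeneousIdeal.toIdeal hxy.1 hxy.2 hr).2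
        (Ideal.mul_mem_right _ _ (Ideal.pow_mem_of_mem _ hz _ hi))
    have hcharq : ∀ n (r : MvPolynomial (Fin 3) k), r.IsWeightedHomogeneous w3 n →
        (π r ∈ q.asHomogeneousIdeal.toIdeal ↔ ev0 r = 0) := by
      intro n r hr
      rw [mem_iff_xy π q.asHomogeneousIdeal.toIdeal hxy.1 hxy.2 hr]
      constructor
      · intro h
        by_contra hne
        rw [Ideal.mul_unit_mem_iff_mem _ ((IsUnit.mk0 _ hne).map (algebraMap k A))] at h
        exact hzq (hqp.mem_of_pow_mem _ h)
      · intro h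
        rw [h]; simp
    apply ProjectiveSpectrum.ext
    apply HomogeneousIdeal.toIdeal_injective
    apply le_antisymm
    · exact hle_of _ _ q.asHomogeneousIdeal.isHomogeneous fun n r hr h =>
        (hchar0 n r hr).2 ((hcharq n r hr).1 h)
    · exact hle_of _ _ hhom0 fun n r hr h =>
        (hcharq n r hr).2 ((hchar0 n r hr).1 h)

end main


/-- Proposition 2.19 (curve-singularities): if `f ∈ R₉` is irreducible and has degree 1
in `z`, then the curve `C = Proj (R/fR) ⊆ ℙ(3,2,1)` has exactly one singular point.
Here the grading on `R/fR` is the one induced by the weighted grading of `R = k[x,y,z]`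
with weights `(3,2,1)`. -/
theorem statement_13 (k : Type) [Field k] [IsAlgClosed k] [CharZero k]
    (f : MvPolynomial (Fin 3) k)
    (hf9 : f.IsWeightedHomogeneous w3 9)
    (hC1 : Irreducible f)
    (hdz : f.degreeOf 2 = 1) :
    ∃ (ℬ : ℕ → Submodule k (MvPolynomial (Fin 3) k ⧸ Ideal.span {f}))
      (inst : GradedAlgebra ℬ),
      (∀ (i : ℕ) (r : MvPolynomial (Fin 3) k), r.IsWeightedHomogeneous w3 i →
        Ideal.Quotient.mk (Ideal.span {f}) r ∈ ℬ i) ∧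
      @ProjHasUniqueSingularPoint k _ _ _ _ ℬ inst := by
  refine ⟨gr (Ideal.span {f}), grAlg hf9, fun i r hr => mem_gr _ hr, ?_⟩
  obtain ⟨a, b, c, d, ha, hc, hf⟩ := f_shape hf9 hC1 hdz
  have hpr : (Ideal.span {f}).IsPrime :=
    (Ideal.span_singleton_prime hC1.ne_zero).2 hC1.prime
  have hdom : IsDomain (MvPolynomial (Fin 3) k ⧸ Ideal.span {f}) := Ideal.Quotient.isDomain _
  let _ := grAlg hf9
  refine uniq_sing (Ideal.Quotient.mkₐ k (Ideal.span {f})) (gr (Ideal.span {f})) ?_ a b c d ha hc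
    ?_ ?_
  · intro i g
    constructor
    · rintro ⟨r, hr, h⟩
      exact ⟨r, hr, h⟩
    · rintro ⟨r, hr, h⟩
      exact ⟨r, hr, h⟩
  · have h0 : Ideal.Quotient.mkₐ k (Ideal.span {f}) f = 0 :=
      Ideal.Quotient.eq_zero_iff_mem.2 (Ideal.mem_span_singleton_self f)
    have hC : ∀ t : k, Ideal.Quotient.mkₐ k (Ideal.span {f}) (C t) = algebraMap k _ t := fun t =>
      (Ideal.Quotient.mkₐ k (Ideal.span {f})).commutes t
    have h1 := (congrArg (Ideal.Quotient.mkₐ k (Ideal.span {f})) hf).symm.trans h0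
    simp only [map_add, map_mul, map_pow, hC] at h1
    exact h1
  · intro B _ _ v hv
    have hv' : aeval v f = 0 := by
      rw [hf]
      simp only [map_add, map_mul, map_pow, aeval_X, aeval_C]
      exact hv
    refine ⟨Ideal.Quotient.liftₐ _ (aeval v) ?_, fun r => rfl⟩
    intro g hg
    obtain ⟨h, rfl⟩ := Ideal.mem_span_singleton.1 hg
    rw [map_mul, hv', zero_mul]
end
end

section
/- Let D be an irreducible homogeneous locally nilpotent derivation of R with ker D = k[g,h] for homogeneous g ∈ R_3 and h ∈ R_4. Then, after applying a suitable degree-preserving (graded) k-algebra automorphism of R, one has ker D = k[x, xz + y²], and y is a minimal local slice for D. -/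
open MvPolynomial

set_option synthInstance.maxHeartbeats 400000
set_option maxHeartbeats 1000000

noncomputable section

/-- A derivation `D` is irreducible if the only principal ideal of `B` containing the
image of `D` is `B` itself. -/
def IsIrreducibleDeriv {k B : Type*} [CommRing k] [CommRing B] [Algebra k B]
    (D : Derivation k B B) : Prop :=
  ∀ b : B, (∀ r : B, D r ∈ Ideal.span {b}) → IsUnit b

/-- `D` is a homogeneous derivation of degree `m` with respect to the `ℕ`-grading of
`k[x,y,z]` in which the variables have weights `w`, i.e. `D(R_i) ⊆ R_{i+m}` for all `i`. -/
def DerivIsHomogOfDeg {k : Type} [Field k] (w : Fin 3 → ℕ)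
    (D : Derivation k (MvPolynomial (Fin 3) k) (MvPolynomial (Fin 3) k)) (m : ℤ) : Prop :=
  ∀ (i : ℕ) (f : MvPolynomial (Fin 3) k), f.IsWeightedHomogeneous w i →
    (∀ j : ℕ, (j : ℤ) = (i : ℤ) + m → (D f).IsWeightedHomogeneous w j) ∧
    ((i : ℤ) + m < 0 → D f = 0)

/-- `r` is a local slice of `D`: `D r ≠ 0` and `D² r = 0`. -/
def IsLocalSlice {k B : Type*} [CommRing k] [CommRing B] [Algebra k B]
    (D : Derivation k B B) (r : B) : Prop :=
  D r ≠ 0 ∧ D (D r) = 0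

/-- `r` is a minimal local slice of `D`: a local slice such that whenever
`(ker D)[r] ⊆ (ker D)[g]` for another local slice `g`, the two rings are equal. -/
def IsMinimalLocalSlice {k B : Type*} [CommRing k] [CommRing B] [Algebra k B]
    (D : Derivation k B B) (r : B) : Prop :=
  IsLocalSlice D r ∧ ∀ g : B, IsLocalSlice D g →
    Algebra.adjoin k ({b : B | D b = 0} ∪ {r}) ≤ Algebra.adjoin k ({b : B | D b = 0} ∪ {g}) →
    Algebra.adjoin k ({b : B | D b = 0} ∪ {r}) = Algebra.adjoin k ({b : B | D b = 0} ∪ {g})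

section gen
set_option linter.unusedSectionVars false
variable {k B : Type*} [Field k] [CharZero k] [CommRing B] [Algebra k B]

theorem iter_mem (D : Derivation k B B) (I : Ideal B) (hI : ∀ b ∈ I, D b ∈ I) (n : ℕ) :
    ∀ b ∈ I, (⇑D)^[n] b ∈ I := by
  induction n with
  | zero => intro b hb; simpa using hb
  | succ n ih => intro b hb; rw [Function.iterate_succ_apply]; exact ih _ (hI _ hb)

theorem iter_add (D : Derivation k B B) (n : ℕ) :
    ∀ a b, (⇑D)^[n] (a + b) = (⇑D)^[n] a + (⇑D)^[n] b := by
  induction n with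
  | zero => intro a b; simp
  | succ n ih => intro a b; simp only [Function.iterate_succ_apply, map_add, ih]

theorem leib (D : Derivation k B B) (I : Ideal B) (hI : ∀ b ∈ I, D b ∈ I) (N : ℕ) :
    ∀ n m : ℕ, n + m = N → ∀ p q : B, (⇑D)^[n+1] p ∈ I → (⇑D)^[m+1] q ∈ I →
      (⇑D)^[N] (p * q) - (N.choose n : B) * ((⇑D)^[n] p * (⇑D)^[m] q) ∈ I := by
  induction N with
  | zero =>
    intro n m h p q _ _
    obtain rfl : n = 0 := by omega
    obtain rfl : m = 0 := by omega
    simp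
  | succ N ih =>
    intro n m h p q hp hq
    rw [Function.iterate_succ_apply, Derivation.leibniz, iter_add, smul_eq_mul, smul_eq_mul]
    rcases n with _ | n
    · obtain rfl : m = N + 1 := by omega
      have h1 := ih 0 N (by omega) p (D q) hp (by simpa [Function.iterate_succ_apply] using hq)
      have h2 : (⇑D)^[N] (q * D p) ∈ I :=
        iter_mem D I hI N _ (I.mul_mem_left _ (by simpa using hp))
      have := I.add_mem h1 h2
      simp only [Function.iterate_succ_apply, Nat.choose_zero_right] at this ⊢
      convert this using 1; ring
    rcases m with _ | m
    · obtain rfl : n = N := by omega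
      have h1 := ih n 0 (by omega) (D p) q (by simpa [Function.iterate_succ_apply] using hp) hq
      have h2 : (⇑D)^[n] (p * D q) ∈ I :=
        iter_mem D I hI n _ (I.mul_mem_left _ (by simpa using hq))
      have := I.add_mem h1 h2
      simp only [Function.iterate_succ_apply, Nat.choose_self, mul_comm (D p) q] at this ⊢
      convert this using 1; ring
    have h1 := ih (n+1) m (by omega) p (D q) hp (by simpa [Function.iterate_succ_apply] using hq)
    have h2 := ih n (m+1) (by omega) (D p) q (by simpa [Function.iterate_succ_apply] using hp) hq
    have := I.add_mem h1 h2
    simp only [Function.iterate_succ_apply, Nat.choose_succ_succ, mul_comm (D p) q] at this ⊢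
    push_cast
    convert this using 1; ring

theorem fac (D : Derivation k B B) (I : Ideal B) (hI : ∀ b ∈ I, D b ∈ I) [hP : I.IsPrime]
    (hl : IsLND D) (p q : B) (hp : p ∉ I) (hq : q ∉ I) (h : D (p * q) ∈ I) :
    D p ∈ I ∧ D q ∈ I := by
  classical
  have key : ∀ p, p ∉ I → ∃ n, (⇑D)^[n] p ∉ I ∧ (⇑D)^[n+1] p ∈ I := by
    intro p hp
    have ex : ∃ n, (⇑D)^[n] p ∈ I := by
      obtain ⟨n, hn⟩ := hl p
      exact ⟨n, by rw [hn]; exact I.zero_mem⟩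
    have h0 : Nat.find ex ≠ 0 := by
      intro h0
      have := Nat.find_spec ex
      rw [h0] at this
      exact hp (by simpa using this)
    obtain ⟨n, hn⟩ := Nat.exists_eq_succ_of_ne_zero h0
    refine ⟨n, Nat.find_min ex (by omega), ?_⟩
    have := Nat.find_spec ex
    rwa [hn] at this
  obtain ⟨n, hn, hn'⟩ := key p hp
  obtain ⟨m, hm, hm'⟩ := key q hq
  have hL := leib D I hI (n+m) n m rfl p q hn' hm'
  have hz : n + m = 0 := by
    by_contra hne
    obtain ⟨N, hN⟩ := Nat.exists_eq_succ_of_ne_zero hne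
    have h1 : (⇑D)^[n+m] (p*q) ∈ I := by
      rw [hN, Nat.succ_eq_add_one, Function.iterate_succ_apply]
      exact iter_mem D I hI N _ h
    have h2 := I.sub_mem h1 hL
    rw [sub_sub_cancel] at h2
    have hc : ((n+m).choose n : k) ≠ 0 := by
      exact_mod_cast (Nat.choose_pos (by omega)).ne'
    have h3 := I.mul_mem_left (algebraMap k B ((n+m).choose n : k)⁻¹) h2
    rw [← mul_assoc, ← map_natCast (algebraMap k B), ← map_mul, inv_mul_cancel₀ hc, map_one,
      one_mul] at h3
    rcases hP.mem_or_mem h3 with h | h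
    · exact hn h
    · exact hm h
  obtain rfl : n = 0 := by omega
  obtain rfl : m = 0 := by omega
  exact ⟨by simpa using hn', by simpa using hm'⟩

theorem fac0 [IsDomain B] (D : Derivation k B B) 
    (hl : IsLND D) (p q : B) (hp : p ≠ 0) (hq : q ≠ 0) (h : D (p * q) = 0) :
    D p = 0 ∧ D q = 0 := by
  have := fac D ⊥ (by simp) hl p q (by simpa using hp) (by simpa using hq) (by simpa using h)
  simpa using this

theorem integ (D : Derivation k B B) (A : Subalgebra k B) (hA : ∀ a ∈ A, D a = 0) (r : B)
    (P : Polynomial A) : ∃ Q : Polynomial A,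
      D (Polynomial.aeval r Q) = D r * Polynomial.aeval r P := by
  induction P using Polynomial.induction_on' with
  | add p q hp hq =>
    obtain ⟨P, hP⟩ := hp
    obtain ⟨Q, hQ⟩ := hq
    exact ⟨P + Q, by simp [hP, hQ, mul_add]⟩
  | monomial n a =>
    refine ⟨Polynomial.monomial (n+1) (algebraMap k A ((n+1 : ℕ) : k)⁻¹ * a), ?_⟩
    have hc : ((n+1 : ℕ) : k) ≠ 0 := by exact_mod_cast Nat.succ_ne_zero n
    have h1 : algebraMap k B ((n+1 : ℕ) : k)⁻¹ * ((n+1 : ℕ) : B) = 1 := by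
      rw [← map_natCast (algebraMap k B), ← map_mul, inv_mul_cancel₀ hc, map_one]
    rw [Polynomial.aeval_monomial, Polynomial.aeval_monomial, Derivation.leibniz,
      show D (algebraMap A B _) = 0 from hA _ (SetLike.coe_mem _), Derivation.leibniz_pow]
    simp only [map_mul, smul_eq_mul, nsmul_eq_mul, mul_zero, add_zero, Nat.add_sub_cancel]
    change algebraMap k B _ * (a : B) * _ = D r * ((a : B) * r^n)
    linear_combination ((a : B) * r^n * D r) * h1

theorem bigker [IsDomain B] (D : Derivation k B B) (hl : IsLND D) (hD : ∃ b, D b ≠ 0) (p : B)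
    (hk : ∀ r, D r = 0 ↔ r ∈ Algebra.adjoin k ({p} : Set B)) : Algebra.trdeg k B ≤ 2 := by
  classical
  obtain ⟨r, hr, hr2⟩ : ∃ r, D r ≠ 0 ∧ D (D r) = 0 := by
    obtain ⟨b, hb⟩ := hD
    have ex := hl b
    have h0 : Nat.find ex ≠ 0 := by
      intro h0
      have := Nat.find_spec ex
      rw [h0] at this
      exact hb (by simp at this; simp [this])
    have h1 : Nat.find ex ≠ 1 := by
      intro h0
      have := Nat.find_spec ex
      rw [h0] at this
      exact hb (by simpa using this)
    obtain ⟨n, hn⟩ : ∃ n, Nat.find ex = n + 2 := ⟨Nat.find ex - 2, by omega⟩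
    refine ⟨(⇑D)^[n] b, ?_, ?_⟩
    · have := Nat.find_min ex (m := n+1) (by omega)
      rwa [Function.iterate_succ_apply'] at this
    · have := Nat.find_spec ex
      rwa [hn, Function.iterate_succ_apply', Function.iterate_succ_apply'] at this
  set A := Algebra.adjoin k ({p} : Set B) with hAdef
  have hA : ∀ a ∈ A, D a = 0 := fun a ha => (hk a).2 ha
  have key : ∀ n : ℕ, ∀ b, (⇑D)^[n] b = 0 → ∃ a : B, a ∈ A ∧ a ≠ 0 ∧ ∃ P : Polynomial A,
      a * b = Polynomial.aeval r P := by
    intro n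
    induction n with
    | zero => intro b hb; exact ⟨1, A.one_mem, one_ne_zero, 0, by simpa using hb⟩
    | succ n ih =>
      intro b hb
      obtain ⟨a, ha, ha0, P, hP⟩ := ih (D b) (by rwa [Function.iterate_succ_apply] at hb)
      obtain ⟨Q, hQ⟩ := integ D A hA r P
      have h0 : D (D r * a * b - Polynomial.aeval r Q) = 0 := by
        rw [map_sub, hQ, Derivation.leibniz, Derivation.leibniz, hr2, hA a ha, ← hP]
        simp only [smul_eq_mul]; ring
      refine ⟨D r * a, A.mul_mem ((hk _).1 hr2) ha, mul_ne_zero hr ha0,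
        Q + Polynomial.C ⟨_, (hk _).1 h0⟩, ?_⟩
      rw [map_add, Polynomial.aeval_C]
      change _ = _ + (D r * a * b - Polynomial.aeval r Q)
      ring
  have hle : A ≤ Algebra.adjoin k ({p, r} : Set B) := Algebra.adjoin_mono (by simp)
  have : Algebra.IsAlgebraic (Algebra.adjoin k ({p, r} : Set B)) B := by
    constructor
    intro b
    obtain ⟨n, hn⟩ := hl b
    obtain ⟨a, ha, ha0, P, hP⟩ := key n b hn
    have hm : a * b ∈ Algebra.adjoin k ({p, r} : Set B) := by
      rw [hP, Polynomial.aeval_eq_sum_range]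
      refine Subalgebra.sum_mem _ fun i _ => ?_
      rw [Algebra.smul_def]
      exact Subalgebra.mul_mem _ (hle (SetLike.coe_mem (P.coeff i)))
        (Subalgebra.pow_mem _ (Algebra.subset_adjoin (by simp)) _)
    refine ⟨Polynomial.C ⟨a, hle ha⟩ * Polynomial.X - Polynomial.C ⟨a*b, hm⟩, ?_, ?_⟩
    · intro h0
      have := congrArg (fun q => Polynomial.coeff q 1) h0
      simp [Polynomial.coeff_C] at this
      exact ha0 (congrArg Subtype.val this)
    · simp only [map_sub, map_mul, Polynomial.aeval_C, Polynomial.aeval_X]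
      exact sub_self (a * b)
  refine (Algebra.IsAlgebraic.trdeg_le_cardinalMk k ({p, r} : Set B)).trans ?_
  refine (Cardinal.mk_insert_le).trans ?_
  rw [Cardinal.mk_singleton]; norm_num
end gen
section poly
variable {k : Type} [Field k]

theorem hom_ind (P : MvPolynomial (Fin 3) k → Prop) (n : ℕ) (h0 : P 0)
    (ha : ∀ p q, P p → P q → P (p + q))
    (hm : ∀ (r : k) (a b c : ℕ), 3 * a + 2 * b + c = n → P (C r * (X 0 ^ a * X 1 ^ b * X 2 ^ c)))
    (f : MvPolynomial (Fin 3) k) (hf : f.IsWeightedHomogeneous w3 n) : P f := by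
  rw [f.as_sum]
  refine Finset.sum_induction _ P ha h0 fun d hd => ?_
  have hw := hf (mem_support_iff.1 hd)
  rw [monomial_eq, Finsupp.prod_fintype _ _ (by simp), Fin.prod_univ_three]
  apply hm
  rw [Finsupp.weight_apply, Finsupp.sum_fintype _ _ (by simp), Fin.sum_univ_three] at hw
  simp [w3] at hw
  omega

theorem form3 (f : MvPolynomial (Fin 3) k) (hf : f.IsWeightedHomogeneous w3 3) :
    ∃ a b c : k, f = C a * X 0 + C b * (X 1 * X 2) + C c * X 2 ^ 3 := by
  refine hom_ind (fun f => ∃ a b c : k, f = C a * X 0 + C b * (X 1 * X 2) + C c * X 2 ^ 3) 3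
    ⟨0, 0, 0, by simp⟩ ?_ ?_ f hf
  · rintro p q ⟨a, b, c, rfl⟩ ⟨a', b', c', rfl⟩
    exact ⟨a + a', b + b', c + c', by simp only [C_add]; ring⟩
  · intro r a b c h
    have : (a = 1 ∧ b = 0 ∧ c = 0) ∨ (a = 0 ∧ b = 1 ∧ c = 1) ∨ (a = 0 ∧ b = 0 ∧ c = 3) := by omega
    rcases this with ⟨rfl, rfl, rfl⟩ | ⟨rfl, rfl, rfl⟩ | ⟨rfl, rfl, rfl⟩
    · exact ⟨r, 0, 0, by simp⟩
    · exact ⟨0, r, 0, by simp⟩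
    · exact ⟨0, 0, r, by simp⟩

theorem form4 (f : MvPolynomial (Fin 3) k) (hf : f.IsWeightedHomogeneous w3 4) :
    ∃ a b c d : k, f = C a * (X 0 * X 2) + C b * X 1 ^ 2 + C c * (X 1 * X 2 ^ 2)
      + C d * X 2 ^ 4 := by
  refine hom_ind (fun f => ∃ a b c d : k, f = C a * (X 0 * X 2) + C b * X 1 ^ 2
    + C c * (X 1 * X 2 ^ 2) + C d * X 2 ^ 4) 4
    ⟨0, 0, 0, 0, by simp⟩ ?_ ?_ f hf
  · rintro p q ⟨a, b, c, d, rfl⟩ ⟨a', b', c', d', rfl⟩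
    exact ⟨a + a', b + b', c + c', d + d', by simp only [C_add]; ring⟩
  · intro r a b c h
    have : (a = 1 ∧ b = 0 ∧ c = 1) ∨ (a = 0 ∧ b = 2 ∧ c = 0) ∨ (a = 0 ∧ b = 1 ∧ c = 2)
      ∨ (a = 0 ∧ b = 0 ∧ c = 4) := by omega
    rcases this with ⟨rfl, rfl, rfl⟩ | ⟨rfl, rfl, rfl⟩ | ⟨rfl, rfl, rfl⟩ | ⟨rfl, rfl, rfl⟩
    · exact ⟨r, 0, 0, 0, by simp⟩
    · exact ⟨0, r, 0, 0, by simp⟩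
    · exact ⟨0, 0, r, 0, by simp⟩
    · exact ⟨0, 0, 0, r, by simp⟩

theorem aeval_hom (u : Fin 3 → MvPolynomial (Fin 3) k)
    (hu : ∀ i, (u i).IsWeightedHomogeneous w3 (w3 i)) (n : ℕ)
    (f : MvPolynomial (Fin 3) k) (hf : f.IsWeightedHomogeneous w3 n) :
    (aeval u f).IsWeightedHomogeneous w3 n := by
  refine hom_ind (fun f => (aeval u f).IsWeightedHomogeneous w3 n) n ?_ ?_ ?_ f hf
  · rw [map_zero]; exact isWeightedHomogeneous_zero _ _ _
  · intro p q hp hq; rw [map_add]; exact hp.add hq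
  · intro r a b c h
    simp only [map_mul, map_pow, aeval_X, algHom_C]
    refine IsWeightedHomogeneous.C_mul ?_ r
    have := (((hu 0).pow a).mul ((hu 1).pow b)).mul ((hu 2).pow c)
    convert this using 1
    simp [w3]; omega

theorem auto (a b c s t m : k) (ha : a ≠ 0) (hs : s ≠ 0) (hm : m ≠ 0) :
    ∃ φ : MvPolynomial (Fin 3) k ≃ₐ[k] MvPolynomial (Fin 3) k,
      φ (X 0) = C a * X 0 + C b * (X 1 * X 2) + C c * X 2 ^ 3 ∧
      φ (X 1) = C s * (X 1 + C t * X 2 ^ 2) ∧ φ (X 2) = C m * X 2 ∧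
      ∀ (i : ℕ) (r : MvPolynomial (Fin 3) k),
        r.IsWeightedHomogeneous w3 i → (φ.symm r).IsWeightedHomogeneous w3 i := by
  let u : Fin 3 → MvPolynomial (Fin 3) k :=
    ![C a * X 0 + C b * (X 1 * X 2) + C c * X 2 ^ 3, C s * (X 1 + C t * X 2 ^ 2), C m * X 2]
  let v2 : MvPolynomial (Fin 3) k := C m⁻¹ * X 2
  let v1 : MvPolynomial (Fin 3) k := C s⁻¹ * X 1 - C t * v2 ^ 2
  let v0 : MvPolynomial (Fin 3) k := C a⁻¹ * (X 0 - C b * (v1 * v2) - C c * v2 ^ 3)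
  let v : Fin 3 → MvPolynomial (Fin 3) k := ![v0, v1, v2]
  have ea : (C a : MvPolynomial (Fin 3) k) * C a⁻¹ = 1 := by
    rw [← C_mul, mul_inv_cancel₀ ha, C_1]
  have es : (C s : MvPolynomial (Fin 3) k) * C s⁻¹ = 1 := by
    rw [← C_mul, mul_inv_cancel₀ hs, C_1]
  have em : (C m : MvPolynomial (Fin 3) k) * C m⁻¹ = 1 := by
    rw [← C_mul, mul_inv_cancel₀ hm, C_1]
  have X0 : (X 0 : MvPolynomial (Fin 3) k).IsWeightedHomogeneous w3 3 :=
    isWeightedHomogeneous_X k w3 0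
  have X1 : (X 1 : MvPolynomial (Fin 3) k).IsWeightedHomogeneous w3 2 :=
    isWeightedHomogeneous_X k w3 1
  have X2 : (X 2 : MvPolynomial (Fin 3) k).IsWeightedHomogeneous w3 1 :=
    isWeightedHomogeneous_X k w3 2
  have h2 : v2.IsWeightedHomogeneous w3 1 := X2.C_mul _
  have h1 : v1.IsWeightedHomogeneous w3 2 := (X1.C_mul _).sub ((h2.pow 2).C_mul _)
  have h0 : v0.IsWeightedHomogeneous w3 3 :=
    ((X0.sub ((h1.mul h2).C_mul _)).sub ((h2.pow 3).C_mul _)).C_mul _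
  have q2 : aeval u v2 = X 2 := by
    simp only [v2, u, map_mul, algHom_C, aeval_X]
    simp
    linear_combination (X 2) * em
  have q1 : aeval u v1 = X 1 := by
    simp only [v1, map_sub, map_mul, map_pow, q2, algHom_C, aeval_X]
    simp [u]
    linear_combination (X 1 + C t * X 2 ^ 2) * es
  have q0 : aeval u v0 = X 0 := by
    simp only [v0, map_sub, map_mul, map_pow, q2, q1, algHom_C, aeval_X]
    simp [u]
    linear_combination (X 0) * ea
  refine ⟨AlgEquiv.ofAlgHom (aeval u) (aeval v) ?_ ?_, ?_, ?_, ?_, ?_⟩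
  · ext1 i
    fin_cases i
    · simpa [v] using q0
    · simpa [v] using q1
    · simpa [v] using q2
  · ext1 i
    fin_cases i
    · simp [u, v]
      simp only [v0]
      linear_combination (X 0 - C b * (v1 * v2) - C c * v2 ^ 3) * ea
    · simp [u, v]
      simp only [v1]
      linear_combination (X 1) * es
    · simp [u, v]
      simp only [v2]
      linear_combination (X 2) * em
  · simp [u]
  · simp [u]
  · simp [u]
  · intro i r hr
    refine aeval_hom v ?_ i r hr
    intro j
    fin_cases j
    · exact h0
    · exact h1
    · exact h2

theorem nolow (g h p : MvPolynomial (Fin 3) k) (i : Fin 3)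
    (hg : eval 0 (pderiv i g) = 0) (hh : eval 0 (pderiv i h) = 0)
    (hp : p ∈ Algebra.adjoin k ({g, h} : Set (MvPolynomial (Fin 3) k))) :
    eval 0 (pderiv i p) = 0 := by
  induction hp using Algebra.adjoin_induction with
  | mem x hx => rcases hx with rfl | rfl <;> assumption
  | algebraMap r => rw [algebraMap_eq, pderiv_C, map_zero]
  | add p q _ _ hp hq => rw [map_add, map_add, hp, hq, add_zero]
  | mul p q _ _ hp hq =>
    rw [Derivation.leibniz, smul_eq_mul, smul_eq_mul, map_add, map_mul, map_mul, hp, hq, mul_zero,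
      mul_zero, add_zero]

theorem D_ideal (D : Derivation k (MvPolynomial (Fin 3) k) (MvPolynomial (Fin 3) k))
    (I : Ideal (MvPolynomial (Fin 3) k)) (φ : MvPolynomial (Fin 3) k ≃ₐ[k] MvPolynomial (Fin 3) k)
    (h0 : D (φ (X 0)) ∈ I) (h1 : D (φ (X 1)) ∈ I) (h2 : D (φ (X 2)) ∈ I)
    (r : MvPolynomial (Fin 3) k) : D r ∈ I := by
  suffices ∀ p, D (φ p) ∈ I by simpa using this (φ.symm r)
  intro p
  induction p using MvPolynomial.induction_on with
  | C a => rw [← algebraMap_eq, AlgEquiv.commutes, Derivation.map_algebraMap]; exact I.zero_mem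
  | add p q hp hq => rw [map_add, map_add]; exact I.add_mem hp hq
  | mul_X p i hp =>
    rw [map_mul, Derivation.leibniz]
    refine I.add_mem (I.mul_mem_left _ ?_) (I.mul_mem_left _ hp)
    fin_cases i <;> assumption
end poly
theorem unitC {k : Type} [Field k] {u : MvPolynomial (Fin 3) k} (hu : IsUnit u) :
    ∃ e : k, e ≠ 0 ∧ u = C e := by
  obtain ⟨e, he, h⟩ := MvPolynomial.isUnit_iff_eq_C_of_isReduced.1 hu
  exact ⟨e, he.ne_zero, h⟩

theorem endgame {k : Type} [Field k] [CharZero k]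
    (D : Derivation k (MvPolynomial (Fin 3) k) (MvPolynomial (Fin 3) k))
    (hirr : IsIrreducibleDeriv D)
    (φ : MvPolynomial (Fin 3) k ≃ₐ[k] MvPolynomial (Fin 3) k)
    (h0 : D (φ (X 0)) = 0) (h1 : D (φ (X 0 * X 2 + X 1 ^ 2)) = 0) :
    IsMinimalLocalSlice D (φ (X 1)) := by
  have hpr : Prime (φ (X 0)) := (MulEquiv.prime_iff φ).2 (MvPolynomial.X_prime (R := k))
  have hx0 := hpr.ne_zero
  have hy : ¬ φ (X 0) ∣ φ (X 1) := by
    rintro ⟨q, hq⟩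
    have h2 := congrArg (fun r => eval (![0, 1, 0] : Fin 3 → k) (φ.symm r)) hq
    simp at h2
  have h2u : IsUnit (2 : MvPolynomial (Fin 3) k) := by
    have := (isUnit_iff_ne_zero.2 (two_ne_zero (α := k))).map (C : k →+* MvPolynomial (Fin 3) k)
    rwa [map_ofNat] at this
  have e1 : φ (X 0) * D (φ (X 2)) + 2 * (φ (X 1) * D (φ (X 1))) = 0 := by
    rw [map_add, map_mul, map_pow, map_add, Derivation.leibniz, Derivation.leibniz_pow, h0] at h1
    simp only [smul_eq_mul, nsmul_eq_mul] at h1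
    linear_combination h1
  have hd : φ (X 0) ∣ D (φ (X 1)) := by
    have : φ (X 0) ∣ 2 * (φ (X 1) * D (φ (X 1))) := ⟨-D (φ (X 2)), by linear_combination e1⟩
    rw [h2u.dvd_mul_left] at this
    exact (hpr.dvd_or_dvd this).resolve_left hy
  obtain ⟨u, hu⟩ := hd
  have hz : D (φ (X 2)) = -2 * φ (X 1) * u := by
    apply mul_left_cancel₀ hx0
    rw [hu] at e1
    linear_combination e1
  have huu : IsUnit u := by
    refine hirr u fun r => D_ideal D _ φ ?_ ?_ ?_ r
    · rw [h0]; exact Ideal.zero_mem _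
    · rw [hu]; exact Ideal.mul_mem_left _ _ (Ideal.mem_span_singleton_self u)
    · rw [hz]; exact Ideal.mul_mem_left _ _ (Ideal.mem_span_singleton_self u)
  obtain ⟨e, he, rfl⟩ := unitC huu
  have hC : ∀ e : k, D (C e) = 0 := fun e => D.map_algebraMap e
  refine ⟨⟨?_, ?_⟩, ?_⟩
  · rw [hu]; exact mul_ne_zero hx0 huu.ne_zero
  · rw [hu, Derivation.leibniz, h0, hC]; simp
  intro s hs hle
  refine le_antisymm hle ?_
  have hdv : D s ∣ D (φ (X 1)) := by
    have hm := hle (Algebra.subset_adjoin (Or.inr rfl) :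
      φ (X 1) ∈ Algebra.adjoin k ({b | D b = 0} ∪ {φ (X 1)}))
    clear * - hm
    generalize φ (X 1) = f at hm
    induction hm using Algebra.adjoin_induction with
    | mem x hx =>
      rcases hx with hx | hx
      · rw [show D x = 0 from hx]; exact dvd_zero _
      · rw [show x = s from hx]
    | algebraMap r => rw [Derivation.map_algebraMap]; exact dvd_zero _
    | add p q _ _ hp hq => rw [map_add]; exact dvd_add hp hq
    | mul p q _ _ hp hq =>
      rw [Derivation.leibniz]; exact dvd_add (Dvd.dvd.mul_left hq _) (Dvd.dvd.mul_left hp _)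
  obtain ⟨q, hq⟩ := hdv
  have hirx : Irreducible (φ (X 0) * C e) := by
    rw [irreducible_mul_isUnit huu]; exact hpr.irreducible
  rcases hirx.isUnit_or_isUnit (hu.symm.trans hq) with h | h
  · exfalso
    have hmem : D s ∈ Ideal.span {φ (X 0), φ (X 1)} := by
      refine D_ideal D _ φ ?_ ?_ ?_ s
      · rw [h0]; exact Ideal.zero_mem _
      · rw [hu, mul_comm]; exact Ideal.mul_mem_left _ _ (Ideal.subset_span (by simp))
      · rw [hz, mul_comm, ← mul_assoc]; exact Ideal.mul_mem_left _ _ (Ideal.subset_span (by simp))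
    obtain ⟨a, b, hab⟩ := Ideal.mem_span_pair.1 hmem
    obtain ⟨e', he', h'⟩ := unitC h
    rw [h'] at hab
    have h2 := congrArg (fun r => eval (![0, 0, 0] : Fin 3 → k) (φ.symm r)) hab
    have h3 : φ.symm (C e') = C e' := φ.symm.commutes e'
    simp [h3] at h2
    exact he' h2.symm
  · obtain ⟨e', he', rfl⟩ := unitC h
    refine Algebra.adjoin_le ?_
    rintro p (hp | hp)
    · exact Algebra.subset_adjoin (Or.inl hp)
    · obtain rfl : p = s := hp
      have hk : D (φ (X 1) - C e' * p) = 0 := by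
        rw [map_sub, Derivation.leibniz, hq, hC]; simp; ring
      have hinv : (C e'⁻¹ : MvPolynomial (Fin 3) k) * C e' = 1 := by
        rw [← C_mul, inv_mul_cancel₀ he', C_1]
      have : p = C e'⁻¹ * (φ (X 1) - (φ (X 1) - C e' * p)) := by
        linear_combination -p * hinv
      rw [this]
      exact Subalgebra.mul_mem _ (Subalgebra.algebraMap_mem _ e'⁻¹)
        (Subalgebra.sub_mem _ (Algebra.subset_adjoin (Or.inr rfl))
          (Algebra.subset_adjoin (Or.inl hk)))
theorem main_aux {k : Type} [Field k] [IsAlgClosed k] [CharZero k]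
    (D : Derivation k (MvPolynomial (Fin 3) k) (MvPolynomial (Fin 3) k))
    (hlnd : IsLND D) (hirr : IsIrreducibleDeriv D)
    (g h : MvPolynomial (Fin 3) k) (hg0 : g ≠ 0) (hh0 : h ≠ 0)
    (hg : g.IsWeightedHomogeneous w3 3) (hh : h.IsWeightedHomogeneous w3 4)
    (hker : ∀ r : MvPolynomial (Fin 3) k,
      D r = 0 ↔ r ∈ Algebra.adjoin k ({g, h} : Set (MvPolynomial (Fin 3) k))) :
    ∃ φ : MvPolynomial (Fin 3) k ≃ₐ[k] MvPolynomial (Fin 3) k,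
      (∀ (i : ℕ) (r : MvPolynomial (Fin 3) k),
        r.IsWeightedHomogeneous w3 i → (φ.symm r).IsWeightedHomogeneous w3 i) ∧
      φ (X 0) = g ∧ φ (X 0 * X 2 + X 1 ^ 2) = h := by
  have hDg : D g = 0 := (hker g).2 (Algebra.subset_adjoin (by simp))
  have hDh : D h = 0 := (hker h).2 (Algebra.subset_adjoin (by simp))
  obtain ⟨a, b, c, hgf⟩ := form3 g hg
  obtain ⟨c1, c2, c3, c4, hhf⟩ := form4 h hh
  have low : ∀ p, D p = 0 → eval 0 (pderiv 1 p) = 0 ∧ eval 0 (pderiv 2 p) = 0 := by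
    intro p hp
    rw [hker] at hp
    refine ⟨nolow g h p 1 ?_ ?_ hp, nolow g h p 2 ?_ ?_ hp⟩ <;>
    · first | rw [hgf] | rw [hhf]
      simp [pderiv_X, Pi.single_apply]
  have hz : D (X 2) ≠ 0 := by
    intro hz
    have := (low _ hz).2
    simp at this
  have hy : ∀ t : k, D (X 1 + C t * X 2 ^ 2) ≠ 0 := by
    intro t hz
    have := (low _ hz).1
    simp [pderiv_X, Pi.single_apply] at this
  have hX2 : (X 2 : MvPolynomial (Fin 3) k) ≠ 0 := X_ne_zero _
  have ha : a ≠ 0 := by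
    rintro rfl
    have e : g = X 2 * (C b * X 1 + C c * X 2 ^ 2) := by rw [hgf, C_0]; ring
    refine hz (fac0 D hlnd (X 2) (C b * X 1 + C c * X 2 ^ 2) hX2 ?_ (by rw [← e, hDg])).1
    intro h0; rw [h0, mul_zero] at e; exact hg0 e
  have ea : (C a : MvPolynomial (Fin 3) k) * C a⁻¹ = 1 := by
    rw [← C_mul, mul_inv_cancel₀ ha, C_1]
  obtain ⟨e1, e2, e3, e4, he⟩ : ∃ e1 e2 e3 e4 : k, h = C e1 * (g * X 2) + (C e2 * X 1 ^ 2
      + C e3 * (X 1 * X 2 ^ 2) + C e4 * X 2 ^ 4) := by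
    refine ⟨c1 * a⁻¹, c2, c3 - c1 * a⁻¹ * b, c4 - c1 * a⁻¹ * c, ?_⟩
    rw [hhf, hgf]
    simp only [C_sub, C_mul]
    linear_combination (-C c1 * X 0 * X 2) * ea
  clear hhf
  -- the ideal generated by g
  obtain ⟨φ0, hφ0, hφ1, hφ2, -⟩ := auto a b c 1 0 1 ha one_ne_zero one_ne_zero
  rw [← hgf] at hφ0
  have hφ1' : φ0 (X 1) = X 1 := by rw [hφ1]; simp
  have hφ2' : φ0 (X 2) = X 2 := by rw [hφ2]; simp
  have hpr : Prime g := by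
    rw [← hφ0]; exact (MulEquiv.prime_iff φ0).2 (MvPolynomial.X_prime (R := k))
  set I := Ideal.span {g} with hIdef
  have hIp : I.IsPrime := (Ideal.span_singleton_prime hg0).2 hpr
  have hgI : g ∈ I := Ideal.mem_span_singleton_self g
  have hI : ∀ b ∈ I, D b ∈ I := by
    intro b hb
    obtain ⟨q, rfl⟩ := Ideal.mem_span_singleton.1 hb
    rw [Derivation.leibniz, hDg, smul_zero, add_zero]
    exact I.mul_mem_right _ hgI
  have hCD : ∀ e : k, D (C e) = 0 := fun e => D.map_algebraMap e
  have hno : ∀ v : Fin 3 → k, eval v g = 0 → ∀ p, eval v p ≠ 0 → p ∉ I := by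
    intro v hv p hp hpI
    obtain ⟨q, rfl⟩ := Ideal.mem_span_singleton.1 hpI
    rw [map_mul, hv, zero_mul] at hp
    exact hp rfl
  have hnoy : ∀ p, eval (![0, 1, 0] : Fin 3 → k) p ≠ 0 → p ∉ I :=
    hno _ (by rw [hgf]; simp)
  have hzI : X 2 ∉ I := hno ![-c / a, 0, 1] (by rw [hgf]; simp; field_simp; ring) _ (by simp)
  have contra : D (X 1) ∈ I → D (X 2) ∈ I → False := by
    intro h1 h2
    refine hpr.not_isUnit (hirr g fun r => D_ideal D I φ0 ?_ ?_ ?_ r)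
    · rw [hφ0, hDg]; exact I.zero_mem
    · rwa [hφ1']
    · rwa [hφ2']
  have unC : ∀ (e : k) (p : MvPolynomial (Fin 3) k), e ≠ 0 → C e * p ∈ I → p ∈ I := by
    intro e p he hp
    have := I.mul_mem_left (C e⁻¹) hp
    rwa [← mul_assoc, ← C_mul, inv_mul_cancel₀ he, C_1, one_mul] at this
  have sqz : D (X 2 ^ 2) ∈ I → D (X 2) ∈ I := by
    intro hs
    rw [sq] at hs
    exact (fac D I hI hlnd _ _ hzI hzI hs).1
  have hbar : D (C e2 * X 1 ^ 2 + C e3 * (X 1 * X 2 ^ 2) + C e4 * X 2 ^ 4) ∈ I := by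
    have : C e2 * X 1 ^ 2 + C e3 * (X 1 * X 2 ^ 2) + C e4 * X 2 ^ 4
      = h - C e1 * (g * X 2) := by rw [he]; ring
    rw [this, map_sub, hDh, zero_sub]
    exact I.neg_mem (hI _ (I.mul_mem_left _ (I.mul_mem_right _ hgI)))
  have he2 : e2 ≠ 0 := by
    rintro rfl
    by_cases he3 : e3 = 0
    · subst he3
      have e : h = X 2 * (C e1 * g + C e4 * X 2 ^ 3) := by rw [he, C_0]; ring
      refine hz (fac0 D hlnd (X 2) (C e1 * g + C e4 * X 2 ^ 3) hX2 ?_ (by rw [← e, hDh])).1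
      intro h0; rw [h0, mul_zero] at e; exact hh0 e
    · have e : (C 0 * X 1 ^ 2 + C e3 * (X 1 * X 2 ^ 2) + C e4 * X 2 ^ 4
        : MvPolynomial (Fin 3) k) = X 2 ^ 2 * (C e3 * X 1 + C e4 * X 2 ^ 2) := by
        rw [C_0]; ring
      rw [e] at hbar
      obtain ⟨q1, q2⟩ := fac D I hI hlnd _ _ (fun hc => hzI (hIp.mem_of_pow_mem _ hc))
        (hnoy _ (by simpa using he3)) hbar
      refine contra ?_ (sqz q1)
      apply unC e3 _ he3
      have : C e3 * D (X 1) = D (C e3 * X 1 + C e4 * X 2 ^ 2) - C e4 * D (X 2 ^ 2) := by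
        rw [map_add, Derivation.leibniz, Derivation.leibniz _ (C e4), hCD, hCD]
        simp only [smul_eq_mul]; ring
      rw [this]
      exact I.sub_mem q2 (I.mul_mem_left _ q1)
  obtain ⟨s, hs⟩ := IsAlgClosed.exists_pow_nat_eq e2 (n := 2) (by norm_num)
  have hs0 : s ≠ 0 := by rintro rfl; exact he2 (by rw [← hs]; simp)
  obtain ⟨t, ht⟩ : ∃ t, e3 = 2 * e2 * t := ⟨e3 / (2 * e2), by field_simp⟩
  obtain ⟨δ, hδ⟩ : ∃ δ, e4 = e2 * t ^ 2 + δ := ⟨e4 - e2 * t ^ 2, by ring⟩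
  have hbf : (C e2 * X 1 ^ 2 + C e3 * (X 1 * X 2 ^ 2) + C e4 * X 2 ^ 4
      : MvPolynomial (Fin 3) k) = C e2 * (X 1 + C t * X 2 ^ 2) ^ 2 + C δ * X 2 ^ 4 := by
    rw [ht, hδ]; simp only [C_mul, C_add, C_pow, map_ofNat]; ring
  have hδ0 : δ = 0 := by
    by_contra hne
    obtain ⟨ρ, hρ⟩ := IsAlgClosed.exists_pow_nat_eq (-δ / e2) (n := 2) (by norm_num)
    have hρ0 : ρ ≠ 0 := by
      rintro rfl
      have : -δ / e2 = 0 := by rw [← hρ]; simp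
      rw [div_eq_zero_iff] at this
      rcases this with h | h
      · exact hne (by simpa using h)
      · exact he2 h
    have hρ' : δ = - (e2 * ρ ^ 2) := by rw [hρ]; field_simp
    have e : (C e2 * (X 1 + C t * X 2 ^ 2) ^ 2 + C δ * X 2 ^ 4 : MvPolynomial (Fin 3) k)
      = (C e2 * (X 1 + C (t + ρ) * X 2 ^ 2)) * (X 1 + C (t - ρ) * X 2 ^ 2) := by
      rw [hρ']; simp only [C_mul, C_add, C_sub, C_neg, C_pow]; ring
    rw [hbf, e] at hbar
    obtain ⟨q1, q2⟩ := fac D I hI hlnd _ _ (hnoy _ (by simpa using he2))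
        (hnoy _ (by simp)) hbar
    rw [Derivation.leibniz, hCD, smul_zero, add_zero, smul_eq_mul] at q1
    replace q1 := unC _ _ he2 q1
    have dd : ∀ τ : k, D (X 1 + C τ * X 2 ^ 2) = D (X 1) + C τ * D (X 2 ^ 2) := by
      intro τ
      rw [map_add, Derivation.leibniz, hCD]; simp only [smul_eq_mul]; ring
    rw [dd] at q1 q2
    have h3 : D (X 2 ^ 2) ∈ I := by
      apply unC (2 * ρ) _ (mul_ne_zero two_ne_zero hρ0)
      have := I.sub_mem q1 q2
      convert this using 1
      simp only [C_mul, C_add, C_sub, map_ofNat]; ring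
    refine contra ?_ (sqz h3)
    have := I.sub_mem q1 (I.mul_mem_left (C (t + ρ)) h3)
    rwa [add_sub_cancel_right] at this
  subst hδ0
  rw [hbf, C_0, zero_mul, add_zero] at he
  have he1 : e1 ≠ 0 := by
    rintro rfl
    rw [C_0, zero_mul, zero_add] at he
    have hne : (X 1 + C t * X 2 ^ 2 : MvPolynomial (Fin 3) k) ≠ 0 := by
      intro h0
      exact hy t (by rw [h0, map_zero])
    have hCe : (C e2 : MvPolynomial (Fin 3) k) ≠ 0 := by simpa using he2
    refine hy t (fac0 D hlnd (C e2 * (X 1 + C t * X 2 ^ 2)) (X 1 + C t * X 2 ^ 2)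
      (mul_ne_zero hCe hne) hne ?_).2
    rw [mul_assoc, ← sq, ← he, hDh]
  obtain ⟨φ, p0, p1, p2, p3⟩ := auto a b c s t e1 ha hs0 he1
  refine ⟨φ, p3, by rw [p0, hgf], ?_⟩
  rw [map_add, map_mul, map_pow, p0, p1, p2, ← hgf, he, ← hs, C_pow]
  ring

/-- Lemma 2.20 (lemma4): let `D` be an irreducible homogeneous locally nilpotent
derivation of `R = k[x,y,z]` (weights `(3,2,1)`) with `ker D = k[g,h]` for homogeneous
`g ∈ R₃`, `h ∈ R₄`. Then after a degree-preserving change of coordinates `α`,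
`ker D = k[x, xz + y²]` and `y` is a minimal local slice for `D`. -/
theorem statement_14 (k : Type) [Field k] [IsAlgClosed k] [CharZero k]
    (D : Derivation k (MvPolynomial (Fin 3) k) (MvPolynomial (Fin 3) k))
    (hlnd : IsLND D) (hirr : IsIrreducibleDeriv D)
    (hhom : ∃ m : ℤ, DerivIsHomogOfDeg w3 D m)
    (g h : MvPolynomial (Fin 3) k)
    (hg : g.IsWeightedHomogeneous w3 3) (hh : h.IsWeightedHomogeneous w3 4)
    (hker : ∀ r : MvPolynomial (Fin 3) k,
      D r = 0 ↔ r ∈ Algebra.adjoin k ({g, h} : Set (MvPolynomial (Fin 3) k))) :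
    ∃ α : MvPolynomial (Fin 3) k ≃ₐ[k] MvPolynomial (Fin 3) k,
      (∀ (i : ℕ) (r : MvPolynomial (Fin 3) k),
        r.IsWeightedHomogeneous w3 i → (α r).IsWeightedHomogeneous w3 i) ∧
      (∀ r : MvPolynomial (Fin 3) k, D r = 0 ↔
        r ∈ Algebra.adjoin k
          ({α.symm (X 0), α.symm (X 0 * X 2 + X 1 ^ 2)} : Set (MvPolynomial (Fin 3) k))) ∧
      IsMinimalLocalSlice D (α.symm (X 1)) := by
  have hD : ∃ b, D b ≠ 0 := by
    by_contra hc
    push Not at hc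
    exact not_isUnit_zero (hirr 0 fun r => by rw [hc]; exact Ideal.zero_mem _)
  have big : ∀ p : MvPolynomial (Fin 3) k,
      ¬ ∀ r, D r = 0 ↔ r ∈ Algebra.adjoin k ({p} : Set (MvPolynomial (Fin 3) k)) := by
    intro p hp
    have := bigker D hlnd hD p hp
    rw [MvPolynomial.trdeg_of_isDomain] at this
    simp at this
    exact absurd this (by norm_num)
  have z1 : ∀ p : MvPolynomial (Fin 3) k, Algebra.adjoin k ({0, p} : Set (MvPolynomial (Fin 3) k))
      = Algebra.adjoin k {p} := fun p => Algebra.adjoin_insert_zero _ _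
  have hg0 : g ≠ 0 := by
    rintro rfl
    rw [z1] at hker
    exact big h hker
  have hh0 : h ≠ 0 := by
    rintro rfl
    rw [Set.pair_comm, z1] at hker
    exact big g hker
  obtain ⟨φ, p1, p2, p3⟩ := main_aux D hlnd hirr g h hg0 hh0 hg hh hker
  refine ⟨φ.symm, p1, ?_, ?_⟩
  · rw [AlgEquiv.symm_symm, p2, p3]; exact hker
  · rw [AlgEquiv.symm_symm]
    refine endgame D hirr φ ?_ ?_
    · rw [p2, hker]; exact Algebra.subset_adjoin (by simp)
    · rw [p3, hker]; exact Algebra.subset_adjoin (by simp)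
end
end

section
/- Let 𝔤 be the ℕ-grading of R with x, y, z of degrees 3, 2, 1, let Γ = T(𝔤) ⊆ Aut_k(R) be the subtorus it determines, and let C(Γ) be the centralizer of Γ in Aut_k(R). Let h ∈ R_9 satisfy conditions (C3) and (C4). If α ∈ C(Γ) and α(h) = h, then α ∈ Γ; that is, there exists μ ∈ k* with α(x) = μ³x, α(y) = μ²y and α(z) = μz. -/
open MvPolynomial

set_option synthInstance.maxHeartbeats 400000
set_option maxHeartbeats 1000000

noncomputable section

/-- Conditions (C3) and (C4): `f(x,y,0) = x (p x² + q y³)` with `p, q ∈ k*`, and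
`f_z(x,y,0) = y (r x² + s y³)` with `r, s ∈ k` such that `det (3p r; q s) = 3ps - qr ≠ 0`. -/
def CondC3C4 (k : Type) [Field k] (f : MvPolynomial (Fin 3) k) : Prop :=
  ∃ p q r s : k, p ≠ 0 ∧ q ≠ 0 ∧
    aeval ![X 0, X 1, 0] f = X 0 * (C p * X 0 ^ 2 + C q * X 1 ^ 3) ∧
    aeval ![X 0, X 1, 0] (pderiv 2 f) = X 1 * (C r * X 0 ^ 2 + C s * X 1 ^ 3) ∧
    3 * p * s - q * r ≠ 0

/-- `α` belongs to the subtorus `Γ = T(𝔤)` of `Aut_k(R)` determined by the `ℕ`-grading of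
`R = k[x,y,z]` with weights `(3,2,1)`: for some `t ∈ k*`, `α` multiplies each homogeneous
element of degree `i` by `tⁱ`. -/
def InGamma {k : Type} [Field k] (α : MvPolynomial (Fin 3) k ≃ₐ[k] MvPolynomial (Fin 3) k) :
    Prop :=
  ∃ t : kˣ, ∀ (i : ℕ) (r : MvPolynomial (Fin 3) k),
    r.IsWeightedHomogeneous w3 i → α r = ((t : k) ^ i) • r

def bHom {k : Type} [Field k] (t : k) : MvPolynomial (Fin 3) k →ₐ[k] MvPolynomial (Fin 3) k :=
  aeval fun i => C (t ^ w3 i) * X i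

lemma bHom_comp {k : Type} [Field k] (t u : k) (h : t * u = 1) :
    (bHom t).comp (bHom u) = AlgHom.id k _ := by
  ext1 i
  simp only [bHom, AlgHom.comp_apply, aeval_X, map_mul, AlgHom.id_apply]
  rw [← algebraMap_eq, AlgHom.commutes, algebraMap_eq, ← mul_assoc, ← C_mul, ← mul_pow, mul_comm u, h]
  simp

lemma bHom_coeff {k : Type} [Field k] (t : k) (r : MvPolynomial (Fin 3) k) (d : Fin 3 →₀ ℕ) :
    coeff d (bHom t r) = t ^ (Finsupp.weight w3 d) * coeff d r := by
  induction r using MvPolynomial.induction_on' with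
  | add p q hp hq => rw [map_add, coeff_add, coeff_add, hp, hq, mul_add]
  | monomial u a =>
    have : bHom t (monomial u a) = monomial u (t ^ (Finsupp.weight w3 u) * a) := by
      rw [bHom, aeval_monomial, monomial_eq, algebraMap_eq, Finsupp.prod_fintype _ _ (by simp),
        Finsupp.prod_fintype _ _ (by simp)]
      simp only [mul_pow, Finset.prod_mul_distrib, C_mul, ← C_pow, ← map_prod, ← pow_mul,
        Finset.prod_pow_eq_pow_sum]
      have : Finsupp.weight w3 u = ∑ i, w3 i * u i := by
        rw [Finsupp.weight_apply, Finsupp.sum_fintype _ _ (by simp)]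
        simp [mul_comm]
      rw [this]
      ring
    rw [this, coeff_monomial, coeff_monomial]
    split_ifs with h
    · rw [h]
    · simp

lemma bHom_hom {k : Type} [Field k] (t : k) (r : MvPolynomial (Fin 3) k) (n : ℕ)
    (h : r.IsWeightedHomogeneous w3 n) : bHom t r = (t ^ n) • r := by
  ext d
  rw [bHom_coeff, coeff_smul, smul_eq_mul]
  by_cases hd : coeff d r = 0
  · simp [hd]
  · rw [h hd]

def bEquiv {k : Type} [Field k] (t : kˣ) : MvPolynomial (Fin 3) k ≃ₐ[k] MvPolynomial (Fin 3) k :=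
  AlgEquiv.ofAlgHom (bHom (t : k)) (bHom ((t⁻¹ : kˣ) : k))
    (bHom_comp _ _ (by simp)) (bHom_comp _ _ (by simp))

lemma bEquiv_gamma {k : Type} [Field k] (t : kˣ) : InGamma (bEquiv t) :=
  ⟨t, fun i r h => bHom_hom _ r i h⟩

def ee (n i j : ℕ) : Fin 3 →₀ ℕ := Finsupp.equivFunOnFinite.symm ![i, j, n - 3 * i - 2 * j]

lemma hom_expand {k : Type} [Field k] (n : ℕ) (r : MvPolynomial (Fin 3) k)
    (h : r.IsWeightedHomogeneous w3 n) :
    r = ∑ i ∈ Finset.range (n / 3 + 1), ∑ j ∈ Finset.range ((n - 3 * i) / 2 + 1),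
      C (coeff (ee n i j) r) * (X 0 ^ i * X 1 ^ j * X 2 ^ (n - 3 * i - 2 * j)) := by
  have hm : ∀ i j, C (coeff (ee n i j) r) * (X 0 ^ i * X 1 ^ j * X 2 ^ (n - 3 * i - 2 * j)) =
      monomial (ee n i j) (coeff (ee n i j) r) := by
    intro i j
    rw [monomial_eq, Finsupp.prod_fintype _ _ (by simp), Fin.prod_univ_three]
    simp [ee]
  simp only [hm]
  ext d
  simp only [coeff_sum, coeff_monomial]
  by_cases hd : coeff d r = 0
  · rw [hd]
    symm
    refine Finset.sum_eq_zero fun i _ => Finset.sum_eq_zero fun j _ => ?_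
    split_ifs with he
    · rw [he, hd]
    · rfl
  · have hw := h hd
    rw [Finsupp.weight_apply, Finsupp.sum_fintype _ _ (by simp), Fin.sum_univ_three] at hw
    simp [w3] at hw
    have he : ee n (d 0) (d 1) = d := by
      ext l
      fin_cases l <;> simp [ee]
      omega
    rw [Finset.sum_eq_single (d 0), Finset.sum_eq_single (d 1)]
    · rw [if_pos he, he]
    · intro j _ hj
      rw [if_neg]
      intro hc
      apply hj
      rw [← hc]; simp [ee]
    · intro hc
      exfalso; apply hc
      rw [Finset.mem_range]; omega
    · intro i _ hi
      refine Finset.sum_eq_zero fun j _ => ?_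
      rw [if_neg]
      intro hc
      apply hi
      rw [← hc]; simp [ee]
    · intro hc
      exfalso; apply hc
      rw [Finset.mem_range]; omega

lemma alpha_hom {k : Type} [Field k] [CharZero k]
    (α : MvPolynomial (Fin 3) k ≃ₐ[k] MvPolynomial (Fin 3) k)
    (hcent : ∀ β : MvPolynomial (Fin 3) k ≃ₐ[k] MvPolynomial (Fin 3) k,
      InGamma β → α * β = β * α) (i : Fin 3) :
    (α (X i)).IsWeightedHomogeneous w3 (w3 i) := by
  intro d hd
  have h2 : (2 : k) ≠ 0 := two_ne_zero
  have h := hcent _ (bEquiv_gamma (Units.mk0 (2 : k) h2))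
  have h1 := congrArg (coeff d) (DFunLike.congr_fun h (X i))
  simp only [AlgEquiv.mul_apply] at h1
  have e1 : bEquiv (Units.mk0 (2 : k) h2) (X i) = ((2 : k) ^ w3 i) • X i :=
    bHom_hom _ _ _ (isWeightedHomogeneous_X k w3 i)
  have e2 : coeff d (bEquiv (Units.mk0 (2 : k) h2) (α (X i))) =
    (2 : k) ^ (Finsupp.weight w3 d) * coeff d (α (X i)) := bHom_coeff _ _ _
  rw [e2, e1, map_smul, coeff_smul, smul_eq_mul] at h1
  have h3 := mul_right_cancel₀ hd h1
  have h4 : (2 : ℕ) ^ w3 i = 2 ^ (Finsupp.weight w3 d) := by exact_mod_cast h3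
  exact (Nat.pow_right_injective le_rfl h4).symm

set_option maxHeartbeats 4000000 in
theorem key (k : Type) [Field k] [CharZero k]
    (h : MvPolynomial (Fin 3) k)
    (hh9 : h.IsWeightedHomogeneous w3 9)
    (hC34 : CondC3C4 k h)
    (α : MvPolynomial (Fin 3) k ≃ₐ[k] MvPolynomial (Fin 3) k)
    (hcent : ∀ β : MvPolynomial (Fin 3) k ≃ₐ[k] MvPolynomial (Fin 3) k,
      InGamma β → α * β = β * α)
    (hfix : α h = h) :
    ∃ μ : k, μ ≠ 0 ∧
      α (X 0) = (μ ^ 3) • (X 0 : MvPolynomial (Fin 3) k) ∧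
      α (X 1) = (μ ^ 2) • (X 1 : MvPolynomial (Fin 3) k) ∧
      α (X 2) = μ • (X 2 : MvPolynomial (Fin 3) k) := by
  have H0 := hom_expand _ _ (alpha_hom α hcent 0)
  have H1 := hom_expand _ _ (alpha_hom α hcent 1)
  have H2 := hom_expand _ _ (alpha_hom α hcent 2)
  have H := hom_expand _ _ hh9
  simp [w3, Finset.sum_range_succ] at H0 H1 H2 H
  generalize coeff (ee 3 0 0) (α (X 0)) = A at H0
  generalize coeff (ee 3 0 1) (α (X 0)) = a' at H0
  generalize coeff (ee 3 1 0) (α (X 0)) = a at H0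
  generalize coeff (ee 2 0 0) (α (X 1)) = B at H1
  generalize coeff (ee 2 0 1) (α (X 1)) = b at H1
  generalize coeff (ee 1 0 0) (α (X 2)) = c at H2
  generalize coeff (ee 9 0 0) h = h00 at H
  generalize coeff (ee 9 0 1) h = h01 at H
  generalize coeff (ee 9 0 2) h = h02 at H
  generalize coeff (ee 9 0 3) h = h03 at H
  generalize coeff (ee 9 0 4) h = h04 at H
  generalize coeff (ee 9 1 0) h = h10 at H
  generalize coeff (ee 9 1 1) h = h11 at H
  generalize coeff (ee 9 1 2) h = h12 at H
  generalize coeff (ee 9 1 3) h = h13 at H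
  generalize coeff (ee 9 2 0) h = h20 at H
  generalize coeff (ee 9 2 1) h = h21 at H
  generalize coeff (ee 9 3 0) h = h30 at H
  have hCC : ∀ u : k, α (C u) = C u := fun u => α.commutes u
  obtain ⟨p, q, r, s, hp, hq, e3, e4, hdet⟩ := hC34
  subst H
  have p1 := congrArg (eval (fun n : ℕ => if n = 0 then (1 : k) else 0)) e3
  have p2 := congrArg (eval (fun n : ℕ => if n = 0 then (1 : k) else 1)) e3
  have p3 := congrArg (eval (fun n : ℕ => if n = 0 then (0 : k) else 1)) e4
  have p4 := congrArg (eval (fun n : ℕ => if n = 0 then (1 : k) else 1)) e4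
  simp [pderiv_X, Pi.single_apply] at p1 p2 p3 p4
  subst p1
  subst p3
  have p2' : h13 = q := by linear_combination p2
  have p4' : h21 = r := by linear_combination p4
  subst p2'
  subst p4'
  clear p2 p4 e3 e4 hh9
  simp only [map_add, map_mul, map_pow, hCC, H0, H1, H2] at hfix
  have E := fun x0 y0 : k =>
    congrArg (aeval ![Polynomial.C x0, Polynomial.C y0, (Polynomial.X : Polynomial k)]) hfix
  have hA : ∀ u : k, algebraMap k (Polynomial k) u = Polynomial.C u := fun u => rfl
  simp [hA] at E
  have q1 := congrArg (Polynomial.eval 0) (E 1 0)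
  have q2 := congrArg (Polynomial.eval 0) (E 1 1)
  have q3 := congrArg (fun f => Polynomial.eval 0 (Polynomial.derivative f)) (E 0 1)
  have q4 := congrArg (fun f => Polynomial.eval 0 (Polynomial.derivative f)) (E 1 1)
  simp [Polynomial.derivative_pow] at q1 q2 q3 q4
  have a3 : a ^ 3 = 1 := by
    apply mul_left_cancel₀ hp
    linear_combination q1
  have ab : a * b ^ 3 = 1 := by
    apply mul_left_cancel₀ hq
    linear_combination q2 - q1
  have r1 : 3 * h30 * a' = h21 * (a - c * b) := by
    linear_combination a * (q4 - q3) - 3 * h30 * a' * a3 - h21 * c * b * a3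
  have r2 : h13 * a' = h04 * (a - c * b) := by
    linear_combination a * q3 - h13 * a' * ab - h04 * c * b * ab
  have ha' : a' = 0 := by
    have : a' * (3 * h30 * h04 - h13 * h21) = 0 := by
      linear_combination h04 * r1 - h21 * r2
    exact (mul_eq_zero.mp this).resolve_right hdet
  have hacb : a - c * b = 0 := by
    have : (a - c * b) * (3 * h30 * h04 - h13 * h21) = 0 := by
      linear_combination -3 * h30 * r2 + h13 * r1
    exact (mul_eq_zero.mp this).resolve_right hdet
  have ha0 : a ≠ 0 := by rintro rfl; simp at a3
  have hb0 : b ≠ 0 := by rintro rfl; simp at ab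
  have hc0 : c ≠ 0 := by rintro rfl; apply ha0; linear_combination hacb
  have hac : a = c ^ 3 := by
    have h1 : a = c * b := by linear_combination hacb
    have h2 : b ^ 3 * (a - c ^ 3) = 0 := by
      have : (c * b) ^ 3 = 1 := by rw [← h1, a3]
      linear_combination ab - this
    linear_combination (mul_eq_zero.mp h2).resolve_left (pow_ne_zero 3 hb0)
  have hbc : b = c ^ 2 := by
    apply mul_left_cancel₀ hc0
    linear_combination hac - hacb
  have c9 : c ^ 9 = 1 := by rw [← a3, hac]; ring
  clear q1 q2 q3 q4 r1 r2 hacb ab a3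
  subst ha'
  have q5 := congrArg (fun f => Polynomial.eval 0 (Polynomial.derivative (Polynomial.derivative f)))
    (E 1 1)
  simp [Polynomial.derivative_pow] at q5
  have hB : B = 0 := by
    have : 6 * h13 * a * b ^ 2 * B = 0 := by
      subst hac hbc
      linear_combination q5 - 2 * h12 * c9
    simpa [hq, ha0, hb0] using this
  subst hB
  have q6 := congrArg (fun f => Polynomial.eval 0 (Polynomial.derivative (Polynomial.derivative
    (Polynomial.derivative f)))) (E 1 0)
  simp [Polynomial.derivative_pow] at q6
  have hA0 : A = 0 := by
    have : 18 * h30 * a ^ 2 * A = 0 := by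
      subst hac hbc
      linear_combination q6 - 6 * h20 * c9
    simpa [hp, ha0] using this
  subst hA0
  refine ⟨c, hc0, ?_, ?_, ?_⟩
  · rw [H0, hac, smul_eq_C_mul]; simp
  · rw [H1, hbc, smul_eq_C_mul]; simp
  · rw [H2, smul_eq_C_mul]

theorem statement_17 (k : Type) [Field k] [IsAlgClosed k] [CharZero k]
    (h : MvPolynomial (Fin 3) k)
    (hh9 : h.IsWeightedHomogeneous w3 9)
    (hC34 : CondC3C4 k h)
    (α : MvPolynomial (Fin 3) k ≃ₐ[k] MvPolynomial (Fin 3) k)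
    (hcent : ∀ β : MvPolynomial (Fin 3) k ≃ₐ[k] MvPolynomial (Fin 3) k,
      InGamma β → α * β = β * α)
    (hfix : α h = h) :
    InGamma α ∧ ∃ μ : k, μ ≠ 0 ∧
      α (X 0) = (μ ^ 3) • (X 0 : MvPolynomial (Fin 3) k) ∧
      α (X 1) = (μ ^ 2) • (X 1 : MvPolynomial (Fin 3) k) ∧
      α (X 2) = μ • (X 2 : MvPolynomial (Fin 3) k) := by
  obtain ⟨μ, h0, h1, h2, h3⟩ := key k h hh9 hC34 α hcent hfix
  refine ⟨⟨Units.mk0 μ h0, fun i r hr => ?_⟩, μ, h0, h1, h2, h3⟩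
  have e : (α : MvPolynomial (Fin 3) k →ₐ[k] MvPolynomial (Fin 3) k) = bHom μ := by
    ext1 i
    fin_cases i
    · simpa [bHom, w3, smul_eq_C_mul] using h1
    · simpa [bHom, w3, smul_eq_C_mul] using h2
    · simpa [bHom, w3, smul_eq_C_mul] using h3
  have e2 : α r = bHom μ r := DFunLike.congr_fun e r
  rw [e2]
  exact bHom_hom _ _ _ hr
end
end
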